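/- arXiv:2406.14853 — 2 statements merged into one kernel-verified Lean document; each statement's English description precedes it below -/
import Mathlib

section
/- Suppose (Ψ1), (Ψ2), (Ψ3), (Φ1), (Φ2), (IB), (E) and (SMP) hold. Then the minimax values at λ = 1 diverge: c_k(1) → ∞ as k → ∞. -/
open Set Filter Metric Bornology Topology

namespace BU

section comb
variable {V W : Type*}

def faces : List V → List (List V)
  | [] => []
  | x :: l => l :: (faces l).map (fun t => x :: t)

def prism (sh : V → V) : List V → List (List V)
  | [] => []
  | x :: l => (x :: sh x :: l.map sh) :: (prism sh l).map (fun t => x :: t)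

def ev (φ : List V → ZMod 2) (C : List (List V)) : ZMod 2 := (C.map φ).sum

theorem ev_nil (φ : List V → ZMod 2) : ev φ [] = 0 := rfl
theorem ev_cons (φ : List V → ZMod 2) (a C) : ev φ (a :: C) = φ a + ev φ C := by
  simp [ev]
theorem ev_append (φ : List V → ZMod 2) (C D) : ev φ (C ++ D) = ev φ C + ev φ D := by
  simp [ev]
theorem ev_map (φ : List W → ZMod 2) (g : List V → List W) (C) :
    ev φ (C.map g) = ev (fun t => φ (g t)) C := by
  simp [ev, Function.comp_def]
theorem ev_flatMap {α : Type*} (φ : List W → ZMod 2) (g : α → List (List W)) (C : List α) :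
    ev φ (C.flatMap g) = (C.map (fun t => ev φ (g t))).sum := by
  induction C with
  | nil => simp [ev]
  | cons a C ih => simp [ev_append, ih]
theorem ev_flatMap' (φ : List W → ZMod 2) (g : List V → List (List W)) (C) :
    ev φ (C.flatMap g) = ev (fun t => ev φ (g t)) C := ev_flatMap φ g C
theorem ev_add (φ ψ : List V → ZMod 2) (C) :
    ev (fun t => φ t + ψ t) C = ev φ C + ev ψ C := by
  simp [ev, List.sum_map_add]
theorem ev_congr {φ ψ : List V → ZMod 2} {C} (h : ∀ s ∈ C, φ s = ψ s) : ev φ C = ev ψ C := by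
  unfold ev; rw [List.map_congr_left h]
theorem ev_zero {φ : List V → ZMod 2} {C} (h : ∀ s ∈ C, φ s = 0) : ev φ C = 0 := by
  rw [ev_congr (ψ := fun _ => 0) h]; simp [ev]

theorem two_zero (a : ZMod 2) : a + a = 0 := CharTwo.add_self_eq_zero a

theorem faces_map (g : V → W) (l : List V) : faces (l.map g) = (faces l).map (List.map g) := by
  induction l with
  | nil => rfl
  | cons x l ih => simp [faces, ih]

theorem prism_id (sh : V → V) (φ : List V → ZMod 2) (l : List V) :
    ev (fun s => ev φ (faces s)) (prism sh l)
      = φ l + φ (l.map sh) + ev (fun t => ev φ (prism sh t)) (faces l) := by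
  induction l generalizing φ with
  | nil => simp [prism, faces, ev, two_zero]
  | cons x l ih =>
    have h := ih (fun t => φ (x :: t))
    simp only [prism, faces, ev_cons, ev_map, ev_add, List.map_cons, faces_map] at h ⊢
    have e1 : ev (fun t => t.length • (0 : ZMod 2) + φ t) (prism sh l) = ev φ (prism sh l) := by
      simp
    rw [h]
    generalize ev (fun t => φ (x :: sh x :: t.map sh)) (faces l) = A
    generalize ev φ (prism sh l) = B
    generalize ev (fun t => ev (fun t => φ (x :: t)) (prism sh t)) (faces l) = D
    generalize φ (x :: l) = p
    generalize φ (sh x :: List.map sh l) = q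
    generalize φ (x :: List.map sh l) = r
    have := two_zero r
    linear_combination this

theorem faces_sublist {l t : List V} (h : t ∈ faces l) : t.Sublist l := by
  induction l generalizing t with
  | nil => simp [faces] at h
  | cons x l ih =>
    simp only [faces, List.mem_cons, List.mem_map] at h
    rcases h with rfl | ⟨s, hs, rfl⟩
    · exact List.sublist_cons_self x t
    · exact (ih hs).cons_cons x

theorem faces_length {l t : List V} (h : t ∈ faces l) : t.length + 1 = l.length := by
  induction l generalizing t with
  | nil => simp [faces] at h
  | cons x l ih =>
    simp only [faces, List.mem_cons, List.mem_map] at h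
    rcases h with rfl | ⟨s, hs, rfl⟩
    · simp
    · simpa using ih hs

theorem prism_mem {sh : V → V} {l t : List V} (h : t ∈ prism sh l) :
    t.length = l.length + 1 ∧ ∀ v ∈ t, v ∈ l ∨ ∃ w ∈ l, v = sh w := by
  induction l generalizing t with
  | nil => simp [prism] at h
  | cons x l ih =>
    simp only [prism, List.mem_cons, List.mem_map] at h
    rcases h with rfl | ⟨s, hs, rfl⟩
    · refine ⟨by simp, ?_⟩
      intro v hv
      simp only [List.mem_cons, List.mem_map] at hv ⊢
      rcases hv with rfl | rfl | ⟨w, hw, rfl⟩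
      · simp
      · right; exact ⟨x, by simp⟩
      · right; exact ⟨w, by simp [hw]⟩
    · obtain ⟨h1, h2⟩ := ih hs
      refine ⟨by simp [h1], ?_⟩
      intro v hv
      rcases List.mem_cons.1 hv with rfl | hv
      · simp
      · rcases h2 v hv with h | ⟨w, hw, rfl⟩
        · simp [h]
        · right; exact ⟨w, by simp [hw]⟩

/-- faces evaluation is permutation invariant -/
theorem ev_faces_perm {φ : List V → ZMod 2} (hφ : ∀ l l' : List V, l.Perm l' → φ l = φ l')
    {l l' : List V} (h : l.Perm l') : ev φ (faces l) = ev φ (faces l') := by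
  induction h generalizing φ with
  | nil => rfl
  | cons x h ih =>
    simp only [faces, ev_cons, ev_map]
    rw [hφ _ _ h, ih (fun l l' h => hφ _ _ (h.cons x))]
  | swap x y l =>
    simp only [faces, ev_cons, ev_map, List.map_cons]
    rw [ev_congr (φ := fun t => φ (y :: x :: t)) (ψ := fun t => φ (x :: y :: t))
      (fun s _ => hφ _ _ (List.Perm.swap _ _ _))]
    ring
  | trans h1 h2 i1 i2 => rw [i1 hφ, i2 hφ]

/-- alternating parity -/
def al : ZMod 2 → List ℕ → ZMod 2
  | _, [] => 1
  | s, a :: l => if (a : ZMod 2) = s then al (s + 1) l else 0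

theorem ev_al (s : ZMod 2) (l : List ℕ) (hl : l ≠ []) :
    ev (al s) (faces l) = al s l + al (s + 1) l := by
  induction l generalizing s with
  | nil => exact absurd rfl hl
  | cons a l ih =>
    have hs : s + 1 + 1 = s := by
      have := two_zero (1 : ZMod 2); linear_combination this
    have hne : s + 1 ≠ s := by simp
    simp only [faces, ev_cons, ev_map]
    by_cases hl' : l = []
    · subst hl'
      simp only [faces, ev_nil, al]
      have h2 : ∀ x y : ZMod 2, (1 : ZMod 2) + 0 = (if x = y then 1 else 0) +
        (if x = y + 1 then 1 else 0) := by decide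
      exact h2 _ _
    · by_cases ha : (a : ZMod 2) = s
      · have h1 : ev (fun t => al s (a :: t)) (faces l) = ev (al (s + 1)) (faces l) := by
          simp [al, ha]
        rw [h1, ih _ hl', hs]
        have h3 : ¬ (s = s + 1) := fun h => hne h.symm
        simp only [al, ha, if_true, if_neg h3]
        have := two_zero (al s l)
        linear_combination this
      · have ha' : (a : ZMod 2) = s + 1 := by
          revert ha; generalize (a : ZMod 2) = x; revert s x; decide
        have h1 : ev (fun t => al s (a :: t)) (faces l) = 0 := by
          apply ev_zero; intro t _; simp only [al, if_neg ha]
        rw [h1]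
        simp only [al, if_neg ha, if_pos ha', hs]
        ring

/-- the basic cochain on sorted label lists -/
def A0 : List ℕ → ZMod 2
  | [] => 0
  | a :: l => if a = 0 then al 1 l else 0

def srt (l : List ℕ) : List ℕ := l.mergeSort (fun a b => decide (a ≤ b))

theorem srt_perm (l : List ℕ) : (srt l).Perm l := List.mergeSort_perm _ _
theorem srt_sorted (l : List ℕ) : (srt l).Pairwise (· ≤ ·) := by
  have := List.pairwise_mergeSort (le := fun a b : ℕ => decide (a ≤ b))
    (by intro a b c; simp; omega) (by intro a b; simp; omega) l
  simpa [srt] using this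
theorem srt_eq {l m : List ℕ} (h : l.Perm m) (hm : m.Pairwise (· ≤ ·)) : srt l = m :=
  List.Perm.eq_of_pairwise (fun a b _ _ h1 h2 => le_antisymm h1 h2) (srt_sorted l) hm
    ((srt_perm l).trans h)

def Ac (l : List ℕ) : ZMod 2 := A0 (srt l)

theorem Ac_perm (l l' : List ℕ) (h : l.Perm l') : Ac l = Ac l' := by
  unfold Ac
  rw [srt_eq (h.trans (srt_perm l').symm) (srt_sorted l')]

/-- label swapping -/
def sw (a : ℕ) : ℕ := if a = 0 then 0 else if a % 2 = 1 then a + 1 else a - 1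

theorem Ac_no_zero {l : List ℕ} (h : 0 ∉ l) : Ac l = 0 := by
  unfold Ac
  have : 0 ∉ srt l := fun h' => h ((srt_perm l).mem_iff.1 h')
  cases hs : srt l with
  | nil => rfl
  | cons a r =>
    rw [hs] at this
    simp only [List.mem_cons, not_or] at this
    simp [A0, Ne.symm this.1]

theorem al_sw (s : ZMod 2) (r : List ℕ) (h : 0 ∉ r) : al s (r.map sw) = al (s + 1) r := by
  induction r generalizing s with
  | nil => rfl
  | cons a r ih =>
    simp only [List.mem_cons, not_or] at h
    simp only [List.map_cons, al]
    have ha : ((sw a : ℕ) : ZMod 2) = (a : ZMod 2) + 1 := by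
      unfold sw
      rw [if_neg (Ne.symm h.1)]
      split_ifs with h1
      · push_cast; rfl
      · obtain ⟨b, rfl⟩ : ∃ b, a = b + 1 := ⟨a - 1, by omega⟩
        have := two_zero (1 : ZMod 2)
        rw [Nat.add_sub_cancel]
        push_cast
        linear_combination -this
    rw [ha, ih _ h.2]
    have : ((a : ZMod 2) + 1 = s) ↔ ((a : ZMod 2) = s + 1) := by
      generalize (a : ZMod 2) = x; revert s x; decide
    simp only [this]

theorem Ac_coboundary (l : List ℕ) (hlen : 2 ≤ l.length)
    (hc : 0 ∈ l → ∀ a ∈ l, ∀ b ∈ l, a ≤ b → sw a ≤ sw b) :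
    ev Ac (faces l) = Ac l + Ac (l.map sw) := by
  by_cases h0 : 0 ∈ l
  swap
  · rw [Ac_no_zero h0, Ac_no_zero (l := l.map sw), ev_zero, add_zero]
    · intro s hs
      exact Ac_no_zero (fun h => h0 ((faces_sublist hs).subset h))
    · intro h
      obtain ⟨a, ha, h1⟩ := List.mem_map.1 h
      unfold sw at h1
      split_ifs at h1 <;> first | (subst a; exact h0 ha) | omega
  have hc := hc h0
  have hsw : srt (l.map sw) = (srt l).map sw := by
    apply srt_eq ((srt_perm l).symm.map sw)
    rw [List.pairwise_map]
    refine (srt_sorted l).imp_of_mem ?_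
    intro a b ha hb hab
    exact hc a ((srt_perm l).mem_iff.1 ha) b ((srt_perm l).mem_iff.1 hb) hab
  rw [ev_faces_perm Ac_perm (srt_perm l).symm]
  have hev : ev Ac (faces (srt l)) = ev A0 (faces (srt l)) := by
    apply ev_congr
    intro s hs
    unfold Ac
    rw [srt_eq (List.Perm.refl s) ((srt_sorted l).sublist (faces_sublist hs))]
  rw [hev]; unfold Ac; rw [hsw]
  have hsorted := srt_sorted l
  have hmem : 0 ∈ srt l := (srt_perm l).mem_iff.2 h0
  have hlen' : 2 ≤ (srt l).length := by rw [(srt_perm l).length_eq]; exact hlen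
  generalize srt l = m at *
  match m, hlen' with
  | a :: b :: r, _ =>
    have ha : a = 0 := by
      rcases List.mem_cons.1 hmem with h | h
      · exact h.symm
      · have := (List.pairwise_cons.1 hsorted).1 0 h
        omega
    subst ha
    rw [faces, ev_cons, ev_map]
    have h1 : ev (fun t => A0 (0 :: t)) (faces (b :: r)) = al 1 (b :: r) + al (1 + 1) (b :: r) := by
      rw [← ev_al 1 (b :: r) (by simp)]; rfl
    rw [h1]
    have h10 : (1 : ZMod 2) + 1 = 0 := two_zero 1
    by_cases hb : b = 0
    · subst hb
      have hz : (0 : ZMod 2) ≠ 1 := by decide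
      simp only [A0, al, sw, List.map_cons, if_true, Nat.cast_zero, if_neg hz, h10]
      simp [two_zero]
    · have hr : 0 ∉ b :: r := by
        intro h
        rcases List.mem_cons.1 h with h | h
        · exact hb h.symm
        · have := (List.pairwise_cons.1 (List.pairwise_cons.1 hsorted).2).1 0 h
          omega
      have h3 : A0 ((0 :: b :: r).map sw) = al (1 + 1) (b :: r) := by
        rw [← al_sw 1 _ hr]; simp [A0, sw]
      rw [h3]
      simp [A0, hb]

end comb
end BU

namespace BU

section chains
variable {V : Type*} [NormedAddCommGroup V] [NormedSpace ℝ V]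

noncomputable def Hs (e : ℕ → V) (R : ℕ) (d : ℕ) (C : List (List V)) : List (List V) :=
  (List.range R).flatMap fun t => C.flatMap fun σ =>
    prism (fun v => v + ((R : ℝ)⁻¹) • e d) (σ.map (fun v => v + ((t : ℝ) * (R : ℝ)⁻¹) • e d))

noncomputable def Ch (e : ℕ → V) (R : ℕ) : ℕ → List (List V)
  | 0 => [[0]]
  | d + 1 => Hs e R d (Ch e R d) ++ (Hs e R d (Ch e R d)).map (List.map Neg.neg)

theorem Ch_neg (e : ℕ → V) (R : ℕ) (d : ℕ) (φ : List V → ZMod 2) :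
    ev (fun σ => φ (σ.map Neg.neg)) (Ch e R d) = ev φ (Ch e R d) := by
  cases d with
  | zero => simp [Ch, ev]
  | succ d =>
    simp only [Ch, ev_append, ev_map]
    rw [add_comm]
    congr 1
    apply ev_congr
    intro s _
    simp

def good (co : ℕ → V →ₗ[ℝ] ℝ) (k R d : ℕ) (σ : List V) : Prop :=
  σ.length = d + 1 ∧ (∀ v ∈ σ, ‖v‖ ≤ d ∧ ∀ i, d ≤ i → i < k → co i v = 0) ∧
    ∀ v ∈ σ, ∀ w ∈ σ, ‖v - w‖ ≤ d * (R : ℝ)⁻¹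

theorem good_H {e : ℕ → V} {co : ℕ → V →ₗ[ℝ] ℝ} {k R d : ℕ} (hd : d < k)
    (he : ∀ d < k, ‖e d‖ ≤ 1) (hco : ∀ i < k, ∀ d < k, i ≠ d → co i (e d) = 0)
    {C : List (List V)} (hC : ∀ σ ∈ C, good co k R d σ) :
    ∀ σ ∈ Hs e R d C, good co k R (d + 1) σ := by
  intro σ hσ
  simp only [Hs, List.mem_flatMap, List.mem_range] at hσ
  obtain ⟨t, ht, τ, hτ, hp⟩ := hσ
  obtain ⟨h1, h2, h3⟩ := hC τ hτ
  obtain ⟨p1, p2⟩ := prism_mem hp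
  have hR : (0 : ℝ) < R := by
    have : 0 < R := by omega
    exact_mod_cast this
  have key : ∀ v ∈ σ, ∃ w ∈ τ, v = w + ((t : ℝ) * (R : ℝ)⁻¹) • e d ∨
      v = w + (((t : ℝ) + 1) * (R : ℝ)⁻¹) • e d := by
    intro v hv
    rcases p2 v hv with h | ⟨w, hw, rfl⟩
    · obtain ⟨w, hw, rfl⟩ := List.mem_map.1 h
      exact ⟨w, hw, Or.inl rfl⟩
    · obtain ⟨w', hw', rfl⟩ := List.mem_map.1 hw
      refine ⟨w', hw', Or.inr ?_⟩
      module
  have ht1 : ((t : ℝ) + 1) * (R : ℝ)⁻¹ ≤ 1 := by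
    rw [← div_eq_mul_inv, div_le_one hR]; exact_mod_cast ht
  have hRi : 0 < (R : ℝ)⁻¹ := by positivity
  have hnorm : ∀ s : ℝ, 0 ≤ s → ‖s • e d‖ ≤ s := by
    intro s hs
    rw [norm_smul, Real.norm_of_nonneg hs]
    nlinarith [he d hd]
  have hdiff : ∀ s : ℝ, |s| ≤ (R : ℝ)⁻¹ → ‖s • e d‖ ≤ (R : ℝ)⁻¹ := by
    intro s hs
    rw [norm_smul, Real.norm_eq_abs]
    nlinarith [he d hd, abs_nonneg s]
  refine ⟨by rw [p1, List.length_map, h1], ?_, ?_⟩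
  · intro v hv
    obtain ⟨w, hw, h⟩ := key v hv
    obtain ⟨s, hs0, hs1, rfl⟩ : ∃ s : ℝ, 0 ≤ s ∧ s ≤ 1 ∧ v = w + s • e d := by
      rcases h with h | h
      · exact ⟨_, by positivity, by nlinarith, h⟩
      · exact ⟨_, by positivity, ht1, h⟩
    refine ⟨?_, ?_⟩
    · push_cast
      linarith [norm_add_le w (s • e d), hnorm s hs0, (h2 w hw).1]
    · intro i hi hik
      rw [map_add, map_smul, (h2 w hw).2 i (by omega) hik, hco i hik d hd (by omega)]
      simp
  · intro v hv v' hv'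
    obtain ⟨w, hw, h⟩ := key v hv
    obtain ⟨w', hw', h'⟩ := key v' hv'
    obtain ⟨s, hs, hvv⟩ : ∃ s : ℝ, |s| ≤ (R : ℝ)⁻¹ ∧ v - v' = (w - w') + s • e d := by
      rcases h with rfl | rfl <;> rcases h' with rfl | rfl
      · exact ⟨0, by simp, by module⟩
      · exact ⟨-(R : ℝ)⁻¹, by simp, by module⟩
      · exact ⟨(R : ℝ)⁻¹, by simp, by module⟩
      · exact ⟨0, by simp, by module⟩
    rw [hvv]
    push_cast
    have := h3 w hw w' hw'
    linarith [norm_add_le (w - w') (s • e d), hdiff s hs]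

theorem good_neg {co : ℕ → V →ₗ[ℝ] ℝ} {k R d : ℕ} {σ : List V} (h : good co k R d σ) :
    good co k R d (σ.map Neg.neg) := by
  obtain ⟨h1, h2, h3⟩ := h
  refine ⟨by simpa using h1, ?_, ?_⟩
  · intro v hv
    obtain ⟨w, hw, rfl⟩ := List.mem_map.1 hv
    exact ⟨by rw [norm_neg]; exact (h2 w hw).1, fun i hi hk => by
      rw [map_neg, (h2 w hw).2 i hi hk, neg_zero]⟩
  · intro v hv v' hv'
    obtain ⟨w, hw, rfl⟩ := List.mem_map.1 hv
    obtain ⟨w', hw', rfl⟩ := List.mem_map.1 hv'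
    have := h3 w' hw' w hw
    rwa [show -w - -w' = w' - w by abel]

theorem good_Ch {e : ℕ → V} {co : ℕ → V →ₗ[ℝ] ℝ} {k R : ℕ}
    (he : ∀ d < k, ‖e d‖ ≤ 1) (hco : ∀ i < k, ∀ d < k, i ≠ d → co i (e d) = 0)
    (d : ℕ) (hd : d ≤ k) : ∀ σ ∈ Ch e R d, good co k R d σ := by
  induction d with
  | zero =>
    intro σ hσ
    simp only [Ch, List.mem_singleton] at hσ
    subst hσ
    simp [good]
  | succ d ih =>
    intro σ hσ
    have hH := good_H (R := R) (e := e) (co := co) (k := k) (d := d) (by omega) he hco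
      (ih (by omega))
    simp only [Ch, List.mem_append] at hσ
    rcases hσ with h | h
    · exact hH σ h
    · obtain ⟨τ, hτ, rfl⟩ := List.mem_map.1 h
      exact good_neg (hH τ hτ)

def far (co : ℕ → V →ₗ[ℝ] ℝ) (d : ℕ) (v : V) : Prop := ∃ i < d, 1 ≤ |co i v|

theorem far_mono {co : ℕ → V →ₗ[ℝ] ℝ} {d d' : ℕ} (h : d ≤ d') {v : V} (hv : far co d v) :
    far co d' v := by
  obtain ⟨i, hi, h1⟩ := hv
  exact ⟨i, by omega, h1⟩

theorem sum_tel (a : ℕ → ZMod 2) (R : ℕ) :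
    ((List.range R).map (fun t => a t + a (t + 1))).sum = a 0 + a R := by
  induction R with
  | zero => simp [two_zero]
  | succ R ih =>
    rw [List.range_succ, List.map_append, List.sum_append, ih]
    simp only [List.map_cons, List.map_nil, List.sum_cons, List.sum_nil]
    have := two_zero (a R)
    linear_combination this

theorem bd_H {e : ℕ → V} {co : ℕ → V →ₗ[ℝ] ℝ} {k R d : ℕ} (hd : d < k) (hR : 0 < R)
    (hco : ∀ i < k, ∀ d < k, i ≠ d → co i (e d) = 0) (hco1 : ∀ i < k, co i (e i) = 1)
    {C : List (List V)} (hC : ∀ σ ∈ C, good co k R d σ)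
    (hB : ∀ φ : List V → ZMod 2, (∀ σ, (∀ v ∈ σ, far co d v) → φ σ = 0) →
      ev (fun σ => ev φ (faces σ)) C = 0)
    (φ : List V → ZMod 2) (hφ : ∀ σ, (∀ v ∈ σ, far co (d + 1) v) → φ σ = 0) :
    ev (fun σ => ev φ (faces σ)) (Hs e R d C) = ev φ C := by
  have hR' : (R : ℝ) ≠ 0 := by positivity
  set sh : V → V := fun v => v + ((R : ℝ)⁻¹) • e d with hsh
  set st : ℕ → V → V := fun t v => v + ((t : ℝ) * (R : ℝ)⁻¹) • e d with hst
  have hst1 : ∀ t, sh ∘ st t = st (t + 1) := by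
    intro t; funext v; simp only [hsh, hst, Function.comp]; push_cast; module
  have hfar_add : ∀ v : V, ∀ s : ℝ, far co d v → far co d (v + s • e d) := by
    rintro v s ⟨i, hi, h⟩
    exact ⟨i, hi, by rw [map_add, map_smul, hco i (by omega) d hd (by omega)]; simpa using h⟩
  unfold Hs
  rw [ev_flatMap]
  have hstep : ∀ t : ℕ, ev (fun σ => ev φ (faces σ)) (C.flatMap fun σ => prism sh (σ.map (st t)))
      = ev (fun σ => φ (σ.map (st t))) C + ev (fun σ => φ (σ.map (st (t + 1)))) C := by
    intro t
    rw [ev_flatMap']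
    simp only [prism_id, ev_add, faces_map, ev_map, List.map_map, hst1]
    rw [hB (fun τ => ev φ (prism sh (τ.map (st t)))), add_zero]
    intro σ hσ
    apply ev_zero
    intro s hs
    apply hφ
    intro v hv
    apply far_mono (Nat.le_succ d)
    rcases (prism_mem hs).2 v hv with h | ⟨w, hw, rfl⟩
    · obtain ⟨w, hw, rfl⟩ := List.mem_map.1 h
      exact hfar_add _ _ (hσ w hw)
    · obtain ⟨w', hw', rfl⟩ := List.mem_map.1 hw
      exact hfar_add _ _ (hfar_add _ _ (hσ w' hw'))
  have : ((List.range R).map (fun t => ev (fun σ => ev φ (faces σ))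
      (C.flatMap fun σ => prism sh (σ.map (st t))))).sum = ev φ C := by
    simp only [hstep]
    rw [sum_tel (fun t => ev (fun σ => φ (σ.map (st t))) C) R]
    have h0 : st 0 = id := by funext v; simp [hst]
    rw [h0]
    rw [ev_zero (φ := fun σ => φ (σ.map (st R)))]
    · simp
    · intro σ hσ
      apply hφ
      intro v hv
      obtain ⟨w, hw, rfl⟩ := List.mem_map.1 hv
      refine ⟨d, by omega, ?_⟩
      simp only [hst]
      rw [map_add, map_smul, hco1 d hd, ((hC σ hσ).2.1 w hw).2 d le_rfl hd, mul_inv_cancel₀ hR']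
      simp
  exact this

theorem bd_Ch {e : ℕ → V} {co : ℕ → V →ₗ[ℝ] ℝ} {k R : ℕ} (hR : 0 < R)
    (he : ∀ d < k, ‖e d‖ ≤ 1)
    (hco : ∀ i < k, ∀ d < k, i ≠ d → co i (e d) = 0) (hco1 : ∀ i < k, co i (e i) = 1)
    (d : ℕ) (hd : d ≤ k) :
    ∀ φ : List V → ZMod 2, (∀ σ, (∀ v ∈ σ, far co d v) → φ σ = 0) →
      ev (fun σ => ev φ (faces σ)) (Ch e R d) = 0 := by
  induction d with
  | zero =>
    intro φ hφ
    simp [Ch, ev, faces, hφ [] (by simp)]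
  | succ d ih =>
    intro φ hφ
    have hH := bd_H (by omega) hR hco hco1 (good_Ch he hco d (by omega)) (ih (by omega))
    simp only [Ch, ev_append, ev_map, faces_map]
    rw [hH φ hφ, hH (fun t => φ (t.map Neg.neg)), Ch_neg e R d φ, two_zero]
    intro σ hσ
    apply hφ
    intro v hv
    obtain ⟨w, hw, rfl⟩ := List.mem_map.1 hv
    obtain ⟨i, hi, h⟩ := hσ w hw
    exact ⟨i, hi, by rwa [map_neg, abs_neg]⟩

theorem exists_alt {e : ℕ → V} {co : ℕ → V →ₗ[ℝ] ℝ} {k R : ℕ} (hR : 0 < R)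
    (he : ∀ d < k, ‖e d‖ ≤ 1)
    (hco : ∀ i < k, ∀ d < k, i ≠ d → co i (e d) = 0) (hco1 : ∀ i < k, co i (e i) = 1)
    (L : V → ℕ) (hL0 : L 0 = 0) (hLz : ∀ v, L (-v) = 0 → L v = 0)
    (hLfar : ∀ v, far co k v → L v ≠ 0)
    (hmono : ∀ l : List V, (∀ v ∈ l, ‖v‖ ≤ k) → (∀ v ∈ l, ∀ w ∈ l, ‖v - w‖ ≤ k * (R : ℝ)⁻¹) →
      0 ∈ l.map L → (∀ a ∈ l.map L, ∀ b ∈ l.map L, a ≤ b → sw a ≤ sw b) ∧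
        ∀ v ∈ l, L (-v) = sw (L v)) :
    ∃ σ : List V, σ.length = k + 1 ∧ (∀ v ∈ σ, ‖v‖ ≤ k) ∧
      (∀ v ∈ σ, ∀ w ∈ σ, ‖v - w‖ ≤ k * (R : ℝ)⁻¹) ∧ Ac (σ.map L) ≠ 0 := by
  have hRi : 0 < (R : ℝ)⁻¹ := by positivity
  have main : ∀ d ≤ k, ev (fun σ => Ac (σ.map L)) (Ch e R d) = 1 := by
    intro d
    induction d with
    | zero =>
      intro _
      simp [Ch, ev, hL0, Ac, srt, A0, al]
    | succ d ih =>
      intro hd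
      have hg := good_H (R := R) (e := e) (co := co) (k := k) (d := d) (by omega) he hco
        (good_Ch he hco d (by omega))
      have hb := bd_H (by omega) hR hco hco1 (good_Ch he hco d (by omega))
        (bd_Ch hR he hco hco1 d (by omega)) (fun σ => Ac (σ.map L)) (by
          intro σ hσ
          apply Ac_no_zero
          intro h
          obtain ⟨v, hv, h⟩ := List.mem_map.1 h
          exact hLfar v (far_mono hd (hσ v hv)) h)
      rw [ih (by omega)] at hb
      rw [← hb]
      simp only [Ch, ev_append, ev_map]
      rw [← ev_add]
      apply ev_congr
      intro σ hσ
      obtain ⟨h1, h2, h3⟩ := hg σ hσ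
      have hdk : ((d + 1 : ℕ) : ℝ) ≤ k := by exact_mod_cast hd
      have hm := hmono σ (fun v hv => (h2 v hv).1.trans hdk)
        (fun v hv w hw => (h3 v hv w hw).trans (by gcongr))
      have := Ac_coboundary (σ.map L) (by simp [h1]) (fun h0 => (hm h0).1)
      rw [faces_map, ev_map] at this
      rw [this]
      congr 1
      by_cases h0 : 0 ∈ σ.map L
      · congr 1
        rw [List.map_map, List.map_map]
        apply List.map_congr_left
        intro v hv
        exact (hm h0).2 v hv
      · rw [Ac_no_zero, Ac_no_zero]
        · intro h
          obtain ⟨a, ha, h1⟩ := List.mem_map.1 h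
          unfold sw at h1
          split_ifs at h1 <;> first | (subst a; exact h0 ha) | omega
        · intro h
          rw [List.map_map] at h
          obtain ⟨v, hv, h1⟩ := List.mem_map.1 h
          exact h0 (List.mem_map.2 ⟨v, hv, hLz v h1⟩)
  have h := main k le_rfl
  by_contra hcon
  push Not at hcon
  rw [ev_zero] at h
  · exact absurd h (by decide)
  · intro σ hσ
    obtain ⟨h1, h2, h3⟩ := good_Ch (R := R) he hco k le_rfl σ hσ
    exact hcon σ h1 (fun v hv => (h2 v hv).1) h3

/-- pigeonhole: alternating sorted lists without complementary labels are short -/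
theorem al_len (r : List ℕ) (n : ℕ) (s : ZMod 2) (lo : ℕ) (hlo : ∀ a ∈ r, 2 * lo + 1 ≤ a)
    (hn : ∀ a ∈ r, a ≤ 2 * n)
    (hs : r.Pairwise (· ≤ ·)) (hc : ∀ i, 2 * i + 1 ∈ r → 2 * i + 2 ∈ r → False)
    (ha : al s r ≠ 0) : r.length + lo ≤ max n lo := by
  induction r generalizing s lo with
  | nil => simp
  | cons a r ih =>
    simp only [al] at ha
    split_ifs at ha with h
    · have ha1 := hlo a (by simp)
      have ha2 := hn a (by simp)
      obtain ⟨hs1, hs2⟩ := List.pairwise_cons.1 hs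
      obtain ⟨i, hi⟩ : ∃ i, a = 2 * i + 1 ∨ a = 2 * i + 2 := ⟨(a - 1) / 2, by omega⟩
      have key : ∀ b ∈ r, 2 * (i + 1) + 1 ≤ b := by
        intro b hb
        cases r with
        | nil => simp at hb
        | cons c r =>
          have hc1 := hs1 c (by simp)
          have hca : c ≠ a := by
            rintro rfl
            simp only [al] at ha
            rw [if_neg] at ha
            · exact ha rfl
            · rw [h]; simp
          have hcc : 2 * (i + 1) + 1 ≤ c := by
            rcases hi with rfl | rfl
            · by_contra hlt
              have : c = 2 * i + 2 := by omega
              subst this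
              exact hc i (by simp) (by simp)
            · omega
          rcases List.mem_cons.1 hb with rfl | hb
          · exact hcc
          · exact hcc.trans ((List.pairwise_cons.1 hs2).1 b hb)
      have := ih (s + 1) (i + 1) key (fun b hb => hn b (by simp [hb])) hs2
        (fun i h1 h2 => hc i (by simp [h1]) (by simp [h2])) ha
      simp only [List.length_cons]
      omega
    · exact absurd rfl ha

theorem Ac_len (l : List ℕ) (n : ℕ) (hn : 0 ∈ l → ∀ a ∈ l, a ≤ 2 * n)
    (hc : 0 ∈ l → ∀ i, 2 * i + 1 ∈ l → 2 * i + 2 ∈ l → False) (h : Ac l ≠ 0) :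
    l.length ≤ n + 1 := by
  have h0 : 0 ∈ l := by
    by_contra h0
    exact h (Ac_no_zero h0)
  have hc := hc h0
  have hn := hn h0
  rw [← (srt_perm l).length_eq]
  have hs := srt_sorted l
  have hm : ∀ a, a ∈ srt l → a ∈ l := fun a => (srt_perm l).mem_iff.1
  unfold Ac at h
  generalize srt l = m at *
  cases m with
  | nil => simp
  | cons a r =>
    simp only [A0] at h
    split_ifs at h with ha
    · subst ha
      have hr0 : ∀ b ∈ r, 1 ≤ b := by
        intro b hb
        cases r with
        | nil => simp at hb
        | cons c r =>
          have hc0 : c ≠ 0 := by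
            rintro rfl
            simp [al] at h
          rcases List.mem_cons.1 hb with rfl | hb
          · omega
          · have := (List.pairwise_cons.1 (List.pairwise_cons.1 hs).2).1 b hb
            omega
      have := al_len r n 1 0 (by simpa using hr0) (fun b hb => hn b (hm b (by simp [hb])))
        (List.pairwise_cons.1 hs).2
        (fun i h1 h2 => hc i (hm _ (by simp [h1])) (hm _ (by simp [h2]))) h
      simp only [List.length_cons]
      omega
    · exact absurd rfl h

end chains
end BU

namespace BU

theorem sw_mono_of {a b : ℕ} (hab : a ≤ b) (h : ∀ i, a = 2 * i + 1 → b = 2 * i + 2 → False) :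
    sw a ≤ sw b := by
  unfold sw
  have := h ((a - 1) / 2)
  by_cases h1 : a = 2 * ((a - 1) / 2) + 1
  · have h2 : ¬ (b = 2 * ((a - 1) / 2) + 2) := this h1
    split_ifs <;> omega
  · split_ifs <;> omega

open Classical in
noncomputable def idx {n : ℕ} (w : Fin n → ℝ) : ℕ :=
  if h : ∃ i : Fin n, w i = ‖w‖ then (h.choose : ℕ) else 0

theorem idx_spec {n : ℕ} (w : Fin n → ℝ) (hw : w ≠ 0) :
    ∃ hi : idx (fun j => |w j|) < n, |w ⟨idx (fun j => |w j|), hi⟩| = ‖w‖ := by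
  have hne : Nonempty (Fin n) := by
    by_contra h
    rw [not_nonempty_iff] at h
    exact hw (Subsingleton.elim _ _)
  have hnorm : ‖(fun j => |w j|)‖ = ‖w‖ := by
    simp [Pi.norm_def]
  have h : ∃ i : Fin n, (fun j => |w j|) i = ‖(fun j => |w j|)‖ := by
    obtain ⟨i, hi⟩ := Finite.exists_max (fun j => |w j|)
    refine ⟨i, le_antisymm ?_ ?_⟩
    · rw [hnorm]; exact norm_le_pi_norm w i
    · rw [hnorm]; exact (pi_norm_le_iff_of_nonneg (abs_nonneg _)).2 (fun j => hi j)
  have he : idx (fun j => |w j|) = (h.choose : ℕ) := by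
    unfold idx; rw [dif_pos h]
  have h2 : (fun j => |w j|) h.choose = ‖w‖ := h.choose_spec.trans hnorm
  refine ⟨by rw [he]; exact h.choose.2, ?_⟩
  rw [← h2]
  simp only [he]

open Classical in
theorem main {k n : ℕ} (hnk : n < k) (f : EuclideanSpace ℝ (Fin k) → (Fin n → ℝ))
    (hf : Continuous f) (hodd : ∀ x, f (-x) = - f x)
    (F1 F2 : Set (EuclideanSpace ℝ (Fin k))) (hF1 : IsClosed F1) (hF2 : IsClosed F2)
    (hs2 : ∀ x ∈ F2, -x ∈ F2) (hU : ∀ x, x ∈ F1 ∨ x ∈ F2)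
    (h0 : 0 ∈ F1) (hfar : ∀ x, 1 ≤ ‖x‖ → x ∈ F2) : ∃ x, x ∈ F1 ∧ x ∈ F2 ∧ f x = 0 := by
  by_contra hcon
  push Not at hcon
  have f0 : f 0 = 0 := by
    have := hodd 0
    rw [neg_zero] at this
    funext i
    have := congrFun this i
    simp only [Pi.neg_apply] at this
    simp only [Pi.zero_apply]
    linarith
  have h02 : (0 : EuclideanSpace ℝ (Fin k)) ∉ F2 := fun h => hcon 0 h0 h f0
  have hs2' : ∀ x, -x ∈ F2 ↔ x ∈ F2 := fun x => ⟨fun h => by simpa using hs2 _ h, hs2 x⟩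
  obtain ⟨m, hm, hmf⟩ : ∃ m > 0, ∀ x ∈ closedBall (0 : EuclideanSpace ℝ (Fin k)) k, x ∈ F2 →
      ∀ y ∈ F1, dist x y < m → m ≤ ‖f x‖ := by
    by_cases hne : (closedBall (0 : EuclideanSpace ℝ (Fin k)) k ∩ F2).Nonempty
    · have hc : IsCompact (closedBall (0 : EuclideanSpace ℝ (Fin k)) k ∩ F2) :=
        (isCompact_closedBall _ _).inter_right hF2
      obtain ⟨z, hz, hzm⟩ := hc.exists_isMinOn hne
        (f := fun x => ‖f x‖ + infDist x F1) (by fun_prop)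
      have hpos : 0 < ‖f z‖ + infDist z F1 := by
        by_cases hz1 : z ∈ F1
        · have := norm_pos_iff.2 (hcon z hz1 hz.2)
          have := infDist_nonneg (x := z) (s := F1)
          linarith
        · have := (hF1.notMem_iff_infDist_pos ⟨0, h0⟩).1 hz1
          have := norm_nonneg (f z)
          linarith
      refine ⟨(‖f z‖ + infDist z F1) / 2, by linarith, ?_⟩
      intro x hx hx2 y hy hxy
      have h1 : ‖f z‖ + infDist z F1 ≤ ‖f x‖ + infDist x F1 := hzm ⟨hx, hx2⟩
      have h2 := infDist_le_dist_of_mem (x := x) hy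
      linarith
    · exact ⟨1, one_pos, fun x hx hx2 => absurd ⟨x, hx, hx2⟩ hne⟩
  have huc : UniformContinuousOn f (closedBall (0 : EuclideanSpace ℝ (Fin k)) k) :=
    (isCompact_closedBall _ _).uniformContinuousOn_of_continuous hf.continuousOn
  obtain ⟨δ, hδ, hδf⟩ := Metric.uniformContinuousOn_iff.1 huc m hm
  obtain ⟨R0, hR0⟩ := exists_nat_gt ((k : ℝ) / min δ m)
  have hR : 0 < R0 + 1 := by omega
  have hRb : (k : ℝ) * ((R0 + 1 : ℕ) : ℝ)⁻¹ < min δ m := by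
    have hp : 0 < min δ m := lt_min hδ hm
    rw [div_lt_iff₀ hp] at hR0
    rw [← div_eq_mul_inv, div_lt_iff₀ (by positivity)]
    push_cast
    nlinarith
  set R := R0 + 1 with hRdef
  let e : ℕ → EuclideanSpace ℝ (Fin k) := fun d =>
    if h : d < k then EuclideanSpace.single ⟨d, h⟩ 1 else 0
  let co : ℕ → EuclideanSpace ℝ (Fin k) →ₗ[ℝ] ℝ := fun d =>
    if h : d < k then (EuclideanSpace.proj (⟨d, h⟩ : Fin k) : EuclideanSpace ℝ (Fin k) →L[ℝ] ℝ).toLinearMap else 0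
  have he : ∀ d < k, ‖e d‖ ≤ 1 := by
    intro d hd
    simp [e, hd]
  have hco : ∀ i < k, ∀ d < k, i ≠ d → co i (e d) = 0 := by
    intro i hi d hd hid
    simp [e, co, hi, hd, hid]
  have hco1 : ∀ i < k, co i (e i) = 1 := by
    intro i hi
    simp [e, co, hi]
  let ix : EuclideanSpace ℝ (Fin k) → ℕ := fun x => idx (fun j => |f x j|)
  have hix : ∀ x, ix (-x) = ix x := by
    intro x
    simp only [ix, hodd, Pi.neg_apply, abs_neg]
  let L : EuclideanSpace ℝ (Fin k) → ℕ := fun x =>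
    if x ∈ F2 then (if ∃ hi : ix x < n, 0 < f x ⟨ix x, hi⟩ then 2 * ix x + 1 else 2 * ix x + 2)
      else 0
  have hL0 : ∀ x, L x = 0 ↔ x ∉ F2 := by
    intro x
    simp only [L]
    split_ifs <;> simp_all
  -- main local fact
  have loc : ∀ l : List (EuclideanSpace ℝ (Fin k)), (∀ v ∈ l, ‖v‖ ≤ k) →
      (∀ v ∈ l, ∀ w ∈ l, ‖v - w‖ ≤ k * (R : ℝ)⁻¹) → 0 ∈ l.map L → ∀ v ∈ l, v ∈ F2 →
      m ≤ ‖f v‖ := by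
    intro l hl1 hl2 hl0 v hv hvF
    obtain ⟨w, hw, hwL⟩ := List.mem_map.1 hl0
    have hwF := (hU w).resolve_right ((hL0 w).1 hwL)
    refine hmf v (by simpa using hl1 v hv) hvF w hwF ?_
    rw [dist_eq_norm]
    exact ((hl2 v hv w hw).trans_lt hRb).trans_le (min_le_right _ _)
  have spec : ∀ v, v ∈ F2 → m ≤ ‖f v‖ → ∃ i : Fin n, ix v = i ∧
      ((L v = 2 * (i : ℕ) + 1 ∧ L (-v) = 2 * (i : ℕ) + 2 ∧ m ≤ f v i) ∨
       (L v = 2 * (i : ℕ) + 2 ∧ L (-v) = 2 * (i : ℕ) + 1 ∧ f v i ≤ -m)) := by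
    intro v hv hmv
    have hne : f v ≠ 0 := by
      intro h; rw [h, norm_zero] at hmv; linarith
    obtain ⟨hi, hi2⟩ := idx_spec (f v) hne
    have hnv := (hs2' v).2 hv
    refine ⟨⟨ix v, hi⟩, rfl, ?_⟩
    have hi3 : m ≤ |f v ⟨ix v, hi⟩| := by rw [hi2]; exact hmv
    have hi' : ix v < n := hi
    simp only [L, if_pos hv, if_pos hnv, hix, hodd, Pi.neg_apply]
    rcases le_abs.1 hi3 with h | h
    · left
      rw [if_pos ⟨hi', by linarith⟩, if_neg]
      · exact ⟨rfl, rfl, h⟩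
      · rintro ⟨_, h'⟩; linarith
    · right
      rw [if_neg, if_pos ⟨hi', by linarith⟩]
      · exact ⟨rfl, rfl, by linarith⟩
      · rintro ⟨_, h'⟩; linarith
  have nocomp : ∀ l : List (EuclideanSpace ℝ (Fin k)), (∀ v ∈ l, ‖v‖ ≤ k) →
      (∀ v ∈ l, ∀ w ∈ l, ‖v - w‖ ≤ k * (R : ℝ)⁻¹) → 0 ∈ l.map L →
      ∀ i, 2 * i + 1 ∈ l.map L → 2 * i + 2 ∈ l.map L → False := by
    intro l hl1 hl2 hl0 i ha hb
    obtain ⟨v, hv, hvL⟩ := List.mem_map.1 ha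
    obtain ⟨w, hw, hwL⟩ := List.mem_map.1 hb
    have hvF : v ∈ F2 := by
      by_contra h; have := (hL0 v).2 h; omega
    have hwF : w ∈ F2 := by
      by_contra h; have := (hL0 w).2 h; omega
    obtain ⟨iv, _, h1⟩ := spec v hvF (loc l hl1 hl2 hl0 v hv hvF)
    obtain ⟨iw, _, h2⟩ := spec w hwF (loc l hl1 hl2 hl0 w hw hwF)
    have hd : dist (f v) (f w) < m := hδf v (by simpa using hl1 v hv) w (by simpa using hl1 w hw) (by
      rw [dist_eq_norm]
      exact ((hl2 v hv w hw).trans_lt hRb).trans_le (min_le_left _ _))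
    rcases h1 with ⟨h1, _, h1'⟩ | ⟨h1, _, h1'⟩
    swap
    · omega
    rcases h2 with ⟨h2, _, h2'⟩ | ⟨h2, _, h2'⟩
    · omega
    have hii : iv = iw := by ext; omega
    subst hii
    have := norm_le_pi_norm (f v - f w) iv
    rw [← dist_eq_norm, Pi.sub_apply, Real.norm_eq_abs] at this
    have := le_abs_self (f v iv - f w iv)
    linarith
  obtain ⟨σ, s1, s2, s3, s4⟩ := exists_alt (R := R) hR he hco hco1 L ((hL0 0).2 h02)
    (by intro v hv; rw [hL0] at hv ⊢; rwa [hs2'] at hv)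
    (by
      rintro v ⟨i, hi, h⟩ h'
      apply (hL0 v).1 h'
      apply hfar
      simp only [co, dif_pos hi] at h
      exact h.trans (PiLp.norm_apply_le v ⟨i, hi⟩))
    (by
      intro l hl1 hl2 hl0
      refine ⟨?_, ?_⟩
      · intro a ha b hb hab
        apply sw_mono_of hab
        rintro i rfl rfl
        exact nocomp l hl1 hl2 hl0 i ha hb
      · intro v hv
        by_cases hvF : v ∈ F2
        · obtain ⟨i, _, h | h⟩ := spec v hvF (loc l hl1 hl2 hl0 v hv hvF)
          · rw [h.1, h.2.1]; unfold sw; split_ifs <;> omega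
          · rw [h.1, h.2.1]; unfold sw; split_ifs <;> omega
        · rw [(hL0 v).2 hvF, (hL0 (-v)).2 (by rwa [hs2'])]; rfl)
  have := Ac_len (σ.map L) n (by
      intro hl0 a ha
      obtain ⟨v, hv, rfl⟩ := List.mem_map.1 ha
      by_cases hvF : v ∈ F2
      · obtain ⟨i, _, h | h⟩ := spec v hvF (loc σ s2 s3 hl0 v hv hvF) <;> omega
      · rw [(hL0 v).2 hvF]; omega) (nocomp σ s2 s3) s4
  rw [List.length_map, s1] at this
  omega

end BU

namespace BU

section cls
variable {Y : Type*} [NormedAddCommGroup Y]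

/-- the linking class -/
def Cls (s : Y → Y) (E C1 C2 : Set Y) (j : ℕ) (A : Set Y) : Prop :=
  IsCompact A ∧ A ⊆ E ∧ (∀ a ∈ A, s a ∈ A) ∧
  ∀ (F1 F2 : Set Y) (f : Y → (Fin j → ℝ)), IsClosed F1 → IsClosed F2 →
    (∀ a ∈ A, a ∈ F2 → s a ∈ F2) → (∀ a ∈ A, a ∈ F1 ∨ a ∈ F2) →
    (∀ a ∈ A, a ∈ C1 → a ∈ F1) → (∀ a ∈ A, a ∈ C2 → a ∈ F2) →
    ContinuousOn f A → (∀ a ∈ A, f (s a) = - f a) →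
    ∃ a ∈ A, a ∈ F1 ∧ a ∈ F2 ∧ f a = 0

theorem Cls.excise {s : Y → Y} (hs : Continuous s) (hss : ∀ y, s (s y) = y)
    {E C1 C2 : Set Y} {j n : ℕ} {A : Set Y} (hA : Cls s E C1 C2 (j + n) A)
    {Z : Set Y} (hZ : IsOpen Z) (hZs : ∀ y ∈ Z, s y ∈ Z)
    (g : Y → (Fin n → ℝ)) (hg : Continuous g) (hgo : ∀ y, g (s y) = - g y)
    (hg0 : ∀ y ∈ closure Z, g y ≠ 0) : Cls s E C1 C2 j (A \ Z) := by
  obtain ⟨hA1, hA2, hA3, hA4⟩ := hA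
  have hA' : IsCompact (A \ Z) := hA1.diff hZ
  have hsym : ∀ a ∈ A \ Z, s a ∈ A \ Z := by
    rintro a ⟨ha, haZ⟩
    refine ⟨hA3 a ha, fun h => haZ ?_⟩
    have := hZs _ h
    rwa [hss] at this
  refine ⟨hA', sdiff_subset.trans hA2, hsym, ?_⟩
  intro F1 F2 f h1 h2 h3 h4 h5 h6 h7 h8
  have hclZ : ∀ y ∈ closure Z, s y ∈ closure Z := by
    intro y hy
    exact map_mem_closure hs hy hZs
  obtain ⟨F, hF⟩ := ContinuousMap.exists_restrict_eq hA'.isClosed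
    (⟨(A \ Z).domRestrict f, h7.domRestrict⟩ : C((A \ Z : Set Y), Fin j → ℝ))
  have hFf : ∀ a ∈ A \ Z, F a = f a := by
    intro a ha
    have := DFunLike.congr_fun hF ⟨a, ha⟩
    exact this
  let fo : Y → Fin j → ℝ := fun y => (1 / 2 : ℝ) • (F y - F (s y))
  have hfo : Continuous fo := by
    have := F.continuous
    fun_prop
  have hfoo : ∀ y, fo (s y) = - fo y := by
    intro y; simp only [fo, hss]; module
  have hfof : ∀ a ∈ A \ Z, fo a = f a := by
    intro a ha
    simp only [fo]
    rw [hFf a ha, hFf _ (hsym a ha), h8 a ha]; module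
  let G : Y → (Fin (j + n) → ℝ) := fun y => Fin.append (fo y) (g y)
  have hG : Continuous G := by
    apply continuous_pi
    intro i
    refine Fin.addCases (fun i => ?_) (fun i => ?_) i
    · simp only [G, Fin.append_left]; exact (continuous_apply i).comp hfo
    · simp only [G, Fin.append_right]; exact (continuous_apply i).comp hg
  obtain ⟨a, ha, a1, a2, a3⟩ := hA4 ((F1 ∩ (A \ Z)) ∪ closure Z) ((F2 ∩ (A \ Z)) ∪ closure Z) G
    ((h1.inter hA'.isClosed).union isClosed_closure)
    ((h2.inter hA'.isClosed).union isClosed_closure)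
    (by
      rintro a ha (⟨h, h'⟩ | h)
      · exact Or.inl ⟨h3 a h' h, hsym a h'⟩
      · exact Or.inr (hclZ a h))
    (by
      intro a ha
      by_cases haZ : a ∈ Z
      · exact Or.inl (Or.inr (subset_closure haZ))
      · rcases h4 a ⟨ha, haZ⟩ with h | h
        · exact Or.inl (Or.inl ⟨h, ha, haZ⟩)
        · exact Or.inr (Or.inl ⟨h, ha, haZ⟩))
    (by
      intro a ha haC
      by_cases haZ : a ∈ Z
      · exact Or.inr (subset_closure haZ)
      · exact Or.inl ⟨h5 a ⟨ha, haZ⟩ haC, ha, haZ⟩)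
    (by
      intro a ha haC
      by_cases haZ : a ∈ Z
      · exact Or.inr (subset_closure haZ)
      · exact Or.inl ⟨h6 a ⟨ha, haZ⟩ haC, ha, haZ⟩)
    hG.continuousOn
    (by
      intro a ha
      funext i
      refine Fin.addCases (fun i => ?_) (fun i => ?_) i
      · simp only [G, Fin.append_left, Pi.neg_apply, hfoo]
      · simp only [G, Fin.append_right, Pi.neg_apply, hgo])
  have hg' : g a = 0 := by
    funext i
    have := congrFun a3 (Fin.natAdd j i)
    simp only [G, Fin.append_right] at this
    exact this
  have hf' : fo a = 0 := by
    funext i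
    have := congrFun a3 (Fin.castAdd n i)
    simp only [G, Fin.append_left] at this
    exact this
  have hncl : a ∉ closure Z := fun h => hg0 a h hg'
  have ha' := (a1.resolve_right hncl)
  exact ⟨a, ha'.2, ha'.1, (a2.resolve_right hncl).1, by rw [← hfof a ha'.2]; exact hf'⟩

theorem Cls.image {s : Y → Y} {E C1 C2 C1' C2' : Set Y} {j : ℕ} {A : Set Y}
    (hA : Cls s E C1 C2 j A) (η : Y → Y) (hη : ContinuousOn η A) (hηE : ∀ a ∈ A, η a ∈ E)
    (hηs : ∀ a ∈ A, η (s a) = s (η a)) (hη1 : ∀ a ∈ A, a ∈ C1 → η a ∈ C1')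
    (hη2 : ∀ a ∈ A, a ∈ C2 → η a ∈ C2') : Cls s E C1' C2' j (η '' A) := by
  obtain ⟨hA1, hA2, hA3, hA4⟩ := hA
  refine ⟨hA1.image_of_continuousOn hη, ?_, ?_, ?_⟩
  · rintro _ ⟨a, ha, rfl⟩; exact hηE a ha
  · rintro _ ⟨a, ha, rfl⟩; exact ⟨s a, hA3 a ha, hηs a ha⟩
  intro F1 F2 f h1 h2 h3 h4 h5 h6 h7 h8
  obtain ⟨a, ha, a1, a2, a3⟩ := hA4 (A ∩ η ⁻¹' F1) (A ∩ η ⁻¹' F2) (f ∘ η)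
    (hη.preimage_isClosed_of_isClosed hA1.isClosed h1)
    (hη.preimage_isClosed_of_isClosed hA1.isClosed h2)
    (fun a ha h => ⟨hA3 a ha, by
      simp only [mem_preimage]; rw [hηs a ha]; exact h3 _ ⟨a, ha, rfl⟩ h.2⟩)
    (fun a ha => (h4 _ ⟨a, ha, rfl⟩).imp (fun h => ⟨ha, h⟩) (fun h => ⟨ha, h⟩))
    (fun a ha h => ⟨ha, h5 _ ⟨a, ha, rfl⟩ (hη1 a ha h)⟩)
    (fun a ha h => ⟨ha, h6 _ ⟨a, ha, rfl⟩ (hη2 a ha h)⟩)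
    (h7.comp hη (mapsTo_image η A))
    (fun a ha => by
      simp only [Function.comp]; rw [hηs a ha]; exact h8 _ ⟨a, ha, rfl⟩)
  exact ⟨η a, ⟨a, ha, rfl⟩, a1.2, a2.2, a3⟩

theorem Cls.start {s : Y → Y} {E C1 C2 : Set Y} {j k : ℕ} (hjk : j < k)
    (h : EuclideanSpace ℝ (Fin k) → Y) (hc : Continuous h) (ho : ∀ x, h (-x) = s (h x))
    (hE : ∀ x, h x ∈ E) (hr : ∀ x, ∃ y ∈ closedBall (0 : EuclideanSpace ℝ (Fin k)) 1, h y = h x)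
    (hC1 : h 0 ∈ C1) (hC2 : ∀ x, 1 ≤ ‖x‖ → h x ∈ C2) :
    Cls s E C1 C2 j (range h) := by
  have hran : range h = h '' closedBall 0 1 := by
    ext y; constructor
    · rintro ⟨x, rfl⟩
      obtain ⟨y, hy, hyx⟩ := hr x
      exact ⟨y, hy, hyx⟩
    · rintro ⟨x, _, rfl⟩; exact ⟨x, rfl⟩
  refine ⟨by rw [hran]; exact (isCompact_closedBall _ _).image hc, ?_, ?_, ?_⟩
  · rintro _ ⟨x, rfl⟩; exact hE x
  · rintro _ ⟨x, rfl⟩; exact ⟨-x, ho x⟩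
  intro F1 F2 f g1 g2 g3 g4 g5 g6 g7 g8
  obtain ⟨x, x1, x2, x3⟩ := main hjk (f ∘ h) (g7.comp_continuous hc (fun x => ⟨x, rfl⟩))
    (fun x => by simp only [Function.comp]; rw [ho, g8 _ ⟨x, rfl⟩]) (h ⁻¹' F1) (h ⁻¹' F2)
    (g1.preimage hc) (g2.preimage hc)
    (fun x hx => by simp only [mem_preimage]; rw [ho]; exact g3 _ ⟨x, rfl⟩ hx)
    (fun x => g4 _ ⟨x, rfl⟩) (g5 _ ⟨0, rfl⟩ hC1) (fun x hx => g6 _ ⟨x, rfl⟩ (hC2 x hx))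
  exact ⟨h x, ⟨x, rfl⟩, x1, x2, x3⟩

end cls
end BU

namespace BU

section deform
variable {Y : Type*} [NormedAddCommGroup Y] [NormedSpace ℝ Y]

theorem convex_comb {C : Set Y} (hC : Convex ℝ C) {ι : Type*} (t : Finset ι) (w : ι → ℝ) (z : ι → Y)
    {y : Y} (hy : y ∈ C) (hz : ∀ i ∈ t, z i ∈ C) (hw : ∀ i ∈ t, 0 ≤ w i) (hw1 : ∑ i ∈ t, w i ≤ 1) :
    y + ∑ i ∈ t, w i • (z i - y) ∈ C := by
  have h : y + ∑ i ∈ t, w i • (z i - y) = (1 - ∑ i ∈ t, w i) • y + ∑ i ∈ t, w i • z i := by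
    simp only [smul_sub, Finset.sum_sub_distrib, sub_smul, one_smul, Finset.sum_smul]
    abel
  rw [h]
  have := hC.sum_mem (t := Finset.insertNone t)
    (w := fun o : Option ι => o.elim (1 - ∑ i ∈ t, w i) w)
    (z := fun o : Option ι => o.elim y z) ?_ ?_ ?_
  · simpa using this
  · rintro (_ | i) hi
    · simpa using hw1
    · exact hw i (by simpa using hi)
  · simp
  · rintro (_ | i) hi
    · exact hy
    · exact hz i (by simpa using hi)

theorem local_step {C : Set Y} (hC : Convex ℝ C) (s : Y →L[ℝ] Y) (hss : ∀ y, s (s y) = y)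
    (hsn : ∀ y, ‖s y‖ = ‖y‖) (hsC : ∀ y ∈ C, s y ∈ C) {J : Y → ℝ} (hJ : ContDiff ℝ 1 J)
    (hJs : ∀ y, J (s y) = J y) {L κ : ℝ} (hL : 0 < L) (hκ : 0 < κ) {G : Set Y} (hGc : IsClosed G)
    (hGs : ∀ y ∈ G, s y ∈ G)
    (hG : ∀ y ∈ G, y ∈ C → 0 < J y ∧ ∃ z ∈ C, ‖z - y‖ < L ∧ fderiv ℝ J y (z - y) < -2 * κ)
    {B : Set Y} (hB : IsCompact B) (hBC : B ⊆ C) (hBs : ∀ y ∈ B, s y ∈ B) :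
    ∃ θ₀ > 0, ∀ θ, 0 < θ → θ ≤ θ₀ → ∃ ξ : Y → Y, Continuous ξ ∧
      (∀ y, ξ (s y) = s (ξ y)) ∧ ∀ y ∈ B, ξ y ∈ C ∧ ‖ξ y - y‖ ≤ L * θ ∧ J (ξ y) ≤ J y ∧
        (J y ≤ 0 → ξ y = y) ∧ (y ∈ G → J (ξ y) ≤ J y - κ * θ) := by
  have hJd : Differentiable ℝ J := hJ.differentiable one_ne_zero
  have hJc : Continuous (fderiv ℝ J) := hJ.continuous_fderiv one_ne_zero
  have hJ0 : Continuous J := hJ.continuous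
  let O : Y → Set Y := fun z => {y | fderiv ℝ J y (z - y) < -2 * κ ∧ ‖z - y‖ < L ∧ 0 < J y}
  have hO : ∀ z, IsOpen (O z) := by
    intro z
    have h1 : IsOpen {y | fderiv ℝ J y (z - y) < -2 * κ} :=
      isOpen_lt (hJc.clm_apply (by fun_prop)) continuous_const
    have h2 : IsOpen {y : Y | ‖z - y‖ < L} := isOpen_lt (by fun_prop) continuous_const
    have h3 : IsOpen {y | 0 < J y} := isOpen_lt continuous_const hJ0
    exact h1.inter (h2.inter h3)
  have hK : IsCompact (B ∩ G) := hB.inter_right hGc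
  obtain ⟨t, ht⟩ := hK.elim_finite_subcover (fun z : C => O z) (fun z => hO z) (by
    intro y hy
    obtain ⟨h1, z, hz, h2, h3⟩ := hG y hy.2 (hBC hy.1)
    exact mem_iUnion.2 ⟨⟨z, hz⟩, h3, h2, h1⟩)
  obtain ⟨f, hf⟩ := PartitionOfUnity.exists_isSubordinate (ι := t) hK.isClosed
    (fun z => O z.1) (fun z => hO z.1) (by
      intro y hy
      obtain ⟨z, hz⟩ := mem_iUnion.1 (ht hy)
      obtain ⟨hz, hz'⟩ := mem_iUnion.1 hz
      exact mem_iUnion.2 ⟨⟨z, hz⟩, hz'⟩)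
  have hfO : ∀ i y, f i y ≠ 0 → y ∈ O i.1 := by
    intro i y h
    exact hf i (subset_tsupport _ h)
  have hf0 : ∀ i y, 0 ≤ f i y := fun i y => f.nonneg i y
  have hf1 : ∀ y, ∑ i, f i y ≤ 1 := by
    intro y; have := f.sum_le_one y; rwa [finsum_eq_sum_of_fintype] at this
  have hf2 : ∀ y ∈ B ∩ G, ∑ i, f i y = 1 := by
    intro y hy; have := f.sum_eq_one hy; rwa [finsum_eq_sum_of_fintype] at this
  let W : Y → Y := fun y => ∑ i, f i y • ((i.1 : Y) - y)
  have hWc : Continuous W := by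
    have : ∀ i, Continuous (fun y => f i y) := fun i => (f i).continuous
    exact continuous_finsetSum _ (fun i _ => (this i).smul (by fun_prop))
  let mm : Y → ℝ := fun y => ∑ i, f i y
  have hmm0 : ∀ y, 0 ≤ mm y := fun y => Finset.sum_nonneg (fun i _ => hf0 i y)
  have hWn : ∀ y, ‖W y‖ ≤ L * mm y := by
    intro y
    simp only [mm, Finset.mul_sum]
    refine (norm_sum_le _ _).trans (Finset.sum_le_sum fun i _ => ?_)
    rw [norm_smul, Real.norm_of_nonneg (hf0 i y)]
    by_cases h : f i y = 0
    · simp [h]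
    · have := (hfO i y h).2.1
      nlinarith [hf0 i y]
  have hWd : ∀ y, fderiv ℝ J y (W y) ≤ -2 * κ * mm y := by
    intro y
    simp only [mm, Finset.mul_sum, W, map_sum]
    refine Finset.sum_le_sum fun i _ => ?_
    rw [map_smul, smul_eq_mul]
    by_cases h : f i y = 0
    · simp [h]
    · have := (hfO i y h).1
      nlinarith [hf0 i y]
  have hWz : ∀ y, J y ≤ 0 → W y = 0 := by
    intro y hy
    refine Finset.sum_eq_zero fun i _ => ?_
    have : f i y = 0 := by
      by_contra h
      exact absurd (hfO i y h).2.2 (not_lt.2 hy)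
    rw [this, zero_smul]
  have hWC : ∀ y ∈ C, y + W y ∈ C := by
    intro y hy
    exact convex_comb hC _ _ _ hy (fun i _ => i.1.2) (fun i _ => hf0 i y) (hf1 y)
  have hds : ∀ y v, fderiv ℝ J y (s v) = fderiv ℝ J (s y) v := by
    intro y v
    have h1 : HasFDerivAt (fun x => J (s x)) ((fderiv ℝ J (s y)).comp s) y :=
      (hJd (s y)).hasFDerivAt.comp y s.hasFDerivAt
    have h2 : (fun x => J (s x)) = J := funext hJs
    rw [h2] at h1
    rw [h1.fderiv]
    simp [hss]
  let Ws : Y → Y := fun y => (1 / 2 : ℝ) • (W y + s (W (s y)))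
  let ms : Y → ℝ := fun y => (1 / 2 : ℝ) * (mm y + mm (s y))
  have hms0 : ∀ y, 0 ≤ ms y := fun y => by
    have := hmm0 y; have := hmm0 (s y); simp only [ms]; linarith
  have hms1 : ∀ y, ms y ≤ 1 := fun y => by
    have := hf1 y; have := hf1 (s y); simp only [ms, mm]; linarith
  have hWsn : ∀ y, ‖Ws y‖ ≤ L * ms y := by
    intro y
    simp only [Ws, ms]
    rw [norm_smul, Real.norm_of_nonneg (by norm_num)]
    have h1 := norm_add_le (W y) (s (W (s y)))
    rw [hsn] at h1
    have := hWn y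
    have := hWn (s y)
    linarith
  have hWsd : ∀ y, fderiv ℝ J y (Ws y) ≤ -2 * κ * ms y := by
    intro y
    simp only [Ws, ms, map_smul, map_add, smul_eq_mul, hds]
    have := hWd y
    have := hWd (s y)
    linarith
  obtain ⟨δ, hδ, hδJ⟩ : ∃ δ > 0, ∀ y ∈ B, ∀ w, dist y w < δ →
      dist (fderiv ℝ J y) (fderiv ℝ J w) < κ / L := by
    have := hB.uniformContinuousAt_of_continuousAt (fderiv ℝ J) (fun a _ => hJc.continuousAt)
      (Metric.dist_mem_uniformity (div_pos hκ hL))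
    obtain ⟨δ, hδ, h⟩ := Metric.mem_uniformity_dist.1 this
    exact ⟨δ, hδ, fun y hy w hw => h hw hy⟩
  refine ⟨min 1 (δ / (2 * L)), lt_min one_pos (by positivity), ?_⟩
  intro θ hθ hθ0
  have hθ1 : θ ≤ 1 := hθ0.trans (min_le_left _ _)
  have hθδ : L * θ < δ := by
    have := hθ0.trans (min_le_right _ _)
    rw [le_div_iff₀ (by positivity)] at this
    nlinarith
  have hdec : ∀ y ∈ B, J (y + θ • Ws y) ≤ J y - κ * θ * ms y := by
    intro y hy
    have hn : ‖θ • Ws y‖ ≤ L * θ * ms y := by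
      rw [norm_smul, Real.norm_of_nonneg hθ.le]
      nlinarith [hWsn y]
    have hmv := (convex_ball y δ).norm_image_sub_le_of_norm_fderiv_le' (𝕜 := ℝ) (f := J)
      (φ := fderiv ℝ J y) (C := κ / L) (fun x _ => hJd x) (fun x hx => by
        rw [← dist_eq_norm, dist_comm]
        exact (hδJ y hy x (by rw [dist_comm]; exact hx)).le) (mem_ball_self hδ)
        (y := y + θ • Ws y) (by
          rw [mem_ball, dist_eq_norm, add_sub_cancel_left]
          have := hms1 y
          have : L * θ * ms y ≤ L * θ := by
            have : 0 < L * θ := by positivity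
            nlinarith
          linarith)
    rw [add_sub_cancel_left, map_smul, smul_eq_mul] at hmv
    have h1 := (abs_le.1 (Real.norm_eq_abs _ ▸ hmv)).2
    have h2 : κ / L * ‖θ • Ws y‖ ≤ κ * θ * ms y := by
      calc κ / L * ‖θ • Ws y‖ ≤ κ / L * (L * θ * ms y) := by gcongr
        _ = κ * θ * ms y := by field_simp
    have h3 : θ * fderiv ℝ J y (Ws y) ≤ θ * (-2 * κ * ms y) := by
      gcongr; exact hWsd y
    linarith
  refine ⟨fun y => y + θ • Ws y, by fun_prop, ?_, ?_⟩
  · intro y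
    simp only [Ws, hss, map_add, map_smul]
    rw [add_comm (W (s y))]
  intro y hy
  refine ⟨?_, ?_, ?_, ?_, ?_⟩
  · have h1 := hWC y (hBC hy)
    have h2 := hsC _ (hWC (s y) (hsC y (hBC hy)))
    rw [map_add, hss] at h2
    have h3 : y + Ws y ∈ C := by
      have := hC h1 h2 (show (0 : ℝ) ≤ 1 / 2 by norm_num) (show (0 : ℝ) ≤ 1 / 2 by norm_num)
        (by norm_num)
      convert this using 1
      simp only [Ws]; module
    exact hC.add_smul_mem (hBC hy) h3 ⟨hθ.le, hθ1⟩
  · rw [add_sub_cancel_left, norm_smul, Real.norm_of_nonneg hθ.le]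
    have := hWsn y
    have := hms1 y
    have : L * ms y ≤ L * 1 := by gcongr
    nlinarith
  · have := hdec y hy
    have := hms0 y
    have : 0 ≤ κ * θ * ms y := by positivity
    linarith
  · intro h
    simp only [Ws]
    rw [hWz y h, hWz (s y) (by rw [hJs]; exact h)]
    simp
  · intro hyG
    have := hdec y hy
    have h1 : ms y = 1 := by
      simp only [ms, mm]
      rw [hf2 y ⟨hy, hyG⟩, hf2 (s y) ⟨hBs y hy, hGs y hyG⟩]; norm_num
    rw [h1] at this
    simpa using this

/-- ordering relation used in the continuation argument -/
def Rel (J : Y → ℝ) (L κ c : ℝ) {A : Set Y} (p q : C(A, Y) × ℝ) : Prop :=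
  p.2 ≤ q.2 ∧ ∀ x, ‖q.1 x - p.1 x‖ ≤ L * (q.2 - p.2) ∧ J (q.1 x) ≤ J (p.1 x) ∧
    (J (p.1 x) ≤ 0 → q.1 x = p.1 x) ∧ J (q.1 x) ≤ max (J (p.1 x) - κ * (q.2 - p.2)) c

theorem Rel.refl {J : Y → ℝ} {L κ c : ℝ} {A : Set Y} (p : C(A, Y) × ℝ) : Rel J L κ c p p :=
  ⟨le_rfl, fun x => by simp⟩

theorem Rel.trans {J : Y → ℝ} {L κ c : ℝ} (hκ : 0 < κ) {A : Set Y} {p q r : C(A, Y) × ℝ}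
    (h1 : Rel J L κ c p q) (h2 : Rel J L κ c q r) : Rel J L κ c p r := by
  refine ⟨h1.1.trans h2.1, fun x => ?_⟩
  obtain ⟨a1, a2, a3, a4⟩ := h1.2 x
  obtain ⟨b1, b2, b3, b4⟩ := h2.2 x
  refine ⟨?_, b2.trans a2, ?_, ?_⟩
  · have := norm_add_le (r.1 x - q.1 x) (q.1 x - p.1 x)
    rw [sub_add_sub_cancel] at this
    linarith
  · intro h
    rw [b3 (a2.trans h), a3 h]
  · have := mul_nonneg hκ.le (sub_nonneg.2 h2.1)
    rcases le_max_iff.1 b4 with h | h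
    · rcases le_max_iff.1 a4 with h' | h'
      · exact le_max_of_le_left (by linarith)
      · exact le_max_of_le_right (by linarith)
    · exact le_max_of_le_right h

theorem Rel.lim {J : Y → ℝ} (hJ : Continuous J) {L κ c : ℝ} {A : Set Y} [CompactSpace A]
    {p q : C(A, Y) × ℝ} {u : ℕ → C(A, Y) × ℝ} (hu : Tendsto u atTop (𝓝 q))
    (h : ∃ᶠ n in atTop, Rel J L κ c p (u n)) : Rel J L κ c p q := by
  have h2 : Tendsto (fun n => (u n).2) atTop (𝓝 q.2) := (continuous_snd.tendsto q).comp hu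
  have h1 : ∀ x, Tendsto (fun n => (u n).1 x) atTop (𝓝 (q.1 x)) := fun x =>
    (((continuous_eval_const x).comp continuous_fst).tendsto q).comp hu
  refine ⟨ge_of_tendsto_of_frequently h2 (h.mono fun n hn => hn.1), fun x => ⟨?_, ?_, ?_, ?_⟩⟩
  · have : Tendsto (fun n => ‖(u n).1 x - p.1 x‖ - L * ((u n).2 - p.2)) atTop
        (𝓝 (‖q.1 x - p.1 x‖ - L * (q.2 - p.2))) :=
      ((h1 x).sub_const _).norm.sub ((h2.sub_const _).const_mul _)
    have := le_of_tendsto_of_frequently this (h.mono fun n hn => sub_nonpos.2 (hn.2 x).1)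
    linarith
  · exact le_of_tendsto_of_frequently ((hJ.tendsto _).comp (h1 x))
      (h.mono fun n hn => (hn.2 x).2.1)
  · intro h0
    have hcl : IsClosed {p.1 x} := isClosed_singleton
    exact hcl.mem_of_frequently_of_tendsto (h.mono fun n hn => (hn.2 x).2.2.1 h0) (h1 x)
  · have : Tendsto (fun n => J ((u n).1 x) - max (J (p.1 x) - κ * ((u n).2 - p.2)) c) atTop
        (𝓝 (J (q.1 x) - max (J (p.1 x) - κ * (q.2 - p.2)) c)) :=
      ((hJ.tendsto _).comp (h1 x)).sub
        ((tendsto_const_nhds.sub ((h2.sub_const _).const_mul _)).max tendsto_const_nhds)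
    have := le_of_tendsto_of_frequently this (h.mono fun n hn => sub_nonpos.2 (hn.2 x).2.2.2)
    linarith

theorem deform [CompleteSpace Y] {C : Set Y} (hCc : IsClosed C) (hC : Convex ℝ C)
    (s : Y →L[ℝ] Y) (hss : ∀ y, s (s y) = y)
    (hsn : ∀ y, ‖s y‖ = ‖y‖) (hsC : ∀ y ∈ C, s y ∈ C) {J : Y → ℝ} (hJ : ContDiff ℝ 1 J)
    (hJs : ∀ y, J (s y) = J y) {L κ : ℝ} (hL : 0 < L) (hκ : 0 < κ) {G : Set Y} (hGc : IsClosed G)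
    (hGs : ∀ y ∈ G, s y ∈ G)
    (hG : ∀ y ∈ G, y ∈ C → 0 < J y ∧ ∃ z ∈ C, ‖z - y‖ < L ∧ fderiv ℝ J y (z - y) < -2 * κ)
    {A : Set Y} (hA : IsCompact A) (hAC : A ⊆ C) (hAs : ∀ y ∈ A, s y ∈ A)
    {T c : ℝ} (hT : 0 < T)
    (hWI : ∀ x ∈ A, ∀ y ∈ C, ‖y - x‖ ≤ L * T → c ≤ J y → J y ≤ J x → y ∈ G) :
    ∃ η : Y → Y, ContinuousOn η A ∧ ∀ x ∈ A, η (s x) = s (η x) ∧ η x ∈ C ∧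
      (J x ≤ 0 → η x = x) ∧ J (η x) ≤ max (J x - κ * T) c := by
  haveI : CompactSpace A := isCompact_iff_compactSpace.1 hA
  let sA : A → A := fun x => ⟨s x, hAs x x.2⟩
  let p0 : C(A, Y) × ℝ := (⟨Subtype.val, continuous_subtype_val⟩, 0)
  let Q : Set (C(A, Y) × ℝ) := {p | Rel J L κ c p0 p ∧ p.2 ≤ T ∧
    ∀ x, p.1 x ∈ C ∧ p.1 (sA x) = s (p.1 x)}
  have hp0 : p0 ∈ Q := ⟨Rel.refl _, hT.le, fun x => ⟨hAC x.2, rfl⟩⟩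
  have hmax : ∃ m : Q, ∀ a : Q, Rel J L κ c m.1 a.1 → Rel J L κ c a.1 m.1 := by
    refine exists_maximal_of_chains_bounded (r := fun a b : Q => Rel J L κ c a.1 b.1) ?_
      (fun h1 h2 => Rel.trans hκ h1 h2)
    intro ch hch
    by_cases hne : ch.Nonempty
    swap
    · exact ⟨⟨p0, hp0⟩, fun a ha => absurd ⟨a, ha⟩ hne⟩
    obtain ⟨u, _, hut, hum⟩ := exists_seq_tendsto_sSup (S := (fun a : Q => a.1.2) '' ch)
      (hne.image _) ⟨T, by rintro _ ⟨a, _, rfl⟩; exact a.2.2.1⟩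
    have hle : ∀ a ∈ ch, a.1.2 ≤ sSup ((fun a : Q => a.1.2) '' ch) := fun a ha =>
      le_csSup ⟨T, by rintro _ ⟨a, _, rfl⟩; exact a.2.2.1⟩ ⟨a, ha, rfl⟩
    generalize sSup ((fun a : Q => a.1.2) '' ch) = τ at *
    choose P hPc hPu using hum
    have hcmp : ∀ a ∈ ch, ∀ b ∈ ch, Rel J L κ c a.1 b.1 ∨ Rel J L κ c b.1 a.1 := by
      intro a ha b hb
      by_cases hab : a = b
      · subst hab; exact Or.inl (Rel.refl _)
      · exact hch ha hb hab
    have hdist : ∀ a b : C(A, Y) × ℝ, Rel J L κ c a b → dist a.1 b.1 ≤ L * dist a.2 b.2 := by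
      intro a b h
      rw [ContinuousMap.dist_le (by positivity)]
      intro x
      rw [dist_comm, dist_eq_norm, dist_comm a.2, Real.dist_eq, abs_of_nonneg (sub_nonneg.2 h.1)]
      exact (h.2 x).1
    have hdist' : ∀ n m, dist (P n).1.1 (P m).1.1 ≤ L * dist (u n) (u m) := by
      intro n m
      have hn : (P n).1.2 = u n := hPu n
      have hm : (P m).1.2 = u m := hPu m
      rcases hcmp _ (hPc n) _ (hPc m) with h | h
      · rw [← hn, ← hm]; exact hdist _ _ h
      · rw [← hn, ← hm, dist_comm, dist_comm (P n).1.2]; exact hdist _ _ h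
    have hcau : CauchySeq (fun n => (P n).1.1) := by
      have hu := hut.cauchySeq
      rw [Metric.cauchySeq_iff] at hu ⊢
      intro e he
      obtain ⟨N, hN⟩ := hu (e / L) (by positivity)
      refine ⟨N, fun m hm n hn => (hdist' m n).trans_lt ?_⟩
      have := hN m hm n hn
      rw [lt_div_iff₀ hL] at this
      linarith
    obtain ⟨ηl, hηl⟩ := cauchySeq_tendsto_of_complete hcau
    have hlim : Tendsto (fun n => (P n).1) atTop (𝓝 (ηl, τ)) := by
      have h2 : Tendsto (fun n => (P n).1.2) atTop (𝓝 τ) := by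
        convert hut using 2 with n; exact hPu n
      exact hηl.prodMk_nhds h2
    have hev : ∀ x, Tendsto (fun n => (P n).1.1 x) atTop (𝓝 (ηl x)) := fun x =>
      ((continuous_eval_const x).tendsto ηl).comp hηl
    have hq : (ηl, τ) ∈ Q := by
      refine ⟨Rel.lim hJ.continuous hlim (Frequently.of_forall fun n => (P n).2.1), ?_, ?_⟩
      · exact le_of_tendsto' ((continuous_snd.tendsto _).comp hlim) (fun n => (P n).2.2.1)
      · intro x
        refine ⟨hCc.mem_of_tendsto (hev x) (Eventually.of_forall fun n => ((P n).2.2.2 x).1), ?_⟩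
        refine tendsto_nhds_unique (hev (sA x)) ?_
        have : Tendsto (fun n => s ((P n).1.1 x)) atTop (𝓝 (s (ηl x))) :=
          (s.continuous.tendsto _).comp (hev x)
        convert this using 2 with n
        exact ((P n).2.2.2 x).2
    refine ⟨⟨(ηl, τ), hq⟩, ?_⟩
    intro a ha
    by_cases hfr : ∃ᶠ n in atTop, Rel J L κ c a.1 (P n).1
    · exact Rel.lim hJ.continuous hlim hfr
    · have hev2 : ∀ᶠ n in atTop, Rel J L κ c (P n).1 a.1 := by
        filter_upwards [not_frequently.1 hfr] with n hn
        exact (hcmp _ ha _ (hPc n)).resolve_left hn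
      have h2 : Tendsto (fun n => (P n).1.2) atTop (𝓝 τ) := (continuous_snd.tendsto _).comp hlim
      have hτ : a.1.2 = τ :=
        le_antisymm (hle a ha) (le_of_tendsto h2 (hev2.mono fun n hn => hn.1))
      have hη : a.1.1 = ηl := by
        refine tendsto_nhds_unique ?_ hηl
        rw [tendsto_iff_dist_tendsto_zero]
        have h3 : Tendsto (fun n => L * dist (P n).1.2 a.1.2) atTop (𝓝 0) := by
          have := (tendsto_iff_dist_tendsto_zero.1 h2).const_mul L
          rw [hτ]; simpa using this
        rw [tendsto_iff_dist_tendsto_zero] at hηl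
        exact squeeze_zero' (Eventually.of_forall fun n => dist_nonneg)
          (hev2.mono fun n hn => hdist _ _ hn) h3
      have : a.1 = (ηl, τ) := Prod.ext hη hτ
      show Rel J L κ c a.1 (ηl, τ)
      rw [this]; exact Rel.refl _
  obtain ⟨⟨⟨η, t⟩, hm1, hm2, hm3⟩, hmm⟩ := hmax
  have htT : t = T := by
    by_contra hne
    have htT : t < T := lt_of_le_of_ne hm2 hne
    have hB : IsCompact (range η) := isCompact_range η.continuous
    obtain ⟨θ₀, hθ₀, hstep⟩ := local_step hC s hss hsn hsC hJ hJs hL hκ hGc hGs hG hB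
      (by rintro _ ⟨x, rfl⟩; exact (hm3 x).1)
      (by rintro _ ⟨x, rfl⟩; exact ⟨sA x, (hm3 x).2⟩)
    obtain ⟨ξ, hξc, hξs, hξ⟩ := hstep (min θ₀ (T - t)) (lt_min hθ₀ (by linarith)) (min_le_left _ _)
    have hθ : 0 < min θ₀ (T - t) := lt_min hθ₀ (by linarith)
    have hθT : min θ₀ (T - t) ≤ T - t := min_le_right _ _
    generalize min θ₀ (T - t) = θ at *
    let q : C(A, Y) × ℝ := (⟨fun x => ξ (η x), hξc.comp η.continuous⟩, t + θ)
    have hrel : Rel J L κ c (η, t) q := by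
      refine ⟨by simp [q, hθ.le], fun x => ?_⟩
      obtain ⟨x1, x2, x3, x4, x5⟩ := hξ (η x) ⟨x, rfl⟩
      simp only [q, ContinuousMap.coe_mk, add_sub_cancel_left]
      refine ⟨x2, x3, x4, ?_⟩
      by_cases hc : c ≤ J (η x)
      · have hx := hm1.2 x
        simp only [p0, ContinuousMap.coe_mk, sub_zero] at hx
        refine le_max_of_le_left (x5 (hWI x x.2 (η x) (hm3 x).1 (hx.1.trans ?_) hc hx.2.1))
        gcongr
      · exact le_max_of_le_right (by linarith)
    have hqQ : q ∈ Q := by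
      refine ⟨Rel.trans hκ hm1 hrel, by simp only [q]; linarith, fun x => ?_⟩
      refine ⟨(hξ (η x) ⟨x, rfl⟩).1, ?_⟩
      simp only [q, ContinuousMap.coe_mk]
      have := (hm3 x).2
      simp only at this
      rw [this, hξs]
    have := (hmm ⟨q, hqQ⟩ hrel).1
    simp only [q] at this
    linarith
  subst htT
  classical
  refine ⟨fun x => if h : x ∈ A then η ⟨x, h⟩ else x, ?_, ?_⟩
  · rw [continuousOn_iff_continuous_domRestrict]
    convert η.continuous using 1
    funext x
    simp [Set.domRestrict]
  · intro x hx
    have h1 := hm3 ⟨x, hx⟩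
    have h2 := hm1.2 ⟨x, hx⟩
    simp only [p0, ContinuousMap.coe_mk, sub_zero] at h2
    simp only [dif_pos hx, dif_pos (hAs x hx)]
    exact ⟨h1.2, h1.1, h2.2.2.1, h2.2.2.2⟩

end deform
end BU

namespace BU

section setting
variable {X : Type*} [NormedAddCommGroup X] [NormedSpace ℝ X]

/-- the standing assumptions, in convenient form -/
structure Setup (Ψ : X → EReal) (Φ : X → ℝ) : Prop where
  zero : Ψ 0 = 0
  nn : ∀ u : X, 0 ≤ Ψ u
  lsc : LowerSemicontinuous Ψ
  conv : ∀ u v : X, ∀ a b : ℝ, 0 ≤ a → 0 ≤ b → a + b = 1 →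
      Ψ (a • u + b • v) ≤ (a : EReal) * Ψ u + (b : EReal) * Ψ v
  coer : ∀ C : ℝ, ∃ R : ℝ, ∀ u : X, R ≤ ‖u‖ → (C : EReal) ≤ Ψ u
  p3 : ∀ (u : ℕ → X) (w : X), (∀ j, Ψ (u j) ≠ ⊤) → Ψ w ≠ ⊤ →
      (∀ f : X →L[ℝ] ℝ, Tendsto (fun j => f (u j)) atTop (𝓝 (f w))) →
      Tendsto (fun j => Ψ (u j)) atTop (𝓝 (Ψ w)) →
      Tendsto (fun j => ‖u j - w‖) atTop (𝓝 0)
  c1 : ContDiff ℝ 1 Φ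
  p2 : ∀ u : ℕ → X, IsBounded (range u) →
      ∃ (φ : ℕ → ℕ) (w : X), StrictMono φ ∧
        (∀ f : X →L[ℝ] ℝ, Tendsto (fun j => f (u (φ j))) atTop (𝓝 (f w))) ∧
        ∀ v : X, ((fderiv ℝ Φ w (v - w) : ℝ) : EReal) ≤
          Filter.liminf
            (fun j => ((fderiv ℝ Φ (u (φ j)) (v - u (φ j)) : ℝ) : EReal)) atTop
  Ψeven : ∀ u : X, Ψ (-u) = Ψ u
  Φeven : ∀ u : X, Φ (-u) = Φ u

def epi (Ψ : X → EReal) : Set (X × ℝ) := {y | Ψ y.1 ≤ (y.2 : EReal)}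

def Jf (Φ : X → ℝ) (lam : ℝ) (y : X × ℝ) : ℝ := lam * y.2 - Φ y.1

variable {Ψ : X → EReal} {Φ : X → ℝ}

theorem epi_closed (h : Setup Ψ Φ) : IsClosed (epi Ψ) := by
  have h1 : IsClosed {p : X × EReal | Ψ p.1 ≤ p.2} := h.lsc.isClosed_epigraph
  exact h1.preimage (f := fun y : X × ℝ => (y.1, (y.2 : EReal)))
    (continuous_fst.prodMk (continuous_coe_real_ereal.comp continuous_snd))

theorem epi_nonneg (h : Setup Ψ Φ) {y : X × ℝ} (hy : y ∈ epi Ψ) : 0 ≤ y.2 := by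
  have : (0 : EReal) ≤ (y.2 : EReal) := (h.nn y.1).trans hy
  exact_mod_cast this

theorem epi_ne_top {y : X × ℝ} (hy : y ∈ epi Ψ) : Ψ y.1 ≠ ⊤ := by
  intro h
  have : Ψ y.1 ≤ (y.2 : EReal) := hy
  rw [h, top_le_iff] at this
  exact EReal.coe_ne_top _ this

theorem coe_toReal (h : Setup Ψ Φ) {u : X} (hu : Ψ u ≠ ⊤) : ((Ψ u).toReal : EReal) = Ψ u := by
  apply EReal.coe_toReal hu
  intro hb
  have := h.nn u
  rw [hb] at this
  exact absurd this (by simp)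

theorem epi_convex (h : Setup Ψ Φ) : Convex ℝ (epi Ψ) := by
  intro y hy z hz a b ha hb hab
  have h1 := h.conv y.1 z.1 a b ha hb hab
  have ey := coe_toReal h (epi_ne_top hy)
  have ez := coe_toReal h (epi_ne_top hz)
  have hy' : Ψ y.1 ≤ (y.2 : EReal) := hy
  have hz' : Ψ z.1 ≤ (z.2 : EReal) := hz
  rw [← ey] at hy'
  rw [← ez] at hz'
  rw [← ey, ← ez] at h1
  have hy2 : (Ψ y.1).toReal ≤ y.2 := by exact_mod_cast hy'
  have hz2 : (Ψ z.1).toReal ≤ z.2 := by exact_mod_cast hz'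
  refine h1.trans ?_
  have : a * (Ψ y.1).toReal + b * (Ψ z.1).toReal ≤ a * y.2 + b * z.2 := by gcongr
  simp only [Prod.snd_add, Prod.smul_snd, smul_eq_mul]
  exact_mod_cast this

theorem epi_bdd (h : Setup Ψ Φ) (M : ℝ) : ∃ R > 0, ∀ y ∈ epi Ψ, y.2 ≤ M → ‖y.1‖ < R := by
  obtain ⟨R, hR⟩ := h.coer (M + 1)
  refine ⟨max R 1, by positivity, ?_⟩
  intro y hy hyM
  by_contra hcon
  push Not at hcon
  have h1 := hR y.1 ((le_max_left _ _).trans hcon)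
  have h2 : ((M + 1 : ℝ) : EReal) ≤ (y.2 : EReal) := h1.trans hy
  have : M + 1 ≤ y.2 := by exact_mod_cast h2
  linarith

theorem p2r (h : Setup Ψ Φ) (u : ℕ → X) (hu : IsBounded (range u)) :
    ∃ (φ : ℕ → ℕ) (w : X), StrictMono φ ∧
        (∀ f : X →L[ℝ] ℝ, Tendsto (fun j => f (u (φ j))) atTop (𝓝 (f w))) ∧
        ∀ v : X, ∀ e > 0, ∀ᶠ j in atTop, fderiv ℝ Φ w (v - w) - e <
            fderiv ℝ Φ (u (φ j)) (v - u (φ j)) := by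
  obtain ⟨φ, w, h1, h2, h3⟩ := h.p2 u hu
  refine ⟨φ, w, h1, h2, fun v e he => ?_⟩
  have h4 : ((fderiv ℝ Φ w (v - w) - e : ℝ) : EReal) < Filter.liminf
            (fun j => ((fderiv ℝ Φ (u (φ j)) (v - u (φ j)) : ℝ) : EReal)) atTop := by
    refine lt_of_lt_of_le ?_ (h3 v)
    exact_mod_cast sub_lt_self _ he
  filter_upwards [eventually_lt_of_lt_liminf h4] with j hj
  exact_mod_cast hj

theorem weak_closed {Y : Type*} [NormedAddCommGroup Y] [NormedSpace ℝ Y] {C : Set Y}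
    (hCc : IsClosed C) (hC : Convex ℝ C) (y : ℕ → Y) (w : Y)
    (hw : ∀ f : Y →L[ℝ] ℝ, Tendsto (fun j => f (y j)) atTop (𝓝 (f w)))
    (hf : ∃ᶠ j in atTop, y j ∈ C) : w ∈ C := by
  by_contra hcon
  obtain ⟨f, c, h1, h2⟩ := geometric_hahn_banach_closed_point hC hCc hcon
  have := le_of_tendsto_of_frequently (hw f) (hf.mono fun j hj => (h1 _ hj).le)
  linarith

theorem weak_prod {u : ℕ → X} {w : X} {p : ℕ → ℝ} {q : ℝ}
    (hw : ∀ f : X →L[ℝ] ℝ, Tendsto (fun j => f (u j)) atTop (𝓝 (f w)))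
    (hp : Tendsto p atTop (𝓝 q)) (f : X × ℝ →L[ℝ] ℝ) :
    Tendsto (fun j => f (u j, p j)) atTop (𝓝 (f (w, q))) := by
  have h1 : ∀ x : X, ∀ r : ℝ, f (x, r) = (f.comp (ContinuousLinearMap.inl ℝ X ℝ)) x +
      (f.comp (ContinuousLinearMap.inr ℝ X ℝ)) r := by
    intro x r
    simp [← map_add]
  simp only [h1]
  exact (hw _).add (((f.comp (ContinuousLinearMap.inr ℝ X ℝ)).continuous.tendsto q).comp hp)

theorem weak_conv_Ψ (h : Setup Ψ Φ) {u : ℕ → X} {w : X} {p : ℕ → ℝ}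
    (hw : ∀ f : X →L[ℝ] ℝ, Tendsto (fun j => f (u j)) atTop (𝓝 (f w)))
    (hu : ∀ j, (u j, p j) ∈ epi Ψ) (hwt : Ψ w ≠ ⊤) (hp : Tendsto p atTop (𝓝 (Ψ w).toReal)) :
    Tendsto u atTop (𝓝 w) := by
  rw [tendsto_iff_norm_sub_tendsto_zero]
  refine h.p3 u w (fun j => epi_ne_top (hu j)) hwt hw ?_
  rw [tendsto_order]
  constructor
  · intro a ha
    obtain ⟨b, hb1, hb2⟩ := EReal.lt_iff_exists_real_btwn.1 ha
    by_contra hcon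
    have hfr : ∃ᶠ j in atTop, (u j, b) ∈ epi Ψ := by
      refine (not_eventually.1 hcon).mono fun j hj => ?_
      exact (not_lt.1 hj).trans hb1.le
    have := weak_closed (epi_closed h) (epi_convex h) (fun j => (u j, b)) (w, b)
      (weak_prod hw tendsto_const_nhds) hfr
    exact absurd hb2 (not_lt.2 this)
  · intro a ha
    have h1 : Tendsto (fun j => (p j : EReal)) atTop (𝓝 (Ψ w)) := by
      rw [← coe_toReal h hwt]
      exact (continuous_coe_real_ereal.tendsto _).comp hp
    filter_upwards [h1.eventually_lt_const ha] with j hj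
    exact lt_of_le_of_lt (hu j) hj

theorem PS (h : Setup Ψ Φ) {lam : ℝ} (hlam : 0 < lam) {N : ℝ} (u : ℕ → X) (p : ℕ → ℝ) (e : ℕ → ℝ)
    (hu : ∀ j, (u j, p j) ∈ epi Ψ) (hpN : ∀ j, p j ≤ N) (he : Tendsto e atTop (𝓝 0))
    (hps : ∀ j, ∀ z ∈ epi Ψ, z.2 ≤ N + 1 →
      - e j ≤ lam * (z.2 - p j) - fderiv ℝ Φ (u j) (z.1 - u j)) :
    ∃ φ : ℕ → ℕ, StrictMono φ ∧ ∃ y : X × ℝ, y ∈ epi Ψ ∧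
      Tendsto (fun j => (u (φ j), p (φ j))) atTop (𝓝 y) := by
  obtain ⟨R, hR, hRb⟩ := epi_bdd h N
  have hbd : IsBounded (range u) := by
    refine (isBounded_ball (x := (0 : X)) (r := R)).subset ?_
    rintro _ ⟨j, rfl⟩
    simpa using hRb _ (hu j) (hpN j)
  obtain ⟨φ, w, hφ, hw, hinf⟩ := p2r h u hbd
  obtain ⟨q, hq, ψ, hψ, hqt⟩ := isCompact_Icc.tendsto_subseq (x := fun j => p (φ j))
    (fun j => (⟨epi_nonneg h (hu _), hpN _⟩ : p (φ j) ∈ Icc 0 N))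
  have hw' : ∀ f : X →L[ℝ] ℝ, Tendsto (fun j => f (u (φ (ψ j)))) atTop (𝓝 (f w)) :=
    fun f => (hw f).comp hψ.tendsto_atTop
  have hwq : (w, q) ∈ epi Ψ := weak_closed (epi_closed h) (epi_convex h)
    (fun j => (u (φ (ψ j)), p (φ (ψ j)))) (w, q) (weak_prod hw' hqt)
    (Frequently.of_forall fun j => hu _)
  have hwt : Ψ w ≠ ⊤ := epi_ne_top hwq
  have hwr := coe_toReal h hwt
  have hle : (Ψ w).toReal ≤ q := by
    have : ((Ψ w).toReal : EReal) ≤ (q : EReal) := by rw [hwr]; exact hwq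
    exact_mod_cast this
  have hge : q ≤ (Ψ w).toReal := by
    by_contra hcon
    push Not at hcon
    have hε : 0 < lam * (q - (Ψ w).toReal) / 2 := by
      have := mul_pos hlam (sub_pos.2 hcon); linarith
    have h1 : Tendsto (fun j => lam * ((Ψ w).toReal - p (φ (ψ j))) + e (φ (ψ j))) atTop
        (𝓝 (lam * ((Ψ w).toReal - q) + 0)) :=
      ((tendsto_const_nhds.sub hqt).const_mul lam).add
        (he.comp (hφ.comp hψ).tendsto_atTop)
    have h2 := hψ.tendsto_atTop.eventually (hinf w _ hε)
    have h3 : - (lam * (q - (Ψ w).toReal) / 2) ≤ lam * ((Ψ w).toReal - q) + 0 := by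
      refine ge_of_tendsto h1 ?_
      filter_upwards [h2] with j hj
      have := hps (φ (ψ j)) (w, (Ψ w).toReal) hwr.symm.le (by
        have := hq.2; simp only; linarith)
      simp only [sub_self, map_zero, zero_sub] at hj this
      linarith
    nlinarith
  have hqe : q = (Ψ w).toReal := le_antisymm hge hle
  refine ⟨φ ∘ ψ, hφ.comp hψ, (w, q), hwq, ?_⟩
  refine Tendsto.prodMk_nhds ?_ hqt
  refine weak_conv_Ψ h hw' (fun j => hu _) hwt ?_
  rw [← hqe]; exact hqt

end setting
end BU

namespace BU

section lemZ
variable {X : Type*} [NormedAddCommGroup X] [NormedSpace ℝ X]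
variable {Ψ : X → EReal} {Φ : X → ℝ}

theorem norming (V : Submodule ℝ X) [FiniteDimensional ℝ V] :
    ∃ F : Set (X →L[ℝ] ℝ), F.Finite ∧ ∀ x ∈ V, x ≠ 0 → ∃ l ∈ F, ‖l‖ ≤ 1 ∧ ‖x‖ ≤ 2 * |l x| := by
  have hc : IsCompact (sphere (0 : V) 1) := isCompact_sphere _ _
  have hd : ∀ x : X, ∃ g : X →L[ℝ] ℝ, ‖g‖ ≤ 1 ∧ g x = ‖x‖ := by
    intro x
    obtain ⟨g, h1, h2⟩ := exists_dual_vector'' ℝ x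
    exact ⟨g, h1, by simpa using h2⟩
  choose g hg1 hg2 using hd
  obtain ⟨t, ht1, ht2⟩ := hc.elim_nhds_subcover (fun x : V => {y : V | 1 / 2 < g x y}) (by
    intro x hx
    refine IsOpen.mem_nhds (isOpen_lt continuous_const (by fun_prop)) ?_
    simp only [mem_setOf_eq, hg2]
    have : ‖(x : X)‖ = 1 := by simpa using hx
    rw [this]; norm_num)
  refine ⟨(fun x : V => g x) '' t, t.finite_toSet.image _, ?_⟩
  intro x hx hx0
  have hn : 0 < ‖x‖ := norm_pos_iff.2 hx0
  have hmem : (‖x‖⁻¹ • (⟨x, hx⟩ : V)) ∈ sphere (0 : V) 1 := by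
    simp [norm_smul, hn.ne']
  obtain ⟨z, hz⟩ := mem_iUnion.1 (ht2 hmem)
  obtain ⟨hz1, hz2⟩ := mem_iUnion.1 hz
  refine ⟨g z, ⟨z, hz1, rfl⟩, hg1 _, ?_⟩
  have h3 : (1 : ℝ) / 2 < g z (‖x‖⁻¹ • x) := hz2
  rw [map_smul, smul_eq_mul, inv_mul_eq_div, lt_div_iff₀ hn] at h3
  have := le_abs_self (g z x)
  linarith

structure ZDat (X : Type*) [NormedAddCommGroup X] [NormedSpace ℝ X] where
  y : X × ℝ
  N : ℕ
  V : Submodule ℝ X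
  F : Set (X →L[ℝ] ℝ)

theorem exists_weak_null_seq {S : ℕ → Set (X × ℝ)} (hS : Antitone S)
    (h : ∀ (F : Set (X →L[ℝ] ℝ)), F.Finite → ∀ N : ℕ, ∃ y ∈ S N, ∀ l ∈ F, l y.1 = 0) :
    ∃ y : ℕ → X × ℝ, (∀ n, y n ∈ S n) ∧
      ∀ (φ : ℕ → ℕ) (w : X), StrictMono φ →
        (∀ f : X →L[ℝ] ℝ, Tendsto (fun j => f (y (φ j)).1) atTop (𝓝 (f w))) → w = 0 := by
  let P : ZDat X → Prop := fun d => d.y ∈ S d.N ∧ FiniteDimensional ℝ d.V ∧ d.F.Finite ∧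
    d.y.1 ∈ d.V ∧ ∀ x ∈ d.V, x ≠ 0 → ∃ l ∈ d.F, ‖l‖ ≤ 1 ∧ ‖x‖ ≤ 2 * |l x|
  let r : ZDat X → ZDat X → Prop := fun a b => a.V ≤ b.V ∧ a.N < b.N ∧ ∀ l ∈ a.F, l b.y.1 = 0
  obtain ⟨d, hd1, hd2⟩ := exists_seq_of_forall_finset_exists P r (by
    intro s hs
    obtain ⟨y, hy, hyF⟩ := h (⋃ x ∈ s, x.F)
      (Set.Finite.biUnion s.finite_toSet (fun x hx => (hs x hx).2.2.1)) (s.sup ZDat.N + 1)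
    let V : Submodule ℝ X := (⨆ x : s, x.1.V) ⊔ Submodule.span ℝ {y.1}
    have hfd : ∀ x : s, FiniteDimensional ℝ x.1.V := fun x => (hs x.1 x.2).2.1
    have hV : FiniteDimensional ℝ V := inferInstance
    obtain ⟨F, hF1, hF2⟩ := norming V
    refine ⟨⟨y, s.sup ZDat.N + 1, V, F⟩, ⟨hy, hV, hF1, ?_, hF2⟩, ?_⟩
    · exact Submodule.mem_sup_right (Submodule.mem_span_singleton_self _)
    · intro x hx
      refine ⟨?_, ?_, ?_⟩
      · exact le_sup_of_le_left (le_iSup (fun x : s => x.1.V) ⟨x, hx⟩)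
      · exact Nat.lt_succ_of_le (Finset.le_sup (f := ZDat.N) hx)
      · intro l hl
        exact hyF l (mem_iUnion₂.2 ⟨x, hx, hl⟩))
  have hN : StrictMono (fun n => (d n).N) := fun m n hmn => (hd2 m n hmn).2.1
  have hV : Monotone (fun n => (d n).V) := by
    intro m n hmn
    rcases hmn.eq_or_lt with rfl | hlt
    · exact le_rfl
    · exact (hd2 m n hlt).1
  refine ⟨fun n => (d n).y, fun n => hS (hN.id_le n) (hd1 n).1, ?_⟩
  intro φ w hφ hw
  -- every functional in some F kills w
  have hkill : ∀ m, ∀ l ∈ (d m).F, l w = 0 := by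
    intro m l hl
    refine tendsto_nhds_unique (hw l) ?_
    refine tendsto_const_nhds.congr' ?_
    filter_upwards [eventually_gt_atTop m] with j hj
    have : m < φ j := lt_of_lt_of_le hj (hφ.id_le j)
    exact ((hd2 m _ this).2.2 l hl).symm
  -- w is in the closure of the union
  let U : Submodule ℝ X := ⨆ n, (d n).V
  have hUmem : ∀ x, x ∈ U ↔ ∃ n, x ∈ (d n).V := fun x =>
    Submodule.mem_iSup_of_directed _ hV.directed_le
  have hwU : w ∈ closure (U : Set X) := by
    refine weak_closed isClosed_closure U.convex.closure (fun j => (d (φ j)).y.1) w hw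
      (Frequently.of_forall fun j => subset_closure ?_)
    exact (hUmem _).2 ⟨φ j, (hd1 (φ j)).2.2.2.1⟩
  by_contra hw0
  have hwn : 0 < ‖w‖ := norm_pos_iff.2 hw0
  obtain ⟨x, hxU, hxw⟩ := Metric.mem_closure_iff.1 hwU (‖w‖ / 4) (by positivity)
  obtain ⟨n, hxn⟩ := (hUmem x).1 hxU
  rw [dist_eq_norm] at hxw
  have h1 : ‖w‖ ≤ ‖w - x‖ + ‖x‖ := by
    have := norm_add_le (w - x) x; rwa [sub_add_cancel] at this
  have hx0 : x ≠ 0 := by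
    rintro rfl
    simp at hxw
    linarith
  obtain ⟨l, hl, hl1, hl2⟩ := (hd1 n).2.2.2.2 x hxn hx0
  have h2 : |l x| ≤ ‖w - x‖ := by
    have h3 : l x = - l (w - x) := by rw [map_sub, hkill n l hl]; ring
    rw [h3, abs_neg, ← Real.norm_eq_abs]
    exact (l.le_opNorm _).trans (by nlinarith [norm_nonneg (w - x)])
  linarith

theorem lemma_Z (h : Setup Ψ Φ) {lam ρ : ℝ} (hlam : 0 < lam) (hρ : 0 < ρ) :
    ∃ (F : Set (X →L[ℝ] ℝ)), F.Finite ∧ ∃ m > 0, ∀ y ∈ epi Ψ, ‖y.1‖ = ρ → (∀ l ∈ F, l y.1 = 0) →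
      - Φ 0 + m ≤ Jf Φ lam y := by
  by_contra hcon
  push Not at hcon
  let S : ℕ → Set (X × ℝ) := fun N => {y | y ∈ epi Ψ ∧ ‖y.1‖ = ρ ∧
    Jf Φ lam y < - Φ 0 + 1 / ((N : ℝ) + 1)}
  have hS : Antitone S := by
    intro m n hmn y hy
    refine ⟨hy.1, hy.2.1, hy.2.2.trans_le ?_⟩
    have : (1 : ℝ) / ((n : ℝ) + 1) ≤ 1 / ((m : ℝ) + 1) := Nat.one_div_le_one_div hmn
    linarith
  obtain ⟨y, hyS, hyw⟩ := exists_weak_null_seq hS (by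
    intro F hF N
    obtain ⟨y, h1, h2, h3, h4⟩ := hcon F hF (1 / ((N : ℝ) + 1)) (by positivity)
    exact ⟨y, ⟨h1, h2, h4⟩, h3⟩)
  have hbd : IsBounded (range fun n => (y n).1) := by
    refine (isBounded_closedBall (x := (0 : X)) (r := ρ)).subset ?_
    rintro _ ⟨j, rfl⟩
    simpa using (hyS j).2.1.le
  obtain ⟨φ1, w, hφ1, hw1, -⟩ := p2r h _ hbd
  have hw0 := hyw φ1 w hφ1 hw1
  subst hw0
  -- mean value points
  have hΦd : Differentiable ℝ Φ := h.c1.differentiable one_ne_zero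
  have hmv : ∀ u : X, ∃ t ∈ Icc (0 : ℝ) 1, Φ u - Φ 0 = fderiv ℝ Φ (t • u) u := by
    intro u
    obtain ⟨t, ht, hte⟩ := exists_hasDerivAt_eq_slope (fun t : ℝ => Φ (t • u))
      (fun t => fderiv ℝ Φ (t • u) u) zero_lt_one
      (by have := hΦd.continuous; fun_prop) (by
        intro t _
        have h1 : HasDerivAt (fun t : ℝ => t • u) u t := by
          simpa using (hasDerivAt_id t).smul_const u
        exact (hΦd (t • u)).hasFDerivAt.comp_hasDerivAt t h1)
    exact ⟨t, Ioo_subset_Icc_self ht, by simpa using hte.symm⟩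
  choose T hT hTe using hmv
  let u : ℕ → X := fun n => (y (φ1 n)).1
  have hun : ∀ n, ‖u n‖ = ρ := fun n => (hyS _).2.1
  have hbd2 : IsBounded (range fun n => T (u n) • u n) := by
    refine (isBounded_closedBall (x := (0 : X)) (r := ρ)).subset ?_
    rintro _ ⟨j, rfl⟩
    have := hT (u j)
    simp only [mem_closedBall, dist_zero_right]
    rw [norm_smul, Real.norm_of_nonneg this.1, hun]
    nlinarith [this.2]
  obtain ⟨φ2, w, hφ2, hw2, hinf⟩ := p2r h _ hbd2
  have hw0 : w = 0 := by
    by_contra hne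
    obtain ⟨g, _, hg2⟩ := exists_dual_vector ℝ w (norm_ne_zero_iff.2 hne)
    have hz : Tendsto (fun j => g (T (u (φ2 j)) • u (φ2 j))) atTop (𝓝 0) := by
      have h1 : Tendsto (fun j => ‖g (u (φ2 j))‖) atTop (𝓝 0) := by
        have := ((hw1 g).comp hφ2.tendsto_atTop).norm
        simpa using this
      refine squeeze_zero_norm (fun j => ?_) h1
      rw [map_smul, norm_smul, Real.norm_of_nonneg (hT _).1]
      nlinarith [(hT (u (φ2 j))).2, norm_nonneg (g (u (φ2 j)))]
    have := tendsto_nhds_unique (hw2 g) hz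
    rw [this] at hg2
    simp at hg2
    exact hne (norm_eq_zero.1 hg2.symm)
  subst hw0
  obtain ⟨t, ht, ψ, hψ, htt⟩ := isCompact_Icc.tendsto_subseq (x := fun j => T (u (φ2 j)))
    (fun j => hT _)
  -- final sequence
  let χ : ℕ → ℕ := φ1 ∘ φ2 ∘ ψ
  have hχ : StrictMono χ := hφ1.comp (hφ2.comp hψ)
  let v : ℕ → X := fun j => u (φ2 (ψ j))
  have hvw : ∀ f : X →L[ℝ] ℝ, Tendsto (fun j => f (v j)) atTop (𝓝 (f 0)) := fun f =>
    (hw1 f).comp (hφ2.comp hψ).tendsto_atTop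
  have hvn : ∀ j, ‖v j‖ = ρ := fun j => hun _
  have htt' : Tendsto (fun j => T (v j)) atTop (𝓝 t) := htt
  have hlim : ∀ e > 0, ∀ᶠ j in atTop, Φ (v j) - Φ 0 < e := by
    intro e he
    rcases ht.1.eq_or_lt with h0 | h0
    · -- t = 0
      subst h0
      have hz : Tendsto (fun j => T (v j) • v j) atTop (𝓝 0) := by
        have h1 : Tendsto (fun j => T (v j) * ρ) atTop (𝓝 0) := by
          simpa using htt'.mul_const ρ
        refine squeeze_zero_norm (fun j => ?_) h1
        rw [norm_smul, Real.norm_of_nonneg (hT _).1, hvn]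
      have hD : Tendsto (fun j => fderiv ℝ Φ (T (v j) • v j)) atTop (𝓝 (fderiv ℝ Φ 0)) :=
        ((h.c1.continuous_fderiv one_ne_zero).tendsto 0).comp hz
      have h2 : Tendsto (fun j => (fderiv ℝ Φ (T (v j) • v j) - fderiv ℝ Φ 0) (v j)) atTop (𝓝 0) := by
        have h1 : Tendsto (fun j => ‖fderiv ℝ Φ (T (v j) • v j) - fderiv ℝ Φ 0‖ * ρ) atTop (𝓝 0) := by
          have := (tendsto_iff_norm_sub_tendsto_zero.1 hD).mul_const ρ
          simpa using this
        refine squeeze_zero_norm (fun j => ?_) h1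
        have := (fderiv ℝ Φ (T (v j) • v j) - fderiv ℝ Φ 0).le_opNorm (v j)
        rwa [hvn] at this
      have h3 := h2.add (hvw (fderiv ℝ Φ 0))
      simp only [ContinuousLinearMap.sub_apply, sub_add_cancel, map_zero, add_zero] at h3
      filter_upwards [h3.eventually_lt_const he] with j hj
      rw [hTe]; exact hj
    · have h1 := hψ.tendsto_atTop.eventually (hinf 0 (e * (t / 2)) (by positivity))
      filter_upwards [h1, htt'.eventually_const_lt (show t / 2 < t by linarith)] with j hj hj2
      rw [hTe]
      simp only [sub_self, map_zero, zero_sub, map_neg, map_smul, smul_eq_mul] at hj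
      have h2 : T (v j) * fderiv ℝ Φ (T (v j) • v j) (v j) < e * (t / 2) := by
        simp only [v]; linarith
      by_contra hcon2
      push Not at hcon2
      nlinarith
  have hp0 : Tendsto (fun j => (y (χ j)).2) atTop (𝓝 (Ψ 0).toReal) := by
    rw [h.zero]
    simp only [EReal.toReal_zero]
    rw [tendsto_order]
    constructor
    · intro a ha
      exact Eventually.of_forall fun j => ha.trans_le (epi_nonneg h (hyS _).1)
    · intro a ha
      have hl : 0 < lam * a / 2 := by positivity
      have h1 : Tendsto (fun j => 1 / (((χ j : ℕ) : ℝ) + 1)) atTop (𝓝 0) :=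
        tendsto_one_div_add_atTop_nhds_zero_nat.comp hχ.tendsto_atTop
      filter_upwards [hlim _ hl, h1.eventually_lt_const hl] with j hj1 hj2
      have h3 := (hyS (χ j)).2.2
      simp only [Jf] at h3
      have h4 : Φ (v j) = Φ (y (χ j)).1 := rfl
      rw [h4] at hj1
      have : lam * (y (χ j)).2 < lam * a := by linarith
      exact lt_of_mul_lt_mul_left this hlam.le
  have hconv := weak_conv_Ψ h (u := v) (p := fun j => (y (χ j)).2) hvw (fun j => (hyS _).1)
    (by rw [h.zero]; exact EReal.zero_ne_top) hp0
  have := hconv.norm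
  simp only [hvn, norm_zero] at this
  have := tendsto_nhds_unique this tendsto_const_nhds
  linarith

end lemZ
end BU

namespace BU

section eight
variable {X : Type*} [NormedAddCommGroup X] [NormedSpace ℝ X]
variable {Ψ : X → EReal} {Φ : X → ℝ}

/-- the symmetry `(u, p) ↦ (-u, p)` -/
noncomputable def sg : (X × ℝ) →L[ℝ] (X × ℝ) :=
  (-(ContinuousLinearMap.fst ℝ X ℝ)).prod (ContinuousLinearMap.snd ℝ X ℝ)

theorem sg_apply (y : X × ℝ) : sg y = (-y.1, y.2) := rfl

theorem sg_sg (y : X × ℝ) : sg (sg y) = y := by simp [sg_apply]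

theorem sg_norm (y : X × ℝ) : ‖sg y‖ = ‖y‖ := by simp [sg_apply, Prod.norm_def]

theorem sg_epi (h : Setup Ψ Φ) {y : X × ℝ} (hy : y ∈ epi Ψ) : sg y ∈ epi Ψ := by
  have : Ψ y.1 ≤ (y.2 : EReal) := hy
  change Ψ (-y.1) ≤ (y.2 : EReal)
  rwa [h.Ψeven]

theorem Jf_sg (h : Setup Ψ Φ) (lam : ℝ) (y : X × ℝ) : Jf Φ lam (sg y) = Jf Φ lam y := by
  simp [Jf, sg_apply, h.Φeven]

theorem Jf_contDiff (h : Setup Ψ Φ) (lam : ℝ) : ContDiff ℝ 1 (Jf Φ lam) := by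
  unfold Jf
  exact (contDiff_const.mul contDiff_snd).sub (h.c1.comp contDiff_fst)

theorem Jf_cont (h : Setup Ψ Φ) (lam : ℝ) : Continuous (Jf Φ lam) := (Jf_contDiff h lam).continuous

theorem Jf_fderiv (h : Setup Ψ Φ) (lam : ℝ) (y z : X × ℝ) :
    fderiv ℝ (Jf Φ lam) y z = lam * z.2 - fderiv ℝ Φ y.1 z.1 := by
  have h1 : HasFDerivAt (Jf Φ lam) (lam • ContinuousLinearMap.snd ℝ X ℝ -
      (fderiv ℝ Φ y.1).comp (ContinuousLinearMap.fst ℝ X ℝ)) y := by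
    have h2 : HasFDerivAt (fun y : X × ℝ => y.2) (ContinuousLinearMap.snd ℝ X ℝ) y :=
      (ContinuousLinearMap.snd ℝ X ℝ).hasFDerivAt
    have h3 : HasFDerivAt (fun y : X × ℝ => y.1) (ContinuousLinearMap.fst ℝ X ℝ) y :=
      (ContinuousLinearMap.fst ℝ X ℝ).hasFDerivAt
    have h4 : HasFDerivAt Φ (fderiv ℝ Φ y.1) y.1 :=
      ((h.c1.differentiable one_ne_zero) y.1).hasFDerivAt
    exact (h2.const_mul lam).sub (h4.comp y h3)
  rw [h1.fderiv]
  simp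

theorem Jf_mono (h : Setup Ψ Φ) {lam lam' : ℝ} (hl : lam ≤ lam') {y : X × ℝ} (hy : y ∈ epi Ψ) :
    Jf Φ lam y ≤ Jf Φ lam' y := by
  have := epi_nonneg h hy
  unfold Jf
  nlinarith

def C1 : Set (X × ℝ) := {y | y.1 = 0}
def C2 (Φ : X → ℝ) (ρ lam : ℝ) : Set (X × ℝ) := {y | ρ ≤ ‖y.1‖ ∧ Jf Φ lam y ≤ 0}

def AC (Ψ : X → EReal) (Φ : X → ℝ) (ρ lam : ℝ) (j : ℕ) (A : Set (X × ℝ)) : Prop :=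
  Cls sg (epi Ψ) C1 (C2 Φ ρ lam) j A

theorem AC.mono (h : Setup Ψ Φ) {ρ lam lam' : ℝ} {j : ℕ} {A : Set (X × ℝ)} (hl : lam ≤ lam')
    (hA : AC Ψ Φ ρ lam' j A) : AC Ψ Φ ρ lam j A := by
  have := Cls.image hA id continuousOn_id (fun a ha => hA.2.1 ha) (fun _ _ => rfl)
    (C1' := C1) (C2' := C2 Φ ρ lam) (fun _ _ h => h)
    (fun a ha h2 => ⟨h2.1, (Jf_mono h hl (hA.2.1 ha)).trans h2.2⟩)
  simpa [AC] using this

theorem AC.meet {ρ lam : ℝ} (hρ : 0 ≤ ρ) {j : ℕ} {A : Set (X × ℝ)} (hA : AC Ψ Φ ρ lam j A)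
    (l : Fin j → (X →L[ℝ] ℝ)) : ∃ a ∈ A, ‖a.1‖ = ρ ∧ ∀ i, l i a.1 = 0 := by
  obtain ⟨a, ha, h1, h2, h3⟩ := hA.2.2.2 {y | ‖y.1‖ ≤ ρ} {y | ρ ≤ ‖y.1‖} (fun y i => l i y.1)
    (isClosed_le (by fun_prop) (by fun_prop)) (isClosed_le (by fun_prop) (by fun_prop))
    (fun a _ h => by simpa [sg_apply] using h)
    (fun a _ => le_total ‖a.1‖ ρ)
    (fun a _ h => by
      have h0 : a.1 = 0 := h
      simpa [h0] using hρ)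
    (fun a _ h => h.1) (by fun_prop) (fun a _ => by ext i; simp [sg_apply])
  exact ⟨a, ha, le_antisymm h1 h2, fun i => congrFun h3 i⟩

def SS (Ψ : X → EReal) (Φ : X → ℝ) (ρ lam : ℝ) : Set ℝ :=
  {c | ∀ j, ∃ A, AC Ψ Φ ρ lam j A ∧ ∀ a ∈ A, Jf Φ lam a ≤ c}

theorem SS_mono (h : Setup Ψ Φ) {ρ lam lam' : ℝ} (hl : lam ≤ lam') :
    SS Ψ Φ ρ lam' ⊆ SS Ψ Φ ρ lam := by
  intro c hc j
  obtain ⟨A, hA, hAc⟩ := hc j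
  exact ⟨A, hA.mono h hl, fun a ha => (Jf_mono h hl (hA.2.1 ha)).trans (hAc a ha)⟩

theorem SS_lower (hρ : 0 ≤ ρ) {lam α c : ℝ}
    (hα : ∀ y ∈ epi Ψ, ‖y.1‖ = ρ → α ≤ Jf Φ lam y) (hc : c ∈ SS Ψ Φ ρ lam) : α ≤ c := by
  obtain ⟨A, hA, hAc⟩ := hc 0
  obtain ⟨a, ha, h1, -⟩ := hA.meet hρ (fun i => i.elim0)
  exact (hα a (hA.2.1 ha) h1).trans (hAc a ha)

theorem SS_gt (h : Setup Ψ Φ) {ρ lam : ℝ} (hlam : 0 < lam) (hρ : 0 < ρ) :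
    ∃ m > 0, ∀ c ∈ SS Ψ Φ ρ lam, - Φ 0 + m ≤ c := by
  obtain ⟨F, hF, m, hm, hFm⟩ := lemma_Z h hlam hρ
  refine ⟨m, hm, fun c hc => ?_⟩
  obtain ⟨n, l, -, hl⟩ := hF.fin_param
  obtain ⟨A, hA, hAc⟩ := hc n
  obtain ⟨a, ha, h1, h2⟩ := hA.meet hρ.le l
  refine (hFm a (hA.2.1 ha) h1 ?_).trans (hAc a ha)
  intro g hg
  rw [← hl] at hg
  obtain ⟨i, rfl⟩ := hg
  exact h2 i

section startsec
variable {E : Type*} [NormedAddCommGroup E] [NormedSpace ℝ E]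

/-- radial retraction onto the unit ball -/
noncomputable def Qr (x : E) : E := (max 1 ‖x‖)⁻¹ • x

theorem Qr_cont : Continuous (Qr : E → E) := by
  unfold Qr
  refine Continuous.smul (Continuous.inv₀ (by fun_prop) ?_) continuous_id
  intro x
  have : (1 : ℝ) ≤ max 1 ‖x‖ := le_max_left _ _
  linarith

theorem Qr_neg (x : E) : Qr (-x) = - Qr x := by simp [Qr]

theorem Qr_of_le {x : E} (hx : ‖x‖ ≤ 1) : Qr x = x := by simp [Qr, hx]

theorem Qr_norm {x : E} (hx : 1 ≤ ‖x‖) : ‖Qr x‖ = 1 := by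
  have : ‖x‖ ≠ 0 := by linarith
  simp [Qr, hx, norm_smul, this]

theorem Qr_norm_le (x : E) : ‖Qr x‖ ≤ 1 := by
  rcases le_total ‖x‖ 1 with h | h
  · rwa [Qr_of_le h]
  · exact (Qr_norm h).le

theorem Qr_two {x : E} (hx : 1 ≤ ‖x‖) : Qr ((2 : ℝ) • x) = Qr x := by
  have h2 : 1 ≤ 2 * ‖x‖ := by linarith
  have h0 : ‖x‖ ≠ 0 := by linarith
  simp only [Qr, norm_smul, Real.norm_ofNat, max_eq_right h2, max_eq_right hx, smul_smul]
  congr 1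
  field_simp

end startsec

theorem zero_of_eq_neg {x : X} (hx : x = -x) : x = 0 := by
  have h1 : (2 : ℝ) • x = 0 := by
    rw [two_smul]
    nth_rewrite 1 [hx]
    simp
  simpa using h1

theorem start_ac (h : Setup Ψ Φ) {ρ c : ℝ} (hc : 0 ≤ c) {j k : ℕ} (hjk : j < k)
    (γ : EuclideanSpace ℝ (Fin k) → X)
    (hγ : ContinuousOn γ (closedBall 0 1))
    (hodd : ∀ ζ ∈ closedBall (0 : EuclideanSpace ℝ (Fin k)) 1, γ (-ζ) = - γ ζ)
    (hb1 : ∀ ζ : EuclideanSpace ℝ (Fin k), ‖ζ‖ = 1 → ρ ≤ ‖γ ζ‖)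
    (hb2 : ∀ ζ : EuclideanSpace ℝ (Fin k), ‖ζ‖ = 1 → Ψ (γ ζ) ≤ ((Φ (γ ζ) : ℝ) : EReal))
    (hb3 : ∀ ζ : EuclideanSpace ℝ (Fin k), ‖ζ‖ ≤ 1 → Ψ (γ ζ) ≤ ((c + Φ (γ ζ) : ℝ) : EReal)) :
    ∃ A, AC Ψ Φ ρ 1 j A ∧ ∀ a ∈ A, Jf Φ 1 a ≤ c := by
  let χ : EuclideanSpace ℝ (Fin k) → ℝ := fun x => max 0 (min 1 (2 - 2 * ‖x‖))
  let g : EuclideanSpace ℝ (Fin k) → X := fun x => γ (Qr ((2 : ℝ) • x))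
  have hg : Continuous g := by
    refine hγ.comp_continuous (Qr_cont.comp (by fun_prop)) (fun x => ?_)
    simpa using Qr_norm_le ((2 : ℝ) • x)
  have hχ0 : ∀ x, 0 ≤ χ x := fun x => le_max_left _ _
  have hχ1 : ∀ x, χ x ≤ 1 := fun x => max_le zero_le_one (min_le_left _ _)
  have hχz : ∀ x, 1 ≤ ‖x‖ → χ x = 0 := fun x hx =>
    max_eq_left ((min_le_right _ _).trans (by linarith))
  have hΦc : Continuous Φ := h.c1.continuous
  let H : EuclideanSpace ℝ (Fin k) → X × ℝ := fun x => (g x, χ x * c + Φ (g x))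
  have hJ : ∀ x, Jf Φ 1 (H x) = χ x * c := fun x => by simp [Jf, H]
  refine ⟨range H, Cls.start hjk H ?_ ?_ ?_ ?_ ?_ ?_, ?_⟩
  · exact hg.prodMk (by fun_prop)
  · intro x
    have h1 : g (-x) = - g x := by
      simp only [g, smul_neg, Qr_neg]
      exact hodd _ (by simpa using Qr_norm_le ((2 : ℝ) • x))
    simp [H, sg_apply, h1, h.Φeven, χ]
  · intro x
    change Ψ (g x) ≤ ((χ x * c + Φ (g x) : ℝ) : EReal)
    rcases le_total 1 ‖(2 : ℝ) • x‖ with h1 | h1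
    · refine (hb2 _ (Qr_norm h1)).trans ?_
      have := mul_nonneg (hχ0 x) hc
      exact EReal.coe_le_coe_iff.2 (by simp only [g]; linarith)
    · have h2 : χ x = 1 := by
        rw [norm_smul, Real.norm_ofNat] at h1
        simp only [χ]
        rw [min_eq_left (by linarith)]
        simp
      rw [h2, one_mul]
      exact hb3 _ (Qr_norm_le _)
  · intro x
    refine ⟨Qr x, by simpa using Qr_norm_le x, ?_⟩
    rcases le_total ‖x‖ 1 with h1 | h1
    · rw [Qr_of_le h1]
    · have e1 : g (Qr x) = g x := by
        simp only [g]
        rw [Qr_two (Qr_norm h1).ge, Qr_two h1, Qr_of_le (Qr_norm h1).le]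
      simp [H, e1, hχz x h1, hχz _ (Qr_norm h1).ge]
  · have h1 := hodd 0 (by simp)
    rw [neg_zero] at h1
    have h2 : γ 0 = 0 := zero_of_eq_neg h1
    have h3 : g 0 = 0 := by simp [g, Qr, h2]
    exact h3
  · intro x hx
    refine ⟨?_, ?_⟩
    · exact hb1 _ (Qr_norm (by rw [norm_smul, Real.norm_ofNat]; linarith))
    · rw [hJ, hχz x hx, zero_mul]
  · rintro _ ⟨x, rfl⟩
    rw [hJ]
    nlinarith [hχ1 x]

end eight
end BU

namespace BU

section nine
variable {X : Type*} [NormedAddCommGroup X] [NormedSpace ℝ X]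
variable {Ψ : X → EReal} {Φ : X → ℝ}

def KK (Ψ : X → EReal) (Φ : X → ℝ) (lam N b : ℝ) : Set (X × ℝ) :=
  {y | y ∈ epi Ψ ∧ y.2 ≤ N ∧ Jf Φ lam y = b ∧ ∀ z ∈ epi Ψ, z.2 ≤ N + 1 →
    0 ≤ lam * (z.2 - y.2) - fderiv ℝ Φ y.1 (z.1 - y.1)}

theorem fd_cont (h : Setup Ψ Φ) (lam : ℝ) (z : X × ℝ) :
    Continuous (fun y : X × ℝ => lam * (z.2 - y.2) - fderiv ℝ Φ y.1 (z.1 - y.1)) := by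
  have h1 : Continuous (fderiv ℝ Φ) := h.c1.continuous_fderiv one_ne_zero
  have h2 : Continuous (fun y : X × ℝ => fderiv ℝ Φ y.1) := h1.comp continuous_fst
  have h3 : Continuous (fun y : X × ℝ => fderiv ℝ Φ y.1 (z.1 - y.1)) := by
    exact h2.clm_apply (by fun_prop)
  fun_prop

theorem KK_compact (h : Setup Ψ Φ) {lam : ℝ} (hlam : 0 < lam) (N b : ℝ) :
    IsCompact (KK Ψ Φ lam N b) := by
  apply IsSeqCompact.isCompact
  intro y hy
  obtain ⟨φ, hφ, w, hw, hlim⟩ := PS h hlam (N := N) (fun j => (y j).1) (fun j => (y j).2)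
    (fun _ => 0) (fun j => (hy j).1) (fun j => (hy j).2.1) tendsto_const_nhds
    (fun j z hz hzN => by simpa using (hy j).2.2.2 z hz hzN)
  have hlim' : Tendsto (fun j => y (φ j)) atTop (𝓝 w) := hlim
  refine ⟨w, ⟨hw, ?_, ?_, ?_⟩, φ, hφ, hlim'⟩
  · exact le_of_tendsto ((continuous_snd.tendsto w).comp hlim')
      (Eventually.of_forall fun j => (hy (φ j)).2.1)
  · refine tendsto_nhds_unique (((Jf_cont h lam).tendsto w).comp hlim') ?_
    exact tendsto_const_nhds.congr (fun j => ((hy (φ j)).2.2.1).symm)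
  · intro z hz hzN
    exact ge_of_tendsto (((fd_cont h lam z).tendsto w).comp hlim')
      (Eventually.of_forall fun j => (hy (φ j)).2.2.2 z hz hzN)

theorem KK_sg (h : Setup Ψ Φ) {lam N b : ℝ} {y : X × ℝ} (hy : y ∈ KK Ψ Φ lam N b) :
    sg y ∈ KK Ψ Φ lam N b := by
  refine ⟨sg_epi h hy.1, hy.2.1, by rw [Jf_sg h]; exact hy.2.2.1, ?_⟩
  intro z hz hzN
  have h1 := hy.2.2.2 (sg z) (sg_epi h hz) hzN
  have h2 : fderiv ℝ Φ (-y.1) = - fderiv ℝ Φ y.1 := by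
    have h3 : HasFDerivAt (fun x => Φ (-x))
        ((fderiv ℝ Φ (-y.1)).comp (-(ContinuousLinearMap.id ℝ X))) y.1 :=
      ((h.c1.differentiable one_ne_zero) (-y.1)).hasFDerivAt.comp y.1
        (hasFDerivAt_id y.1).neg
    have h4 : (fun x => Φ (-x)) = Φ := funext h.Φeven
    rw [h4] at h3
    rw [h3.fderiv]
    ext v
    simp
  simp only [sg_apply] at h1 ⊢
  rw [h2]
  have h5 : (-z.1 - y.1) = - (z.1 - -y.1) := by abel
  rw [h5, map_neg] at h1
  simpa using h1

theorem KK_ne (h : Setup Ψ Φ) {lam N b : ℝ} (hlam : 0 < lam) (hN : 0 ≤ N) (hb : b ≠ - Φ 0)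
    {y : X × ℝ} (hy : y ∈ KK Ψ Φ lam N b) : y.1 ≠ 0 := by
  intro h0
  have h1 := hy.2.2.2 (0, 0) (by simp [epi, h.zero]) (by simpa using by linarith)
  rw [h0] at h1
  simp at h1
  have h2 := epi_nonneg h hy.1
  have h3 : y.2 = 0 := by nlinarith
  apply hb
  rw [← hy.2.2.1, Jf, h0, h3]
  simp

theorem sg_thick (h : Setup Ψ Φ) {lam N b r : ℝ} {y : X × ℝ}
    (hy : y ∈ thickening r (KK Ψ Φ lam N b)) : sg y ∈ thickening r (KK Ψ Φ lam N b) := by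
  rw [mem_thickening_iff] at hy ⊢
  obtain ⟨z, hz, hd⟩ := hy
  refine ⟨sg z, KK_sg h hz, ?_⟩
  rwa [dist_eq_norm, ← map_sub, sg_norm, ← dist_eq_norm]

theorem KK_funct {K : Set (X × ℝ)} (hK : IsCompact K) (hne : ∀ y ∈ K, y.1 ≠ 0) :
    ∃ (n : ℕ) (l : Fin n → (X →L[ℝ] ℝ)), ∃ r > 0, ∀ y ∈ cthickening r K,
      (fun i => l i y.1) ≠ 0 := by
  have hd : ∀ x : X, ∃ g : X →L[ℝ] ℝ, g x = ‖x‖ := by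
    intro x
    obtain ⟨g, h1, h2⟩ := exists_dual_vector'' ℝ x
    exact ⟨g, by simpa using h2⟩
  choose g hg using hd
  obtain ⟨t, ht1, ht2⟩ := hK.elim_nhds_subcover (fun x => {y : X × ℝ | g x.1 y.1 ≠ 0}) (by
    intro x hx
    refine IsOpen.mem_nhds (isOpen_ne_fun (by fun_prop) (by fun_prop)) ?_
    change g x.1 x.1 ≠ 0
    rw [hg]
    exact norm_ne_zero_iff.2 (hne x hx))
  obtain ⟨n, l, -, hl⟩ := (t.finite_toSet.image (fun x => g x.1)).fin_param
  have hopen : IsOpen {y : X × ℝ | (fun i => l i y.1) ≠ 0} :=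
    isOpen_ne_fun (by fun_prop) (by fun_prop)
  obtain ⟨r, hr, hrs⟩ := hK.exists_cthickening_subset_open hopen (by
    intro y hy
    obtain ⟨x, hx⟩ := mem_iUnion.1 (ht2 hy)
    obtain ⟨hx1, hx2⟩ := mem_iUnion.1 hx
    have : g x.1 ∈ range l := by rw [hl]; exact ⟨x, hx1, rfl⟩
    obtain ⟨i, hi⟩ := this
    intro h0
    apply hx2
    rw [← hi]
    exact congrFun h0 i)
  exact ⟨n, l, r, hr, hrs⟩

theorem PS_unif (h : Setup Ψ Φ) {lam : ℝ} (hlam : 0 < lam) (N b : ℝ) {r : ℝ} (hr : 0 < r) :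
    ∃ κ > 0, ∀ y ∈ epi Ψ, y.2 ≤ N → |Jf Φ lam y - b| ≤ κ → y ∉ thickening r (KK Ψ Φ lam N b) →
      ∃ z ∈ epi Ψ, z.2 ≤ N + 1 ∧ fderiv ℝ (Jf Φ lam) y (z - y) < -2 * κ := by
  by_contra hcon
  push Not at hcon
  have h1 := fun n : ℕ => hcon (1 / ((n : ℝ) + 1)) (by positivity)
  choose y hy hyN hyJ hyK hyz using h1
  have he0 : Tendsto (fun n : ℕ => 1 / ((n : ℝ) + 1)) atTop (𝓝 0) :=
    tendsto_one_div_add_atTop_nhds_zero_nat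
  have he : Tendsto (fun n : ℕ => 2 * (1 / ((n : ℝ) + 1))) atTop (𝓝 0) := by
    simpa using he0.const_mul 2
  have hps : ∀ j : ℕ, ∀ z ∈ epi Ψ, z.2 ≤ N + 1 →
      - (2 * (1 / ((j : ℝ) + 1))) ≤ lam * (z.2 - (y j).2) - fderiv ℝ Φ (y j).1 (z.1 - (y j).1) := by
    intro j z hz hzN
    have := hyz j z hz hzN
    rw [Jf_fderiv h] at this
    simp only [Prod.fst_sub, Prod.snd_sub] at this
    linarith
  obtain ⟨φ, hφ, w, hw, hlim⟩ := PS h hlam (N := N) (fun j => (y j).1) (fun j => (y j).2)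
    _ hy hyN he hps
  have hlim' : Tendsto (fun j => y (φ j)) atTop (𝓝 w) := hlim
  have hwK : w ∈ KK Ψ Φ lam N b := by
    refine ⟨hw, ?_, ?_, ?_⟩
    · exact le_of_tendsto ((continuous_snd.tendsto w).comp hlim')
        (Eventually.of_forall fun j => hyN (φ j))
    · have h2 : Tendsto (fun j => Jf Φ lam (y (φ j)) - b) atTop (𝓝 0) :=
        squeeze_zero_norm (fun j => hyJ (φ j)) (he0.comp hφ.tendsto_atTop)
      have h3 : Tendsto (fun j => Jf Φ lam (y (φ j)) - b) atTop (𝓝 (Jf Φ lam w - b)) :=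
        (((Jf_cont h lam).tendsto w).comp hlim').sub_const b
      have := tendsto_nhds_unique h2 h3
      linarith
    · intro z hz hzN
      have h2 : Tendsto (fun j => -(2 * (1 / ((φ j : ℝ) + 1)))) atTop (𝓝 0) := by
        simpa using (he.comp hφ.tendsto_atTop).neg
      exact le_of_tendsto_of_tendsto h2 (((fd_cont h lam z).tendsto w).comp hlim')
        (Eventually.of_forall fun j => hps (φ j) z hz hzN)
  have hev := hlim'.eventually (ball_mem_nhds w hr)
  obtain ⟨j, hj⟩ := hev.exists
  exact hyK (φ j) (mem_thickening_iff.2 ⟨w, hwK, hj⟩)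

theorem step [CompleteSpace X] (h : Setup Ψ Φ) {lam ρ b C t0 : ℝ} (hlam : 0 < lam) (hb0 : 0 < b)
    (hbβ : b ≠ - Φ 0) (hC : 0 ≤ C) (ht0 : 0 < t0)
    (hS : ∀ t, 0 < t → t < t0 → b + (C + 1) * t ∈ SS Ψ Φ ρ (lam + t)) :
    ∃ c < b, c ∈ SS Ψ Φ ρ lam := by
  set N : ℝ := C + 3 with hN
  set K := KK Ψ Φ lam N b with hKdef
  have hK : IsCompact K := KK_compact h hlam N b
  obtain ⟨n, l, r, hr, hl⟩ := KK_funct hK (fun y hy => KK_ne h hlam (by positivity) hbβ hy)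
  obtain ⟨κ, hκ, hκ2⟩ := PS_unif h hlam N b (half_pos hr)
  obtain ⟨R, hR, hRb⟩ := epi_bdd h (N + 1)
  set L : ℝ := 2 * R + N + 2 with hL
  have hL0 : 0 < L := by positivity
  obtain ⟨t, ht, htt0, htb, ht1, ht2, ht3⟩ : ∃ t : ℝ, 0 < t ∧ t < t0 ∧ t < b ∧ (C + 1) * t ≤ κ ∧
      L * ((C + 2) * t / κ) ≤ r / 2 ∧ L * ((C + 2) * t / κ) ≤ 1 := by
    have e1 : ∀ᶠ t : ℝ in 𝓝[>] 0, 0 < t := self_mem_nhdsWithin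
    have e2 : ∀ s : ℝ, 0 < s → ∀ᶠ t : ℝ in 𝓝[>] 0, t < s := fun s hs =>
      mem_nhdsWithin_of_mem_nhds (Iio_mem_nhds hs)
    have e3 : ∀ (f : ℝ → ℝ) (s : ℝ), Continuous f → f 0 = 0 → 0 < s →
        ∀ᶠ t : ℝ in 𝓝[>] 0, f t ≤ s := by
      intro f s hf hf0 hs
      have : Tendsto f (𝓝[>] 0) (𝓝 (f 0)) := hf.continuousAt.mono_left nhdsWithin_le_nhds
      rw [hf0] at this
      exact (this.eventually (Iio_mem_nhds hs)).mono fun _ h => le_of_lt h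
    exact (e1.and ((e2 t0 ht0).and ((e2 b hb0).and
      ((e3 (fun t => (C + 1) * t) κ (by fun_prop) (by simp) hκ).and
      ((e3 (fun t => L * ((C + 2) * t / κ)) (r / 2) (by fun_prop) (by simp) (half_pos hr)).and
      (e3 (fun t => L * ((C + 2) * t / κ)) 1 (by fun_prop) (by simp) one_pos)))))).exists
  refine ⟨b - t, by linarith, fun j => ?_⟩
  obtain ⟨A, hA, hAc⟩ := hS t ht htt0 (j + n)
  set A' := A \ thickening r K with hA'
  have hAC : Cls sg (epi Ψ) C1 (C2 Φ ρ (lam + t)) j A' := by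
    refine Cls.excise sg.continuous sg_sg hA isOpen_thickening (fun y hy => sg_thick h hy)
      (fun y i => l i y.1) (by fun_prop) (fun y => by ext i; simp [sg_apply]) ?_
    intro y hy
    exact hl y (closure_thickening_subset_cthickening _ _ hy)
  let G : Set (X × ℝ) := {y | y ∈ epi Ψ ∧ y.2 ≤ N ∧ b - t ≤ Jf Φ lam y ∧ Jf Φ lam y ≤ b + (C + 1) * t
    ∧ y ∈ (thickening (r / 2) K)ᶜ}
  have hJc := Jf_cont h lam
  have hGc : IsClosed G := by
    refine (epi_closed h).inter (IsClosed.inter ?_ (IsClosed.inter ?_ (IsClosed.inter ?_ ?_)))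
    · exact isClosed_le continuous_snd continuous_const
    · exact isClosed_le continuous_const hJc
    · exact isClosed_le hJc continuous_const
    · exact isOpen_thickening.isClosed_compl
  have hGs : ∀ y ∈ G, sg y ∈ G := by
    rintro y ⟨h1, h2, h3, h4, h5⟩
    refine ⟨sg_epi h h1, h2, by rwa [Jf_sg h], by rwa [Jf_sg h], fun h6 => h5 ?_⟩
    have := sg_thick h h6
    rwa [sg_sg] at this
  have hJA : ∀ x ∈ A', Jf Φ lam x ≤ b + (C + 1) * t := fun x hx =>
    (Jf_mono h (by linarith) (hAC.2.1 hx)).trans (hAc x hx.1)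
  obtain ⟨η, hη1, hη2⟩ := deform (epi_closed h) (epi_convex h) sg sg_sg sg_norm
    (fun y hy => sg_epi h hy) (Jf_contDiff h lam) (Jf_sg h lam) hL0 hκ hGc hGs (by
      rintro y ⟨h1, h2, h3, h4, h5⟩ -
      refine ⟨by linarith, ?_⟩
      obtain ⟨z, hz, hzN, hzd⟩ := hκ2 y h1 h2 (by rw [abs_le]; constructor <;> nlinarith) h5
      refine ⟨z, hz, ?_, hzd⟩
      have a1 := hRb z hz hzN
      have a2 := hRb y h1 (by linarith)
      have a3 := epi_nonneg h hz
      have a4 := epi_nonneg h h1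
      rw [Prod.norm_def]
      refine max_lt ?_ ?_
      · have := norm_sub_le z.1 y.1
        simp only [Prod.fst_sub]
        have : 0 ≤ N := by positivity
        linarith
      · simp only [Prod.snd_sub]
        rw [Real.norm_eq_abs, abs_lt]
        constructor <;> linarith)
    hAC.1 hAC.2.1 hAC.2.2.1 (T := (C + 2) * t / κ) (c := b - t) (by positivity) (by
      intro x hx y hy hyx hcy hyJ
      have hxp : x.2 ≤ C + 2 := by
        have a1 := hAc x hx.1
        have a2 : Jf Φ (lam + t) x = Jf Φ lam x + t * x.2 := by simp only [Jf]; ring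
        have a3 : t * x.2 ≤ t * (C + 2) := by linarith
        exact le_of_mul_le_mul_left a3 ht
      have hn2 : |y.2 - x.2| ≤ 1 := by
        have := norm_snd_le (y - x)
        simp only [Prod.snd_sub, Real.norm_eq_abs] at this
        linarith
      refine ⟨hy, ?_, hcy, hyJ.trans (hJA x hx), ?_⟩
      · have := (abs_le.1 hn2).2
        linarith
      · intro hyK
        apply hx.2
        rw [mem_thickening_iff] at hyK ⊢
        obtain ⟨z, hz, hd⟩ := hyK
        refine ⟨z, hz, ?_⟩
        have := dist_triangle x y z
        rw [dist_comm x y, dist_eq_norm y x] at this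
        linarith)
  refine ⟨η '' A', Cls.image hAC η hη1 (fun a ha => (hη2 a ha).2.1) (fun a ha => (hη2 a ha).1)
    ?_ ?_, ?_⟩
  · intro a ha ha0
    have h0 : a.1 = 0 := ha0
    have h1 : sg a = a := by ext <;> simp [sg_apply, h0]
    have h2 := (hη2 a ha).1
    rw [h1] at h2
    have h3 : (η a).1 = - (η a).1 := congrArg Prod.fst h2
    exact zero_of_eq_neg h3
  · intro a ha ha2
    have h1 : Jf Φ lam a ≤ 0 := (Jf_mono h (by linarith) (hAC.2.1 ha)).trans ha2.2
    rw [(hη2 a ha).2.2.1 h1]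
    exact ⟨ha2.1, h1⟩
  · rintro _ ⟨a, ha, rfl⟩
    refine (hη2 a ha).2.2.2.trans (max_le ?_ le_rfl)
    have h1 := hJA a ha
    have h2 : κ * ((C + 2) * t / κ) = (C + 2) * t := by field_simp
    rw [h2]
    linarith

end nine
end BU

namespace BU

section ten
variable {X : Type*} [NormedAddCommGroup X] [NormedSpace ℝ X]
variable {Ψ : X → EReal} {Φ : X → ℝ}

theorem final_contra [CompleteSpace X] (h : Setup Ψ Φ) {ρ lam0 α : ℝ} (hρ : 0 < ρ) (hl0 : 0 < lam0)
    (hl1 : lam0 < 1) (hα0 : 0 < α)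
    (hα : ∀ lam, lam0 ≤ lam → ∀ y ∈ epi Ψ, ‖y.1‖ = ρ → α ≤ Jf Φ lam y)
    (hne : (SS Ψ Φ ρ 1).Nonempty) : False := by
  let f : ℝ → ℝ := fun lam => sInf (SS Ψ Φ ρ lam)
  have hne' : ∀ lam, lam ≤ 1 → (SS Ψ Φ ρ lam).Nonempty := fun lam hl => hne.mono (SS_mono h hl)
  have hbd : ∀ lam, lam0 ≤ lam → BddBelow (SS Ψ Φ ρ lam) := fun lam hl =>
    ⟨α, fun c hc => SS_lower hρ.le (hα lam hl) hc⟩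
  have hmono : MonotoneOn f (Icc lam0 1) := by
    intro x hx y hy hxy
    exact csInf_le_csInf (hbd x hx.1) (hne' y hy.2) (SS_mono h hxy)
  have hae := hmono.ae_differentiableWithinAt_of_mem
  obtain ⟨x, hx, hd⟩ : ∃ x ∈ Ioo lam0 1, DifferentiableWithinAt ℝ f (Icc lam0 1) x := by
    by_contra hcon
    push Not at hcon
    have h1 : MeasureTheory.volume (Ioo lam0 1) = 0 := by
      refine MeasureTheory.measure_mono_null (fun x hx => ?_) (MeasureTheory.ae_iff.1 hae)
      intro h2
      exact hcon x hx (h2 (Ioo_subset_Icc_self hx))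
    rw [Real.volume_Ioo, ENNReal.ofReal_eq_zero] at h1
    linarith
  have hd' : DifferentiableAt ℝ f x := hd.differentiableAt (Icc_mem_nhds hx.1 hx.2)
  have hd2 := hd'.hasDerivAt.isLittleO.def (c := 1) one_pos
  obtain ⟨e, he, hed⟩ := Metric.eventually_nhds_iff.1 hd2
  set d := deriv f x
  have hxl : 0 < x := hl0.trans hx.1
  have hbα : α ≤ f x := le_csInf (hne' x hx.2.le) fun c hc => SS_lower hρ.le (hα x hx.1.le) hc
  obtain ⟨m, hm, hmS⟩ := SS_gt (ρ := ρ) h hxl hρ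
  have hbm : - Φ 0 + m ≤ f x := le_csInf (hne' x hx.2.le) hmS
  obtain ⟨c, hc, hcS⟩ := step (ρ := ρ) (b := f x) (C := |d| + 1) (t0 := min e (1 - x)) h hxl
    (by linarith) (by intro h1; linarith) (by positivity) (lt_min he (by linarith [hx.2])) (by
      intro t ht htt
      have ht1 : t < e := htt.trans_le (min_le_left _ _)
      have ht2 : t < 1 - x := htt.trans_le (min_le_right _ _)
      have h1 := @hed (x + t) (by simpa [abs_of_pos ht] using ht1)
      simp only [add_sub_cancel_left, smul_eq_mul, one_mul, Real.norm_eq_abs, abs_of_pos ht] at h1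
      have h2 := (abs_le.1 h1).2
      have h3 : t * d ≤ t * |d| := mul_le_mul_of_nonneg_left (le_abs_self d) ht.le
      have h4 : f (x + t) < f x + (|d| + 1 + 1) * t := by nlinarith
      obtain ⟨c, hc, hclt⟩ := exists_lt_of_csInf_lt (hne' (x + t) (by linarith)) h4
      intro j
      obtain ⟨A, hA, hAc⟩ := hc j
      exact ⟨A, hA, fun a ha => (hAc a ha).trans hclt.le⟩)
  have := csInf_le (hbd x hx.1.le) hcS
  exact absurd hc (not_lt.2 this)

theorem cone_cont {E : Type*} [NormedAddCommGroup E] [NormedSpace ℝ E] (π : E → X)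
    (hπ : ContinuousOn π (sphere 0 1)) {B : ℝ} (hB : ∀ x ∈ sphere (0 : E) 1, ‖π x‖ ≤ B) :
    Continuous (fun x : E => ‖x‖ • π (‖x‖⁻¹ • x)) := by
  rw [continuous_iff_continuousAt]
  intro x
  by_cases hx : x = 0
  · subst hx
    have h1 : Tendsto (fun x : E => ‖x‖ * B) (𝓝 0) (𝓝 0) := by
      have : Continuous (fun x : E => ‖x‖ * B) := by fun_prop
      simpa using this.tendsto 0
    have h2 : Tendsto (fun x : E => ‖x‖ • π (‖x‖⁻¹ • x)) (𝓝 0) (𝓝 0) := by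
      refine squeeze_zero_norm (fun x => ?_) h1
      by_cases hx : x = 0
      · simp [hx]
      rw [norm_smul, norm_norm]
      refine mul_le_mul_of_nonneg_left (hB _ ?_) (norm_nonneg _)
      simp [norm_smul, hx]
    simpa [ContinuousAt] using h2
  · have hopen : IsOpen ({0}ᶜ : Set E) := isOpen_compl_singleton
    have h1 : ContinuousOn (fun x : E => ‖x‖⁻¹ • x) {0}ᶜ := by
      refine ContinuousOn.smul (ContinuousOn.inv₀ (by fun_prop) ?_) continuousOn_id
      intro y hy
      simpa using hy
    have h2 : ContinuousOn (fun x : E => π (‖x‖⁻¹ • x)) {0}ᶜ := by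
      refine hπ.comp h1 ?_
      intro y hy
      have : y ≠ 0 := hy
      simp [norm_smul, this]
    exact ((continuous_norm.continuousOn.smul h2).continuousAt (hopen.mem_nhds hx))

end ten
end BU

noncomputable section

variable {X : Type*} [NormedAddCommGroup X] [NormedSpace ℝ X]

/-- The functional `I_λ = λΨ − Φ`, with extended-real values. -/
def ILam (Ψ : X → EReal) (Φ : X → ℝ) (lam : ℝ) (u : X) : EReal :=
  (lam : EReal) * Ψ u - ((Φ u : ℝ) : EReal)

/-- `u` is a critical point of `I_λ = λΨ − Φ` in the sense of Szulkin. -/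
def IsCriticalPoint (Ψ : X → EReal) (Φ : X → ℝ) (lam : ℝ) (u : X) : Prop :=
  ∀ v : X, 0 ≤ (lam : EReal) * (Ψ v - Ψ u) - ((fderiv ℝ Φ u (v - u) : ℝ) : EReal)

/-- The class `Γ_k` of odd continuous maps on the closed unit disk `𝔻^k ⊂ ℝ^k`
coinciding with `π` on the boundary sphere `∂𝔻^k`. -/
def SMPClass (k : ℕ) (π : EuclideanSpace ℝ (Fin k) → X) :
    Set (EuclideanSpace ℝ (Fin k) → X) :=
  {γ | ContinuousOn γ (closedBall 0 1) ∧
    (∀ ζ ∈ closedBall (0 : EuclideanSpace ℝ (Fin k)) 1, γ (-ζ) = - γ ζ) ∧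
    (∀ ζ ∈ sphere (0 : EuclideanSpace ℝ (Fin k)) 1, γ ζ = π ζ)}

/-- The minimax value `c_k(λ) = inf_{γ ∈ Γ_k} sup_{ζ ∈ 𝔻^k} I_λ(γ(ζ))`,
expressed as the infimum of the set of real upper bounds of `I_λ ∘ γ` over `γ ∈ Γ_k`. -/
def smpValue (Ψ : X → EReal) (Φ : X → ℝ) (k : ℕ)
    (π : EuclideanSpace ℝ (Fin k) → X) (lam : ℝ) : ℝ :=
  sInf {x : ℝ | ∃ γ ∈ SMPClass k π,
    ∀ ζ ∈ closedBall (0 : EuclideanSpace ℝ (Fin k)) 1, ILam Ψ Φ lam (γ ζ) ≤ (x : EReal)}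

theorem ILam_real {Ψ : X → EReal} {Φ : X → ℝ} (h : BU.Setup Ψ Φ) {lam x : ℝ} (hlam : 0 < lam)
    {u : X} (hu : ILam Ψ Φ lam u ≤ (x : EReal)) :
    ∃ P : ℝ, 0 ≤ P ∧ Ψ u = (P : EReal) ∧ lam * P - Φ u ≤ x := by
  have hnt : Ψ u ≠ ⊤ := by
    intro ht
    rw [ILam, ht, EReal.coe_mul_top_of_pos hlam, EReal.top_sub_coe, top_le_iff] at hu
    exact EReal.coe_ne_top _ hu
  have hP := BU.coe_toReal h hnt
  refine ⟨(Ψ u).toReal, EReal.toReal_nonneg (h.nn u), hP.symm, ?_⟩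
  rw [ILam, ← hP] at hu
  exact_mod_cast hu

theorem ILam_coe {Ψ : X → EReal} {Φ : X → ℝ} {lam P : ℝ} {u : X} (hu : Ψ u = (P : EReal)) :
    ILam Ψ Φ lam u = ((lam * P - Φ u : ℝ) : EReal) := by
  rw [ILam, hu]
  push_cast
  rfl

theorem smp_nonempty {Ψ : X → EReal} {Φ : X → ℝ} (h : BU.Setup Ψ Φ) {k : ℕ}
    (π : EuclideanSpace ℝ (Fin k) → X)
    (hπcont : ContinuousOn π (sphere (0 : EuclideanSpace ℝ (Fin k)) 1))
    (hπodd : ∀ ζ ∈ sphere (0 : EuclideanSpace ℝ (Fin k)) 1, π (-ζ) = - π ζ)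
    (hπ : ∀ ζ ∈ sphere (0 : EuclideanSpace ℝ (Fin k)) 1,
      ∃ P : ℝ, 0 ≤ P ∧ Ψ (π ζ) = (P : EReal) ∧ P ≤ Φ (π ζ)) :
    {x : ℝ | ∃ γ ∈ SMPClass k π,
      ∀ ζ ∈ closedBall (0 : EuclideanSpace ℝ (Fin k)) 1,
        ILam Ψ Φ 1 (γ ζ) ≤ (x : EReal)}.Nonempty := by
  have hΦc : Continuous Φ := h.c1.continuous
  have hsc : IsCompact (sphere (0 : EuclideanSpace ℝ (Fin k)) 1) := isCompact_sphere _ _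
  have hbc : IsCompact (closedBall (0 : EuclideanSpace ℝ (Fin k)) 1) := isCompact_closedBall _ _
  obtain ⟨B, hB⟩ := hsc.exists_bound_of_continuousOn hπcont
  obtain ⟨B1, hB1⟩ := hsc.exists_bound_of_continuousOn (hΦc.comp_continuousOn hπcont)
  let γ : EuclideanSpace ℝ (Fin k) → X := fun x => ‖x‖ • π (‖x‖⁻¹ • x)
  have hγ : Continuous γ := BU.cone_cont π hπcont hB
  obtain ⟨B2, hB2⟩ := hbc.exists_bound_of_continuousOn (hΦc.comp hγ).continuousOn
  refine ⟨max B1 0 + B2, γ, ⟨hγ.continuousOn, ?_, ?_⟩, ?_⟩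
  · intro ζ _
    by_cases h0 : ζ = 0
    · simp [γ, h0]
    · have := hπodd (‖ζ‖⁻¹ • ζ) (by simp [norm_smul, h0])
      simp only [γ, norm_neg, smul_neg]
      rw [this, smul_neg]
  · intro ζ hζ
    have : ‖ζ‖ = 1 := by simpa using hζ
    simp [γ, this]
  · intro ζ hζ
    have h1 : ‖ζ‖ ≤ 1 := by simpa using hζ
    have h2 := hB2 ζ hζ
    have h3 : Ψ (γ ζ) ≤ ((max B1 0 : ℝ) : EReal) := by
      by_cases h0 : ζ = 0
      · have : γ ζ = 0 := by simp [γ, h0]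
        rw [this, h.zero]
        exact_mod_cast le_max_right B1 0
      · have hs : ‖ζ‖⁻¹ • ζ ∈ sphere (0 : EuclideanSpace ℝ (Fin k)) 1 := by simp [norm_smul, h0]
        obtain ⟨P, hP0, hP, hPΦ⟩ := hπ _ hs
        have h4 := h.conv (π (‖ζ‖⁻¹ • ζ)) 0 ‖ζ‖ (1 - ‖ζ‖) (norm_nonneg _) (by linarith) (by ring)
        rw [hP, h.zero, smul_zero, add_zero, mul_zero, add_zero, ← EReal.coe_mul] at h4
        refine h4.trans (EReal.coe_le_coe_iff.2 (le_max_of_le_left ?_))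
        have h5 := hB1 _ hs
        have h6 := (abs_le.1 h5).2
        simp only [Function.comp_apply] at h6
        nlinarith [norm_nonneg ζ]
    have hnt : Ψ (γ ζ) ≠ ⊤ := fun ht => by
      rw [ht, top_le_iff] at h3
      exact EReal.coe_ne_top _ h3
    have hP := BU.coe_toReal h hnt
    rw [ILam_coe hP.symm]
    rw [← hP] at h3
    have h3' := EReal.coe_le_coe_iff.1 h3
    refine EReal.coe_le_coe_iff.2 ?_
    have h6 := (abs_le.1 h2).1
    simp only [Function.comp_apply] at h6
    linarith

theorem minimax_values_diverge
    [CompleteSpace X]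
    (Ψ : X → EReal) (Φ : X → ℝ)
    -- (Ψ1)
    (hΨ0 : Ψ 0 = 0)
    (hΨnn : ∀ u : X, 0 ≤ Ψ u)
    (hΨlsc : LowerSemicontinuous Ψ)
    (hΨconv : ∀ u v : X, ∀ a b : ℝ, 0 ≤ a → 0 ≤ b → a + b = 1 →
      Ψ (a • u + b • v) ≤ (a : EReal) * Ψ u + (b : EReal) * Ψ v)
    -- (Ψ2)
    (hΨcoer : ∀ C : ℝ, ∃ R : ℝ, ∀ u : X, R ≤ ‖u‖ → (C : EReal) ≤ Ψ u)
    -- (Ψ3)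
    (hΨ3 : ∀ (u : ℕ → X) (w : X), (∀ j, Ψ (u j) ≠ ⊤) → Ψ w ≠ ⊤ →
      (∀ f : X →L[ℝ] ℝ, Tendsto (fun j => f (u j)) atTop (𝓝 (f w))) →
      Tendsto (fun j => Ψ (u j)) atTop (𝓝 (Ψ w)) →
      Tendsto (fun j => ‖u j - w‖) atTop (𝓝 0))
    -- (Φ1)
    (hΦ : ContDiff ℝ 1 Φ)
    -- (Φ2)
    (hΦ2 : ∀ u : ℕ → X, IsBounded (range u) →
      ∃ (φ : ℕ → ℕ) (w : X), StrictMono φ ∧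
        (∀ f : X →L[ℝ] ℝ, Tendsto (fun j => f (u (φ j))) atTop (𝓝 (f w))) ∧
        ∀ v : X, ((fderiv ℝ Φ w (v - w) : ℝ) : EReal) ≤
          Filter.liminf
            (fun j => ((fderiv ℝ Φ (u (φ j)) (v - u (φ j)) : ℝ) : EReal)) atTop)
    -- (IB)
    (hIB : ∀ a b c : ℝ, 0 < a → a ≤ b →
      IsBounded {u : X | ∃ lam ∈ Icc a b,
        IsCriticalPoint Ψ Φ lam u ∧ ILam Ψ Φ lam u ≤ (c : EReal)})
    -- (E): evenness
    (hΨeven : ∀ u : X, Ψ (-u) = Ψ u)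
    (hΦeven : ∀ u : X, Φ (-u) = Φ u)
    -- (SMP)
    (ρ₀ α₀ ε : ℝ) (π : (k : ℕ) → EuclideanSpace ℝ (Fin k) → X)
    (hρ₀ : 0 < ρ₀) (hα₀ : 0 < α₀) (hε : 0 < ε)
    (hinf : (⨅ u ∈ {u : X | ‖u‖ = ρ₀}, ILam Ψ Φ (1 - ε) u) = (α₀ : EReal))
    (hπcont : ∀ k : ℕ, 1 ≤ k →
      ContinuousOn (π k) (sphere (0 : EuclideanSpace ℝ (Fin k)) 1))
    (hπodd : ∀ k : ℕ, 1 ≤ k →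
      ∀ ζ ∈ sphere (0 : EuclideanSpace ℝ (Fin k)) 1, π k (-ζ) = - π k ζ)
    (hπnorm : ∀ k : ℕ, 1 ≤ k →
      ∀ ζ ∈ sphere (0 : EuclideanSpace ℝ (Fin k)) 1, ρ₀ < ‖π k ζ‖)
    (hπneg : ∀ k : ℕ, 1 ≤ k → ∃ β : ℝ, β < 0 ∧
      ∀ ζ ∈ sphere (0 : EuclideanSpace ℝ (Fin k)) 1,
        ILam Ψ Φ (1 + ε) (π k ζ) ≤ (β : EReal)) :
    Tendsto (fun k : ℕ => smpValue Ψ Φ k (π k) 1) atTop atTop := by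
  have h : BU.Setup Ψ Φ :=
    ⟨hΨ0, hΨnn, hΨlsc, hΨconv, hΨcoer, hΨ3, hΦ, hΦ2, hΨeven, hΦeven⟩
  rw [Filter.tendsto_atTop]
  by_contra hcon
  obtain ⟨M, hM⟩ := not_forall.1 hcon
  rw [not_eventually] at hM
  have hsph : ∀ k : ℕ, 1 ≤ k → ∀ ζ ∈ sphere (0 : EuclideanSpace ℝ (Fin k)) 1,
      ∃ P : ℝ, 0 ≤ P ∧ Ψ (π k ζ) = (P : EReal) ∧ P ≤ Φ (π k ζ) := by
    intro k hk ζ hζ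
    obtain ⟨β, hβ, hβ2⟩ := hπneg k hk
    obtain ⟨P, hP0, hP, hP2⟩ := ILam_real h (by linarith) (hβ2 ζ hζ)
    exact ⟨P, hP0, hP, by nlinarith⟩
  refine BU.final_contra (ρ := ρ₀) (lam0 := max (1 - ε) (1 / 2)) (α := α₀) h hρ₀
    (lt_max_of_lt_right (by norm_num)) (max_lt (by linarith) (by norm_num)) hα₀ ?_ ?_
  · intro lam hlam y hy hyρ
    have h1 : (α₀ : EReal) ≤ ILam Ψ Φ (1 - ε) y.1 := by
      rw [← hinf]
      exact iInf₂_le y.1 hyρ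
    have hP := BU.coe_toReal h (BU.epi_ne_top hy)
    have hP0 := EReal.toReal_nonneg (h.nn y.1)
    rw [ILam_coe hP.symm] at h1
    have h2 := EReal.coe_le_coe_iff.1 h1
    have h3 : Ψ y.1 ≤ (y.2 : EReal) := hy
    rw [← hP] at h3
    have h4 := EReal.coe_le_coe_iff.1 h3
    have h5 : 1 - ε ≤ lam := (le_max_left _ _).trans hlam
    have h6 : (1 : ℝ) / 2 ≤ lam := (le_max_right _ _).trans hlam
    have h7 := mul_le_mul_of_nonneg_right h5 hP0
    have h8 : lam * (Ψ y.1).toReal ≤ lam * y.2 := mul_le_mul_of_nonneg_left h4 (by linarith)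
    unfold BU.Jf
    linarith
  · refine ⟨max M 0, fun j => ?_⟩
    obtain ⟨k, hjk, hk⟩ := (frequently_atTop.1 hM) (j + 1)
    have hk1 : 1 ≤ k := by omega
    have hkM : smpValue Ψ Φ k (π k) 1 < M := not_le.1 hk
    obtain ⟨x, ⟨γ, ⟨hγc, hγo, hγb⟩, hγx⟩, hxM⟩ := exists_lt_of_csInf_lt
      (smp_nonempty h (π k) (hπcont k hk1) (hπodd k hk1) (hsph k hk1)) hkM
    refine BU.start_ac h (le_max_right M 0) (Nat.lt_of_succ_le hjk) γ hγc hγo ?_ ?_ ?_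
    · intro ζ hζ
      have hs : ζ ∈ sphere (0 : EuclideanSpace ℝ (Fin k)) 1 := by simpa using hζ
      rw [hγb ζ hs]
      exact (hπnorm k hk1 ζ hs).le
    · intro ζ hζ
      have hs : ζ ∈ sphere (0 : EuclideanSpace ℝ (Fin k)) 1 := by simpa using hζ
      rw [hγb ζ hs]
      obtain ⟨P, hP0, hP, hP2⟩ := hsph k hk1 ζ hs
      rw [hP]
      exact EReal.coe_le_coe_iff.2 hP2
    · intro ζ hζ
      obtain ⟨P, hP0, hP, hP2⟩ := ILam_real h one_pos (hγx ζ (by simpa using hζ))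
      rw [hP]
      refine EReal.coe_le_coe_iff.2 ?_
      have := le_max_left M 0
      linarith

end
end

section
/- (Symmetric Deformation Lemma.) Assume (Ψ1), (Φ1) and the evenness condition (E). Fix λ > 0, let A ⊂ X be bounded, closed and symmetric (A = −A), and for c ∈ ℝ, σ > 0 set 𝒜 := A ∩ {c − 3σ ≤ I_λ ≤ c + 3σ}. Suppose there exists δ₀ > 0 such that for each u ∈ 𝒜 there is v = v(u) ∈ X \ {u} with λ(Ψ(v) − Ψ(u)) − Φ'(u)(v − u) < −5δ₀‖v − u‖. Then for every relatively compact symmetric set K ⊂ 𝒜 there exist symmetric open sets W, W̃ with cl(K) ⊂ W ⊂ cl(W) ⊂ W̃, a number s₀ > 0 and a continuous map η : [0,∞) × X → X such that: (i) ‖η(s,w) − w‖ ≤ s and η(s,−w) = −η(s,w) for all (s,w) ∈ [0,∞) × X, and η(s,w) = w for all s ≥ 0 whenever w ∉ W̃; (ii) I_λ(η(s,w)) ≤ I_λ(w) + δ₀ s for all (s,w) ∈ [0,s₀] × X; (iii) I_λ(η(s,w)) ≤ I_λ(w) − 2δ₀ s for all (s,w) ∈ [0,s₀] × W with I_λ(w)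 ≥ c − σ. -/
open Set Filter Metric Bornology Topology

noncomputable section

variable {X : Type*} [NormedAddCommGroup X] [NormedSpace ℝ X]

theorem sdl_local {X : Type*} [NormedAddCommGroup X] [NormedSpace ℝ X]
    (D : Set X) (ψ Φ : X → ℝ) (hΦ : ContDiff ℝ 1 Φ)
    (hlsc : ∀ u ∈ D, ∀ ε > 0, ∀ᶠ w in 𝓝 u, w ∈ D → ψ u - ε < ψ w)
    (c σ δ : ℝ) (hσ : 0 < σ) (hδ : 0 < δ) (u : X) (hu : u ∈ D)
    (hdesc : c - 3 * σ ≤ ψ u - Φ u → ∃ v ∈ D, v ≠ u ∧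
      ψ v - ψ u - fderiv ℝ Φ u (v - u) < -(5 * δ * ‖v - u‖)) :
    ∃ v ∈ D, ∃ τ > 0, ∀ᶠ w in 𝓝 u, τ * ‖v - w‖ ≤ 1 ∧
      (w ∈ D → τ * (ψ v - ψ w - fderiv ℝ Φ w (v - w)) ≤ δ / 2 ∧
        (c - σ ≤ ψ w - Φ w → τ * (ψ v - ψ w - fderiv ℝ Φ w (v - w)) ≤ - (3 * δ))) := by
  have hfc : Continuous (fderiv ℝ Φ) := hΦ.continuous_fderiv (by norm_num)
  have hf : ∀ v : X, Continuous fun w => fderiv ℝ Φ w (v - w) := fun v =>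
    hfc.clm_apply (continuous_const.sub continuous_id)
  have hn : ∀ v : X, Continuous fun w => ‖v - w‖ := fun v => by fun_prop
  by_cases h : c - 3 * σ ≤ ψ u - Φ u
  · obtain ⟨v, hv, hne, hlt⟩ := hdesc h
    have hd : 0 < ‖v - u‖ := norm_pos_iff.2 (sub_ne_zero.2 hne)
    set d := ‖v - u‖ with hdd
    set ε := (-(5 * δ * d) - (ψ v - ψ u - fderiv ℝ Φ u (v - u))) / 2 with hε
    have hεp : 0 < ε := by rw [hε]; linarith
    refine ⟨v, hv, 4 / (5 * d), by positivity, ?_⟩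
    have e1 := hlsc u hu ε hεp
    have e2 : ∀ᶠ w in 𝓝 u, fderiv ℝ Φ u (v - u) - ε < fderiv ℝ Φ w (v - w) :=
      (hf v).continuousAt.eventually (lt_mem_nhds (by simpa using hεp))
    have e3 : ∀ᶠ w in 𝓝 u, ‖v - w‖ < 5 / 4 * d :=
      (hn v).continuousAt.eventually (gt_mem_nhds (by change d < _; linarith))
    filter_upwards [e1, e2, e3] with w h1 h2 h3
    have hτ : 0 < 4 / (5 * d) := by positivity
    refine ⟨?_, fun hw => ?_⟩
    · calc 4 / (5 * d) * ‖v - w‖ ≤ 4 / (5 * d) * (5 / 4 * d) := by gcongr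
        _ = 1 := by field_simp
    · have h4 : ψ v - ψ w - fderiv ℝ Φ w (v - w) ≤ -(5 * δ * d) := by
        have := h1 hw
        linarith
      have h5 : 4 / (5 * d) * (ψ v - ψ w - fderiv ℝ Φ w (v - w)) ≤ - (4 * δ) := by
        calc _ ≤ 4 / (5 * d) * (-(5 * δ * d)) := by gcongr
          _ = _ := by field_simp
      exact ⟨by linarith, fun _ => by linarith⟩
  · push Not at h
    have hτ : 0 < 3 * δ / σ := by positivity
    refine ⟨u, hu, 3 * δ / σ, hτ, ?_⟩
    have e1 := hlsc u hu (σ / 12) (by positivity)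
    have e2 : ∀ᶠ w in 𝓝 u, - (σ / 12) < fderiv ℝ Φ w (u - w) :=
      (hf u).continuousAt.eventually (lt_mem_nhds (by simpa using hσ))
    have e3 : ∀ᶠ w in 𝓝 u, ‖u - w‖ < 1 / (3 * δ / σ) :=
      (hn u).continuousAt.eventually (gt_mem_nhds (by simp only [sub_self, norm_zero]; positivity))
    have e4 : ∀ᶠ w in 𝓝 u, Φ u - σ / 12 < Φ w :=
      hΦ.continuous.continuousAt.eventually (lt_mem_nhds (by linarith))
    filter_upwards [e1, e2, e3, e4] with w h1 h2 h3 h4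
    refine ⟨?_, fun hw => ⟨?_, fun hc => ?_⟩⟩
    · calc 3 * δ / σ * ‖u - w‖ ≤ 3 * δ / σ * (1 / (3 * δ / σ)) := by gcongr
        _ = 1 := by field_simp
    · have := h1 hw
      calc _ ≤ 3 * δ / σ * (σ / 6) := by gcongr; linarith
        _ = _ := by field_simp; norm_num
    · have := h1 hw
      calc _ ≤ 3 * δ / σ * (-σ) := by gcongr; linarith
        _ = _ := by field_simp

theorem sdl_phi {X : Type*} [NormedAddCommGroup X] [NormedSpace ℝ X]
    (Φ : X → ℝ) (hΦ : ContDiff ℝ 1 Φ) (δ : ℝ) (hδ : 0 < δ) (u : X) :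
    ∃ r > 0, ∀ w ∈ ball u r, ∀ s ∈ Icc 0 r, ∀ V : X, ‖V‖ ≤ 1 →
      Φ w + s * fderiv ℝ Φ w V - s * (δ / 2) ≤ Φ (w + s • V) := by
  have hfc : Continuous (fderiv ℝ Φ) := hΦ.continuous_fderiv (by norm_num)
  obtain ⟨R, hR, hb⟩ := Metric.continuousAt_iff.1 (hfc.continuousAt (x := u)) (δ / 4) (by positivity)
  refine ⟨R / 2, by positivity, fun w hw s hs V hV => ?_⟩
  have hw' : dist w u < R := by have := mem_ball.1 hw; linarith
  have hsV : ‖s • V‖ ≤ s := by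
    rw [norm_smul, Real.norm_of_nonneg hs.1]
    exact mul_le_of_le_one_right hs.1 hV
  have hz : dist (w + s • V) u < R := by
    have h1 : dist (w + s • V) w = ‖s • V‖ := by simp [dist_eq_norm]
    have := dist_triangle (w + s • V) w u
    have h2 := mem_ball.1 hw
    have h3 := hs.2
    linarith
  have key := (convex_ball u R).norm_image_sub_le_of_norm_hasFDerivWithin_le' (f := Φ)
    (f' := fderiv ℝ Φ) (φ := fderiv ℝ Φ w) (C := δ / 2)
    (fun x _ => ((hΦ.differentiable (by norm_num)) x).hasFDerivAt.hasFDerivWithinAt)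
    (fun x hx => by
      have h1 := hb (mem_ball.1 hx)
      have h2 := hb hw'
      rw [← dist_eq_norm]
      have := dist_triangle_right (fderiv ℝ Φ x) (fderiv ℝ Φ w) (fderiv ℝ Φ u)
      linarith)
    (mem_ball.2 hw') (mem_ball.2 hz)
  simp only [add_sub_cancel_left, map_smul, smul_eq_mul] at key
  have h1 := (abs_le.1 ((Real.norm_eq_abs _) ▸ key)).1
  have h2 : δ / 2 * ‖s • V‖ ≤ s * (δ / 2) := by nlinarith
  linarith

/-- admissible directions at `w` -/
def sdlSet {X : Type*} [NormedAddCommGroup X] [NormedSpace ℝ X]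
    (D : Set X) (ψ Φ : X → ℝ) (W W' : Set X) (c σ δ s₀ : ℝ) (w : X) : Set X :=
  {V | ‖V‖ ≤ 1 ∧ (w ∉ W' → V = 0) ∧ (w ∈ D → ∀ s ∈ Icc 0 s₀, w + s • V ∈ D ∧
      ψ (w + s • V) ≤ ψ w + s * (fderiv ℝ Φ w V + δ / 2) ∧
      (w ∈ W → c - σ ≤ ψ w - Φ w → ψ (w + s • V) ≤ ψ w + s * (fderiv ℝ Φ w V - 3 * δ)))}

theorem sdlSet_convex {X : Type*} [NormedAddCommGroup X] [NormedSpace ℝ X]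
    (D : Set X) (ψ Φ : X → ℝ) (hψ : ConvexOn ℝ D ψ) (W W' : Set X) (c σ δ s₀ : ℝ) (w : X) :
    Convex ℝ (sdlSet D ψ Φ W W' c σ δ s₀ w) := by
  rintro V ⟨hV1, hV2, hV3⟩ U ⟨hU1, hU2, hU3⟩ a b ha hb hab
  have hb' : b = 1 - a := by linarith
  refine ⟨?_, fun h => by simp [hV2 h, hU2 h], fun hw s hs => ?_⟩
  · calc ‖a • V + b • U‖ ≤ ‖a • V‖ + ‖b • U‖ := norm_add_le _ _
      _ = a * ‖V‖ + b * ‖U‖ := by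
        rw [norm_smul, norm_smul, Real.norm_of_nonneg ha, Real.norm_of_nonneg hb]
      _ ≤ a * 1 + b * 1 := by gcongr
      _ = 1 := by linarith
  · obtain ⟨v1, v2, v3⟩ := hV3 hw s hs
    obtain ⟨u1, u2, u3⟩ := hU3 hw s hs
    have e : w + s • (a • V + b • U) = a • (w + s • V) + b • (w + s • U) := by
      subst hb'; module
    have h1 := hψ.2 v1 u1 ha hb hab
    rw [e]
    simp only [smul_eq_mul] at h1
    refine ⟨hψ.1 v1 u1 ha hb hab, h1.trans ?_, fun hW hc => h1.trans ?_⟩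
    · calc _ ≤ a * (ψ w + s * (fderiv ℝ Φ w V + δ / 2)) +
            b * (ψ w + s * (fderiv ℝ Φ w U + δ / 2)) := by gcongr
        _ = _ := by simp only [map_add, map_smul, smul_eq_mul]; subst hb'; ring
    · have v3 := v3 hW hc
      have u3 := u3 hW hc
      calc _ ≤ a * (ψ w + s * (fderiv ℝ Φ w V - 3 * δ)) +
            b * (ψ w + s * (fderiv ℝ Φ w U - 3 * δ)) := by gcongr
        _ = _ := by simp only [map_add, map_smul, smul_eq_mul]; subst hb'; ring

theorem sdl_real {X : Type*} [NormedAddCommGroup X] [NormedSpace ℝ X]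
    (D : Set X) (ψ Φ : X → ℝ) (hΦ : ContDiff ℝ 1 Φ) (hψ : ConvexOn ℝ D ψ)
    (hlsc : ∀ u ∈ D, ∀ ε > 0, ∀ᶠ w in 𝓝 u, w ∈ D → ψ u - ε < ψ w)
    (hDe : ∀ u, -u ∈ D ↔ u ∈ D) (hψe : ∀ u, ψ (-u) = ψ u) (hΦe : ∀ u, Φ (-u) = Φ u)
    (c σ δ : ℝ) (hσ : 0 < σ) (hδ : 0 < δ) (Q : Set X) (hQ : IsCompact Q) (hQs : -Q = Q)
    (hQD : Q ⊆ D)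
    (hdesc : ∀ u ∈ Q, c - 3 * σ ≤ ψ u - Φ u → ∃ v ∈ D, v ≠ u ∧
      ψ v - ψ u - fderiv ℝ Φ u (v - u) < -(5 * δ * ‖v - u‖)) :
    ∃ (W W' : Set X), IsOpen W ∧ IsOpen W' ∧ -W = W ∧ -W' = W' ∧
      Q ⊆ W ∧ closure W ⊆ W' ∧
      ∃ s₀ : ℝ, 0 < s₀ ∧ ∃ η : ℝ → X → X,
        Continuous (fun p : ℝ × X => η p.1 p.2) ∧
        (∀ s ∈ Ici (0 : ℝ), ∀ w : X, ‖η s w - w‖ ≤ s) ∧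
        (∀ s ∈ Ici (0 : ℝ), ∀ w : X, η s (-w) = - η s w) ∧
        (∀ s ∈ Ici (0 : ℝ), ∀ w : X, w ∉ W' → η s w = w) ∧
        (∀ s ∈ Icc 0 s₀, ∀ w ∈ D, η s w ∈ D ∧
          ψ (η s w) - Φ (η s w) ≤ ψ w - Φ w + δ * s ∧
          (w ∈ W → c - σ ≤ ψ w - Φ w →
            ψ (η s w) - Φ (η s w) ≤ ψ w - Φ w - 2 * δ * s)) := by
  have loc : ∀ u ∈ Q, ∃ v ∈ D, ∃ τ > 0, ∃ r > 0, r * τ ≤ 1 ∧ ∀ w ∈ ball u r,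
      (τ * ‖v - w‖ ≤ 1 ∧
      (w ∈ D → τ * (ψ v - ψ w - fderiv ℝ Φ w (v - w)) ≤ δ / 2 ∧
        (c - σ ≤ ψ w - Φ w → τ * (ψ v - ψ w - fderiv ℝ Φ w (v - w)) ≤ - (3 * δ)))) ∧
      ∀ s ∈ Icc 0 r, ∀ V : X, ‖V‖ ≤ 1 →
      Φ w + s * fderiv ℝ Φ w V - s * (δ / 2) ≤ Φ (w + s • V) := by
    intro u hu
    obtain ⟨v, hv, τ, hτ, h⟩ := sdl_local D ψ Φ hΦ hlsc c σ δ hσ hδ u (hQD hu) (hdesc u hu)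
    obtain ⟨r1, hr1, h1⟩ := Metric.eventually_nhds_iff_ball.1 h
    obtain ⟨r2, hr2, h2⟩ := sdl_phi Φ hΦ δ hδ u
    refine ⟨v, hv, τ, hτ, min (min r1 r2) (1 / τ), by positivity, ?_, fun w hw => ⟨?_, ?_⟩⟩
    · calc _ ≤ 1 / τ * τ := by gcongr; exact min_le_right _ _
        _ = 1 := by field_simp
    · exact h1 w (ball_subset_ball ((min_le_left _ _).trans (min_le_left _ _)) hw)
    · intro s hs
      have hle : min (min r1 r2) (1 / τ) ≤ r2 := (min_le_left _ _).trans (min_le_right _ _)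
      exact h2 w (ball_subset_ball hle hw) s ⟨hs.1, hs.2.trans hle⟩
  choose! v hvD τ hτ r hr hrτ hloc using loc
  obtain ⟨F, hFQ, hFcov⟩ := hQ.elim_nhds_subcover (fun u => ball u (r u))
    (fun u hu => ball_mem_nhds u (hr u hu))
  obtain ⟨s₀, hs₀, hs₀F⟩ : ∃ s₀ : ℝ, 0 < s₀ ∧ ∀ i ∈ F, s₀ ≤ r i := by
    rcases F.eq_empty_or_nonempty with h | h
    · exact ⟨1, one_pos, by simp [h]⟩
    · obtain ⟨i, hi, hmin⟩ := F.exists_min_image r h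
      exact ⟨r i, hr i (hFQ i hi), hmin⟩
  set O : Set X := ⋃ u ∈ F, ball u (r u) with hO
  have hOo : IsOpen O := isOpen_biUnion fun _ _ => isOpen_ball
  set W' : Set X := O ∩ -O with hW'
  have hW'o : IsOpen W' := hOo.inter hOo.neg
  have hW's : -W' = W' := by rw [hW', Set.inter_neg, neg_neg, inter_comm]
  have hQW' : Q ⊆ W' := subset_inter hFcov (by rw [← hQs]; exact Set.neg_subset_neg.2 hFcov)
  obtain ⟨W₀, hW₀o, hQW₀, hW₀W'⟩ := normal_exists_closure_subset hQ.isClosed hW'o hQW'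
  set W : Set X := W₀ ∩ -W₀ with hW
  have hWo : IsOpen W := hW₀o.inter hW₀o.neg
  have hWs : -W = W := by rw [hW, Set.inter_neg, neg_neg, inter_comm]
  have hQW : Q ⊆ W := subset_inter hQW₀ (by rw [← hQs]; exact Set.neg_subset_neg.2 hQW₀)
  have hWW' : closure W ⊆ W' := (closure_mono inter_subset_left).trans hW₀W'
  have hmW : ∀ w, -w ∈ W ↔ w ∈ W := fun w => by rw [← Set.mem_neg, hWs]
  have hmW' : ∀ w, -w ∈ W' ↔ w ∈ W' := fun w => by rw [← Set.mem_neg, hW's]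
  have hfd : ∀ w, fderiv ℝ Φ (-w) = - fderiv ℝ Φ w := by
    intro w
    have h1 : (Φ ∘ fun x => -x) = Φ := funext hΦe
    have h2 := ((hΦ.differentiable (by norm_num)) (-w)).hasFDerivAt.comp w (hasFDerivAt_id w).neg
    have h3 : HasFDerivAt Φ _ w := h1 ▸ h2
    rw [h3.fderiv]
    ext x
    simp
  set t := sdlSet D ψ Φ W W' c σ δ s₀ with ht
  have hconv : ∀ w, Convex ℝ (t w) := fun w => sdlSet_convex D ψ Φ hψ W W' c σ δ s₀ w
  have hneg : ∀ w V, V ∈ t (-w) → -V ∈ t w := by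
    rintro w V ⟨h1, h2, h3⟩
    refine ⟨by rwa [norm_neg], fun h => by rw [h2 (by rwa [hmW']), neg_zero], fun hw s hs => ?_⟩
    obtain ⟨a1, a2, a3⟩ := h3 ((hDe w).2 hw) s hs
    have e : w + s • -V = -(-w + s • V) := by module
    rw [e, hDe, hψe]
    rw [hψe, hfd] at a2
    rw [hψe, hΦe, hmW, hfd] at a3
    simp only [map_neg]
    exact ⟨a1, a2, a3⟩
  obtain ⟨g, hg⟩ := exists_continuous_forall_mem_convex_of_local hconv (by
    intro x
    by_cases hx : x ∈ W'
    · obtain ⟨u, huF, hxu⟩ := mem_iUnion₂.1 hx.1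
      have huQ := hFQ u huF
      refine ⟨ball u (r u) ∩ W', inter_mem (isOpen_ball.mem_nhds hxu) (hW'o.mem_nhds hx),
        fun w => τ u • (v u - w), by fun_prop, ?_⟩
      rintro w ⟨hwu, hwW'⟩
      obtain ⟨⟨b1, b2⟩, -⟩ := hloc u huQ w hwu
      have hτu := hτ u huQ
      refine ⟨by rwa [norm_smul, Real.norm_of_nonneg hτu.le], fun h => absurd hwW' h,
        fun hw s hs => ?_⟩
      obtain ⟨b2, b3⟩ := b2 hw
      have hst : s * τ u ≤ 1 := by
        have := hrτ u huQ
        have h2 : s * τ u ≤ r u * τ u := by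
          gcongr
          exact hs.2.trans (hs₀F u huF)
        linarith
      have hst0 : 0 ≤ s * τ u := mul_nonneg hs.1 hτu.le
      have e : w + s • τ u • (v u - w) = (1 - s * τ u) • w + (s * τ u) • v u := by module
      have c1 := hψ.1 hw (hvD u huQ) (sub_nonneg.2 hst) hst0 (by ring)
      have c2 := hψ.2 hw (hvD u huQ) (sub_nonneg.2 hst) hst0 (by ring)
      simp only [smul_eq_mul] at c2
      rw [e]
      simp only [map_smul, smul_eq_mul]
      refine ⟨c1, c2.trans ?_, fun _ hc => c2.trans ?_⟩
      · have := mul_le_mul_of_nonneg_left b2 hs.1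
        linarith
      · have := mul_le_mul_of_nonneg_left (b3 hc) hs.1
        linarith
    · refine ⟨(closure W)ᶜ, isClosed_closure.isOpen_compl.mem_nhds (fun h => hx (hWW' h)),
        fun _ => 0, continuousOn_const, fun w hw => ⟨by simp, fun _ => rfl, fun hwD s hs => ?_⟩⟩
      refine ⟨by simpa using hwD, ?_, fun h => absurd (subset_closure h) hw⟩
      simp only [smul_zero, add_zero, map_zero, zero_add]
      have := mul_nonneg hs.1 hδ.le
      linarith)
  set V : X → X := fun w => (1 / 2 : ℝ) • g w + (1 / 2 : ℝ) • (- g (-w)) with hVdef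
  have hVc : Continuous V := by
    have := g.continuous
    fun_prop
  have hVt : ∀ w, V w ∈ t w := fun w =>
    hconv w (hg w) (hneg w _ (hg (-w))) (by norm_num) (by norm_num) (by norm_num)
  have hVodd : ∀ w, V (-w) = - V w := fun w => by
    simp only [hVdef, neg_neg]; module
  refine ⟨W, W', hWo, hW'o, hWs, hW's, hQW, hWW', s₀, hs₀, fun s w => w + min s s₀ • V w,
    by fun_prop, fun s hs w => ?_, fun s hs w => ?_, fun s hs w hw => ?_, fun s hs w hw => ?_⟩
  · have h0 : 0 ≤ min s s₀ := le_min hs hs₀.le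
    rw [add_sub_cancel_left, norm_smul, Real.norm_of_nonneg h0]
    calc _ ≤ min s s₀ * 1 := by gcongr; exact (hVt w).1
      _ ≤ s := by rw [mul_one]; exact min_le_left _ _
  · simp only [hVodd]; module
  · simp only [(hVt w).2.1 hw, smul_zero, add_zero]
  · obtain ⟨hV1, hV2, hV3⟩ := hVt w
    simp only [min_eq_left hs.2]
    obtain ⟨a1, a2, a3⟩ := hV3 hw s hs
    have hs0 := hs.1
    by_cases hwW' : w ∈ W'
    · obtain ⟨u, huF, hxu⟩ := mem_iUnion₂.1 hwW'.1
      have p := (hloc u (hFQ u huF) w hxu).2 s ⟨hs.1, hs.2.trans (hs₀F u huF)⟩ (V w) hV1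
      refine ⟨a1, by linarith, fun h1 h2 => ?_⟩
      have := a3 h1 h2
      have := mul_nonneg hs.1 hδ.le
      linarith
    · have hz := hV2 hwW'
      refine ⟨a1, ?_, fun h => absurd (hWW' (subset_closure h)) hwW'⟩
      simp only [hz, smul_zero, add_zero]
      have := mul_nonneg hs.1 hδ.le
      linarith

theorem symmetric_deformation_lemma
    [CompleteSpace X]
    (Ψ : X → EReal) (Φ : X → ℝ)
    -- (Ψ1)
    (hΨ0 : Ψ 0 = 0)
    (hΨnn : ∀ u : X, 0 ≤ Ψ u)
    (hΨlsc : LowerSemicontinuous Ψ)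
    (hΨconv : ∀ u v : X, ∀ a b : ℝ, 0 ≤ a → 0 ≤ b → a + b = 1 →
      Ψ (a • u + b • v) ≤ (a : EReal) * Ψ u + (b : EReal) * Ψ v)
    -- (Φ1)
    (hΦ : ContDiff ℝ 1 Φ)
    -- (E)
    (hΨeven : ∀ u : X, Ψ (-u) = Ψ u)
    (hΦeven : ∀ u : X, Φ (-u) = Φ u)
    -- the data
    (lam : ℝ) (hlam : 0 < lam)
    (A : Set X) (hAclosed : IsClosed A) (hAbdd : IsBounded A) (hAsymm : -A = A)
    (c σ : ℝ) (hσ : 0 < σ)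
    (δ₀ : ℝ) (hδ₀ : 0 < δ₀)
    -- on 𝒜 = A ∩ {c − 3σ ≤ I_λ ≤ c + 3σ} there are strictly descent directions
    (hdesc : ∀ u ∈ A ∩ {w : X | ((c - 3 * σ : ℝ) : EReal) ≤ ILam Ψ Φ lam w ∧
        ILam Ψ Φ lam w ≤ ((c + 3 * σ : ℝ) : EReal)},
      ∃ v : X, v ≠ u ∧
        (lam : EReal) * (Ψ v - Ψ u) - ((fderiv ℝ Φ u (v - u) : ℝ) : EReal) <
          ((-(5 * δ₀ * ‖v - u‖) : ℝ) : EReal))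
    -- K ⊂ 𝒜 symmetric and relatively compact
    (K : Set X) (hKsymm : -K = K)
    (hK : K ⊆ A ∩ {w : X | ((c - 3 * σ : ℝ) : EReal) ≤ ILam Ψ Φ lam w ∧
        ILam Ψ Φ lam w ≤ ((c + 3 * σ : ℝ) : EReal)})
    (hKcomp : IsCompact (closure K)) :
    ∃ (W W' : Set X), IsOpen W ∧ IsOpen W' ∧ -W = W ∧ -W' = W' ∧
      closure K ⊆ W ∧ closure W ⊆ W' ∧
      ∃ s₀ : ℝ, 0 < s₀ ∧ ∃ η : ℝ → X → X,
        ContinuousOn (fun p : ℝ × X => η p.1 p.2) (Ici 0 ×ˢ univ) ∧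
        -- (i)
        (∀ s ∈ Ici (0 : ℝ), ∀ w : X, ‖η s w - w‖ ≤ s) ∧
        (∀ s ∈ Ici (0 : ℝ), ∀ w : X, η s (-w) = - η s w) ∧
        (∀ s ∈ Ici (0 : ℝ), ∀ w : X, w ∉ W' → η s w = w) ∧
        -- (ii)
        (∀ s ∈ Icc 0 s₀, ∀ w : X,
          ILam Ψ Φ lam (η s w) ≤ ILam Ψ Φ lam w + ((δ₀ * s : ℝ) : EReal)) ∧
        -- (iii)
        (∀ s ∈ Icc 0 s₀, ∀ w ∈ W, ((c - σ : ℝ) : EReal) ≤ ILam Ψ Φ lam w →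
          ILam Ψ Φ lam (η s w) ≤ ILam Ψ Φ lam w - ((2 * δ₀ * s : ℝ) : EReal)) := by
  set D : Set X := {u | Ψ u ≠ ⊤} with hD
  set p : X → ℝ := fun u => (Ψ u).toReal with hp
  have hbot : ∀ u, Ψ u ≠ ⊥ := fun u h => by
    have := hΨnn u
    rw [h] at this
    simp at this
  have hpD : ∀ u ∈ D, Ψ u = ((p u : ℝ) : EReal) := fun u hu =>
    (EReal.coe_toReal hu (hbot u)).symm
  have hID : ∀ u ∈ D, ILam Ψ Φ lam u = ((lam * p u - Φ u : ℝ) : EReal) := fun u hu => by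
    rw [ILam, hpD u hu]; push_cast; rfl
  have hItop : ∀ u, u ∉ D → ILam Ψ Φ lam u = ⊤ := fun u hu => by
    have h : Ψ u = ⊤ := by simpa [hD] using hu
    rw [ILam, h, EReal.coe_mul_top_of_pos hlam, EReal.top_sub_coe]
  have hcv : ∀ u ∈ D, ∀ v ∈ D, ∀ a b : ℝ, 0 ≤ a → 0 ≤ b → a + b = 1 →
      a • u + b • v ∈ D ∧ p (a • u + b • v) ≤ a * p u + b * p v := by
    intro u hu v hv a b ha hb hab
    have h := hΨconv u v a b ha hb hab
    rw [hpD u hu, hpD v hv] at h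
    have h' : Ψ (a • u + b • v) ≤ ((a * p u + b * p v : ℝ) : EReal) := by
      push_cast; exact h
    have hm : a • u + b • v ∈ D := ne_top_of_le_ne_top (EReal.coe_ne_top _) h'
    rw [hpD _ hm] at h'
    exact ⟨hm, EReal.coe_le_coe_iff.1 h'⟩
  have hconv : ConvexOn ℝ D (fun u => lam * p u) := by
    refine ⟨fun u hu v hv a b ha hb hab => (hcv u hu v hv a b ha hb hab).1,
      fun u hu v hv a b ha hb hab => ?_⟩
    have := mul_le_mul_of_nonneg_left (hcv u hu v hv a b ha hb hab).2 hlam.le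
    simp only [smul_eq_mul]
    linarith
  have hlsc : ∀ u ∈ D, ∀ ε > 0, ∀ᶠ w in 𝓝 u, w ∈ D → lam * p u - ε < lam * p w := by
    intro u hu ε hε
    have h1 : ((p u - ε / lam : ℝ) : EReal) < Ψ u := by
      rw [hpD u hu, EReal.coe_lt_coe_iff]
      have : 0 < ε / lam := by positivity
      linarith
    filter_upwards [hΨlsc u _ h1] with w hw hwD
    rw [hpD w hwD, gt_iff_lt, EReal.coe_lt_coe_iff] at hw
    have h2 := mul_lt_mul_of_pos_left hw hlam
    have h3 : lam * (ε / lam) = ε := by field_simp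
    linarith
  have hcl : ∀ u ∈ closure K, u ∈ A ∧ u ∈ D ∧ lam * p u - Φ u ≤ c + 3 * σ := by
    intro u hu
    have hKA : closure K ⊆ A := closure_minimal (fun x hx => (hK hx).1) hAclosed
    have hle : Ψ u ≤ (((c + 3 * σ + Φ u) / lam : ℝ) : EReal) := by
      by_contra! hlt
      obtain ⟨q, hq1, hq2⟩ := EReal.lt_iff_exists_real_btwn.1 hlt
      rw [EReal.coe_lt_coe_iff, div_lt_iff₀ hlam] at hq1
      have e2 : ∀ᶠ w in 𝓝 u, Φ w < q * lam - (c + 3 * σ) :=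
        hΦ.continuous.continuousAt.eventually (gt_mem_nhds (by linarith))
      obtain ⟨w, hwK, hw1, hw2⟩ :=
        ((mem_closure_iff_frequently.1 hu).and_eventually ((hΨlsc u _ hq2).and e2)).exists
      have hwI := (hK hwK).2.2
      have hwD : w ∈ D := by
        by_contra hn
        rw [hItop w hn] at hwI
        exact EReal.coe_ne_top _ (top_le_iff.1 hwI)
      rw [hID w hwD, EReal.coe_le_coe_iff] at hwI
      rw [hpD w hwD, gt_iff_lt, EReal.coe_lt_coe_iff] at hw1
      have := mul_lt_mul_of_pos_left hw1 hlam
      linarith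
    have hm : u ∈ D := ne_top_of_le_ne_top (EReal.coe_ne_top _) hle
    rw [hpD u hm, EReal.coe_le_coe_iff, le_div_iff₀ hlam] at hle
    exact ⟨hKA hu, hm, by linarith⟩
  have hdesc' : ∀ u ∈ closure K, c - 3 * σ ≤ lam * p u - Φ u → ∃ v ∈ D, v ≠ u ∧
      lam * p v - lam * p u - fderiv ℝ Φ u (v - u) < -(5 * δ₀ * ‖v - u‖) := by
    intro u hu hc
    obtain ⟨h1, h2, h3⟩ := hcl u hu
    obtain ⟨v, hv, hlt⟩ := hdesc u ⟨h1, by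
      simp only [mem_ofPred_eq, hID u h2, EReal.coe_le_coe_iff]
      exact ⟨hc, h3⟩⟩
    have hvD : v ∈ D := by
      intro h
      rw [h, hpD u h2, EReal.top_sub_coe, EReal.coe_mul_top_of_pos hlam, EReal.top_sub_coe] at hlt
      simp at hlt
    refine ⟨v, hvD, hv, ?_⟩
    rw [hpD u h2, hpD v hvD] at hlt
    have : ((lam * (p v - p u) - fderiv ℝ Φ u (v - u) : ℝ) : EReal) <
        ((-(5 * δ₀ * ‖v - u‖) : ℝ) : EReal) := by
      refine lt_of_eq_of_lt ?_ hlt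
      simp only [EReal.coe_sub, EReal.coe_mul]
    rw [EReal.coe_lt_coe_iff] at this
    linarith
  obtain ⟨W, W', a1, a2, a3, a4, a5, a6, s₀, hs₀, η, b1, b2, b3, b4, b5⟩ :=
    sdl_real D (fun u => lam * p u) Φ hΦ hconv hlsc
      (fun u => by simp only [hD, mem_ofPred_eq, hΨeven]) (fun u => by simp only [hp, hΨeven])
      hΦeven c σ δ₀ hσ hδ₀ (closure K) hKcomp (by
        rw [neg_closure, hKsymm])
      (fun u hu => (hcl u hu).2.1) hdesc'
  refine ⟨W, W', a1, a2, a3, a4, a5, a6, s₀, hs₀, η, b1.continuousOn, b2, b3, b4, ?_, ?_⟩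
  · intro s hs w
    by_cases hw : w ∈ D
    · obtain ⟨d1, d2, -⟩ := b5 s hs w hw
      rw [hID w hw, hID _ d1, ← EReal.coe_add, EReal.coe_le_coe_iff]
      exact d2
    · rw [hItop w hw, EReal.top_add_coe]
      exact le_top
  · intro s hs w hwW hc
    by_cases hw : w ∈ D
    · obtain ⟨d1, -, d3⟩ := b5 s hs w hw
      rw [hID w hw, EReal.coe_le_coe_iff] at hc
      rw [hID w hw, hID _ d1, ← EReal.coe_sub, EReal.coe_le_coe_iff]
      exact d3 hwW hc
    · rw [hItop w hw, EReal.top_sub_coe]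
      exact le_top

end
end
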